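/- arXiv:1010.3671 — 2 statements merged into one kernel-verified Lean document; each statement's English description precedes it below -/
import Mathlib

section
/- Let k be a field of characteristic zero, A a smooth commutative k-algebra (formally smooth and of finite presentation over k), I an ideal such that B = A/I is also smooth over k, and E a finitely generated projective B-module, regarded as an A-module via the quotient map. Let N := Hom_B(I/I², B) be the normal module. Then for every p ≥ 0 there is an isomorphism of k-modules Ext^p_A(E, E) ≅ Hom_B(E, (∧^p_B N) ⊗_B E), where Ext is computed in the category of A-modules and ∧^p_B denotes the p-th exterior power over B; equivalently, Ext^p_A(E,E) ≅ (∧^p_B N) ⊗_B End_B(E). -/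
open CategoryTheory TensorProduct

universe u

namespace NormalExt
open Abelian

section Cmp
variable {C : Type*} [Category.{u} C] [Abelian C] [HasExt.{u} C]
  {k : Type u} [CommRing k] [Linear k C]

open CochainComplex.HomComplex in
lemma extMk_zero_inj {X Y : C} (R : ProjectiveResolution X) (f : R.complex.X 0 ⟶ Y)
    (hf : R.complex.d 1 0 ≫ f = 0) (h : R.extMk f 1 rfl hf = 0) : f = 0 := by
  simp only [← R.extEquivCohomologyClass.apply_eq_iff_eq,
    ProjectiveResolution.extEquivCohomologyClass_extMk,
    ProjectiveResolution.extEquivCohomologyClass_zero,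
    CohomologyClass.mk_eq_zero_iff] at h
  rw [Cocycle.toSingleMk_mem_coboundaries_iff _ _ _ _ _ 1 (by simp)] at h
  obtain ⟨g, hg⟩ := h
  have h0 : R.cochainComplex.d (-(0:ℕ)) 1 = 0 := by
    apply Limits.IsZero.eq_of_tgt
    exact R.cochainComplex.isZero_of_isStrictlyLE 0 1 (by simp)
  rw [← cancel_epi (R.cochainComplexXIso (-(0:ℕ)) 0 rfl).hom, ← hg, h0]
  simp

lemma ext_cmp [EnoughProjectives C] (X Y : C) (n : ℕ) :
    Nonempty ((((_root_.Ext k C n).obj (Opposite.op X)).obj Y) ≃ₗ[k] Abelian.Ext X Y n) := by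
  let P := projectiveResolution X
  let K := P.complex.linearYonedaObj k Y
  let e0 : ((_root_.Ext k C n).obj (Opposite.op X)).obj Y ≅ K.homology n := P.isoExt (R := k) n Y
  let e1 : K.homology n ≅ (K.sc n).moduleCatLeftHomologyData.H := (K.sc n).moduleCatHomologyIso
  suffices h : Nonempty ((K.sc n).moduleCatLeftHomologyData.H ≃ₗ[k] Abelian.Ext X Y n) by
    obtain ⟨h⟩ := h
    exact ⟨LinearEquiv.trans (Iso.toLinearEquiv (e0 ≪≫ e1)) h⟩
  have hd : ∀ i j (f : P.complex.X i ⟶ Y), (K.d i j).hom f = P.complex.d j i ≫ f := by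
    intro i j f
    rfl
  have hn : (ComplexShape.up ℕ).next n = n + 1 := by simp
  have key : ∀ f : P.complex.X n ⟶ Y, (K.sc n).g.hom f = 0 ↔ P.complex.d (n+1) n ≫ f = 0 := by
    intro f
    change (K.d n ((ComplexShape.up ℕ).next n)).hom f = 0 ↔ _
    rw [hd, hn]
    rfl
  have keyr : ∀ (f : P.complex.X n ⟶ Y) hf,
     P.extMk f (n+1) rfl hf = 0 → (∃ g, (K.sc n).f.hom g = f) := by
    intro f hf h
    change ∃ g, (K.d ((ComplexShape.up ℕ).prev n) n).hom g = f
    rcases n with _ | q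
    · exact ⟨0, by rw [map_zero]; exact (extMk_zero_inj P f hf h).symm⟩
    · have : (ComplexShape.up ℕ).prev (q+1) = q := by simp
      rw [this]
      exact (P.extMk_eq_zero_iff f _ rfl hf _ rfl).1 h
  have keyl : ∀ (f : P.complex.X n ⟶ Y) hf,
     (∃ g, (K.sc n).f.hom g = f) → P.extMk f (n+1) rfl hf = 0 := by
    intro f hf h
    change ∃ g, (K.d ((ComplexShape.up ℕ).prev n) n).hom g = f at h
    rcases n with _ | q
    · obtain ⟨g, hg⟩ := h
      rw [K.shape _ _ (by simp)] at hg
      have : f = 0 := hg.symm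
      subst this
      simp
    · have : (ComplexShape.up ℕ).prev (q+1) = q := by simp
      rw [this] at h
      exact (P.extMk_eq_zero_iff f _ rfl hf _ rfl).2 h
  have hsm : ∀ (r : k) (f : P.complex.X n ⟶ Y) hf hf',
      P.extMk (r • f) (n+1) rfl hf' = r • P.extMk f (n+1) rfl hf := by
    intro r f hf hf'
    rw [Ext.smul_eq_comp_mk₀, P.extMk_comp_mk₀]
    congr 1
    simp
  let φ : LinearMap.ker (K.sc n).g.hom →ₗ[k] Abelian.Ext X Y n :=
    { toFun f := P.extMk f.1 (n+1) rfl ((key f.1).1 f.2)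
      map_add' f g := (P.add_extMk ..).symm
      map_smul' r f := hsm r f.1 _ _ }
  have hs : Function.Surjective φ := by
    intro x
    obtain ⟨f, hf, rfl⟩ := P.extMk_surjective x (n+1) rfl
    exact ⟨⟨f, (key f).2 hf⟩, rfl⟩
  have hk : LinearMap.range (K.sc n).moduleCatToCycles = LinearMap.ker φ := by
    ext f
    constructor
    · rintro ⟨g, rfl⟩
      exact keyl _ ((key _).1 ((K.sc n).moduleCatToCycles g).2) ⟨g, rfl⟩
    · intro h
      obtain ⟨g, hg⟩ := keyr _ ((key _).1 f.2) h
      exact ⟨g, Subtype.ext hg⟩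
  exact ⟨(Submodule.quotEquivOfEq _ _ hk).trans (φ.quotKerEquivOfSurjective hs)⟩
end Cmp
end NormalExt

namespace NormalExt

section Glob

/-- Maximal-ideal-wise surjectivity. -/
def Dom (A : Type u) [CommRing A] (X Y : Type u) [AddCommGroup X] [AddCommGroup Y]
    [Module A X] [Module A Y] : Prop :=
  ∀ m : Ideal A, m.IsMaximal → ∃ φ : X →ₗ[A] Y, LinearMap.range φ ⊔ m • (⊤ : Submodule A Y) = ⊤

variable {A : Type u} [CommRing A] {X Y : Type u} [AddCommGroup X] [AddCommGroup Y]
    [Module A X] [Module A Y]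

lemma range_top_of_local [Module.Finite A Y] (N : Submodule A Y)
    (h : ∀ m : Ideal A, m.IsMaximal → N ⊔ m • (⊤ : Submodule A Y) = ⊤) : N = ⊤ := by
  by_contra hN
  obtain ⟨M, hM, hNM⟩ := (eq_top_or_exists_le_coatom N).resolve_left hN
  have hs : IsSimpleModule A (Y ⧸ M) := isSimpleModule_iff_isCoatom.2 hM
  have hmax := IsSimpleModule.annihilator_isMaximal (R := A) (M := Y ⧸ M)
  have := h _ hmax
  apply hM.1
  rw [eq_top_iff, ← this]
  refine sup_le hNM ?_
  rw [Submodule.smul_le]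
  intro r hr n _
  have := Module.mem_annihilator.1 hr (M.mkQ n)
  rwa [← map_smul, Submodule.mkQ_apply, Submodule.Quotient.mk_eq_zero] at this

variable (k : Type u) [Field k] [Algebra k A] [Module k X] [Module k Y]
  [IsScalarTower k A X] [IsScalarTower k A Y]

lemma glob1 [Module.Finite A Y] [Module.Finite k X] (h : Dom A X Y) :
    ∃ φ : X →ₗ[A] Y, Function.Surjective φ := by
  classical
  let f : A →ₐ[k] Module.End k X := Algebra.lsmul k k X
  let J : Ideal A := RingHom.ker f
  have hJ : ∀ a ∈ J, ∀ x : X, a • x = 0 := fun a ha x => by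
    have : f a = 0 := ha
    exact congrArg (fun g : Module.End k X => g x) this
  have : Module.Finite k (A ⧸ J) :=
    Module.Finite.of_injective (Ideal.kerLiftAlg f).toLinearMap (Ideal.kerLiftAlg_injective f)
  have : IsArtinianRing (A ⧸ J) := IsArtinianRing.of_finite k _
  let ι := MaximalSpectrum (A ⧸ J)
  have : Fintype ι := Fintype.ofFinite _
  let M : ι → Ideal A := fun i => i.asIdeal.comap (Ideal.Quotient.mk J)
  have hMm : ∀ i, (M i).IsMaximal := fun i => by
    have := i.isMaximal
    exact Ideal.comap_isMaximal_of_surjective _ Ideal.Quotient.mk_surjective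
  have hinj : Function.Injective M := by
    intro i j hij
    ext1
    exact Ideal.comap_injective_of_surjective _ Ideal.Quotient.mk_surjective hij
  have hcop : Pairwise (Function.onFun IsCoprime M) := fun i j hij =>
    Ideal.isCoprime_of_isMaximal (hinj.ne hij)
  choose e he using fun i => Ideal.exists_forall_sub_mem_ideal hcop (fun j => if i = j then 1 else 0)
  choose φ hφ using fun i => h (M i) (hMm i)
  let Φ : X →ₗ[A] Y := ∑ i, e i • φ i
  refine ⟨Φ, LinearMap.range_eq_top.1 (range_top_of_local _ ?_)⟩
  intro m hm
  by_cases hle : J ≤ m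
  · -- one of the `M i`
    have hmm : (m.map (Ideal.Quotient.mk J)).IsMaximal := by
      refine Ideal.IsMaximal.map_of_surjective_of_ker_le Ideal.Quotient.mk_surjective ?_
      rwa [Ideal.mk_ker]
    let i : ι := ⟨m.map (Ideal.Quotient.mk J), hmm⟩
    have hi : M i = m := by
      change (m.map _).comap _ = m
      rw [Ideal.comap_map_of_surjective _ Ideal.Quotient.mk_surjective, ← RingHom.ker_eq_comap_bot,
        Ideal.mk_ker, sup_eq_left]
      exact hle
    refine top_le_iff.1 ((hφ i).ge.trans ?_)
    rw [hi]
    refine sup_le ?_ le_sup_right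
    rintro _ ⟨x, rfl⟩
    have h1 : φ i x = Φ x + (φ i x - Φ x) := by abel
    rw [h1]
    refine Submodule.add_mem_sup ⟨x, rfl⟩ ?_
    have h2 : φ i x - Φ x = ∑ j, ((if j = i then 1 else 0) - e j) • φ j x := by
      simp [Φ, sub_smul]
    rw [h2]
    refine Submodule.sum_mem _ fun j _ => Submodule.smul_mem_smul ?_ trivial
    rw [← hi, ← neg_mem_iff, neg_sub]
    exact he j i
  · obtain ⟨φ0, hφ0⟩ := h m hm
    have hle' : m ⊔ J = ⊤ := by
      by_contra hne
      exact hle ((hm.eq_of_le hne le_sup_left) ▸ le_sup_right)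
    obtain ⟨a, ha, b, hb, hab⟩ := Submodule.mem_sup.1 ((Ideal.eq_top_iff_one _).1 hle')
    refine top_le_iff.1 (hφ0.ge.trans ?_)
    refine sup_le ?_ le_sup_right
    rintro _ ⟨x, rfl⟩
    refine Submodule.mem_sup_right ?_
    have : x = a • x := by
      conv_lhs => rw [← one_smul A x, ← hab, add_smul, hJ b hb, add_zero]
    rw [this, map_smul]
    exact Submodule.smul_mem_smul ha trivial

lemma rank_le_aleph0 [Algebra.FiniteType k A] [Module.Finite A X] :
    Module.rank k X ≤ Cardinal.aleph0 := by
  obtain ⟨n, f, hf⟩ := Algebra.FiniteType.iff_quotient_mvPolynomial''.1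
    (inferInstance : Algebra.FiniteType k A)
  have h1 : Module.rank k A ≤ Cardinal.aleph0 := by
    have := LinearMap.rank_le_of_surjective f.toLinearMap hf
    refine this.trans ?_
    rw [MvPolynomial.rank_eq_lift, Cardinal.lift_le_aleph0]
    exact Cardinal.mk_le_aleph0
  obtain ⟨r, g, hg⟩ := Module.Finite.exists_fin' A X
  have h2 := LinearMap.rank_le_of_surjective (g.restrictScalars k) hg
  refine h2.trans ?_
  rw [rank_pi]
  simp only [Cardinal.sum_const, Cardinal.mk_fin, Cardinal.lift_natCast]
  refine (mul_le_mul' (Cardinal.natCast_lt_aleph0 (n := r)).le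
    (Cardinal.lift_le_aleph0.2 h1)).trans ?_
  simp

theorem glob [Algebra.FiniteType k A] [Module.Finite A X] [Module.Finite A Y]
    (h1 : Dom A X Y) (h2 : Dom A Y X) : Nonempty (X ≃ₗ[k] Y) := by
  by_cases hX : Module.Finite k X
  · obtain ⟨f, hf⟩ := glob1 k h1
    have hY : Module.Finite k Y := Module.Finite.of_surjective (f.restrictScalars k) hf
    obtain ⟨g, hg⟩ := glob1 k h2
    exact nonempty_linearEquiv_of_rank_eq (le_antisymm
      (LinearMap.rank_le_of_surjective (g.restrictScalars k) hg)
      (LinearMap.rank_le_of_surjective (f.restrictScalars k) hf))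
  · have hY : ¬ Module.Finite k Y := fun hY => by
      obtain ⟨g, hg⟩ := glob1 k h2
      exact hX (Module.Finite.of_surjective (g.restrictScalars k) hg)
    rw [← Module.rank_lt_aleph0_iff, not_lt] at hX hY
    exact nonempty_linearEquiv_of_rank_eq
      (((rank_le_aleph0 (A := A) k).antisymm hX).trans ((rank_le_aleph0 (A := A) k).antisymm hY).symm)

end Glob
end NormalExt

namespace NormalExt
open Abelian

section Loc
variable {A : Type u} [CommRing A] (S : Submonoid A)

lemma locF_ext (M : ModuleCat.{u} A) {Q : ModuleCat.{u} (Localization S)}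
    (g h : (ModuleCat.localizedModuleFunctor S).obj M ⟶ Q)
    (H : ∀ x : M, g.hom (M.localizedModuleMkLinearMap S x) =
      h.hom (M.localizedModuleMkLinearMap S x)) : g = h := by
  ext x
  change M.localizedModule S at x
  obtain ⟨⟨y, s⟩, rfl⟩ := IsLocalizedModule.mk'_surjective S (M.localizedModuleMkLinearMap S) x
  have hu := IsLocalization.map_units (Localization S) s
  have h1 : (algebraMap A (Localization S) s) •
      (IsLocalizedModule.mk' (M.localizedModuleMkLinearMap S) y s) =
        M.localizedModuleMkLinearMap S y := by
    rw [algebraMap_smul]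
    exact IsLocalizedModule.mk'_cancel' (M.localizedModuleMkLinearMap S) y s
  apply hu.smul_left_cancel.mp
  let g' : M.localizedModule S →ₗ[Localization S] Q := g.hom
  let h' : M.localizedModule S →ₗ[Localization S] Q := h.hom
  change _ • g' _ = _ • h' _
  rw [← map_smul, ← map_smul]
  change g' (_ • (IsLocalizedModule.mk' (M.localizedModuleMkLinearMap S) y s)) =
    h' (_ • (IsLocalizedModule.mk' (M.localizedModuleMkLinearMap S) y s))
  rw [h1]
  exact H y

lemma locF_apply {M N : ModuleCat.{u} A} (f : M ⟶ N) (x : M) :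
    ((ModuleCat.localizedModuleFunctor S).map f).hom (M.localizedModuleMkLinearMap S x) =
      N.localizedModuleMkLinearMap S (f.hom x) := by
  simp only [ModuleCat.localizedModuleFunctor_map, ModuleCat.localizedModuleMap,
    ModuleCat.hom_ofHom]
  exact IsLocalizedModule.map_apply S (M.localizedModuleMkLinearMap S)
    (N.localizedModuleMkLinearMap S) f.hom x

lemma locF_smul (M : ModuleCat.{u} A) (a : A) :
    (ModuleCat.localizedModuleFunctor S).map (a • 𝟙 M) =
      (algebraMap A (Localization S) a) •
        𝟙 ((ModuleCat.localizedModuleFunctor S).obj M) := by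
  apply locF_ext
  intro x
  rw [locF_apply]
  have : (M.localizedModuleMkLinearMap S) (a • x) =
    (algebraMap A (Localization S) a) • (M.localizedModuleMkLinearMap S x) := by
    rw [map_smul, algebraMap_smul]
  exact this

lemma mapExt_smul {M N : ModuleCat.{u} A} {p : ℕ} (a : A) (x : Ext M N p) :
    (a • x).mapExactFunctor (ModuleCat.localizedModuleFunctor S) =
      (algebraMap A (Localization S) a) •
        x.mapExactFunctor (ModuleCat.localizedModuleFunctor S) := by
  rw [Ext.smul_eq_comp_mk₀, Ext.mapExactFunctor_comp, Ext.mapExactFunctor_mk₀, locF_smul,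
    ← Ext.smul_eq_comp_mk₀]

lemma locF_projective (P : ModuleCat.{u} A) [Module.Projective A P] :
    Projective ((ModuleCat.localizedModuleFunctor S).obj P) := by
  have hP : Module.Projective (Localization S) (P.localizedModule S) :=
    Module.projective_of_isLocalizedModule S (P.localizedModuleMkLinearMap S)
  exact (IsProjective.iff_projective _).1 hP

lemma loc_ext_step {C D : Type*} [Category.{u} C] [Category.{u} D] [Abelian C] [Abelian D]
    [HasExt.{u} C] [HasExt.{u} D] (F : C ⥤ D) [F.Additive]
    [Limits.PreservesFiniteLimits F] [Limits.PreservesFiniteColimits F]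
    {R : Type u} [CommRing R] [Algebra A R] [Linear A C] [Linear R D]
    (hF : ∀ (X : C) (a : A), F.map (a • 𝟙 X) = algebraMap A R a • 𝟙 (F.obj X))
    (T : ShortComplex C) (hT : T.ShortExact) [Projective T.X₂] [Projective (F.obj T.X₂)]
    (N : C) (p : ℕ)
    (ihK1 : ∀ y : Ext (F.obj T.X₁) (F.obj N) p, ∃ s ∈ S, ∃ x : Ext T.X₁ N p,
      (algebraMap A R s) • y = x.mapExactFunctor F)
    (ihK2 : ∀ x : Ext T.X₁ N p, x.mapExactFunctor F = 0 → ∃ s ∈ S, s • x = 0)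
    (ihF1 : ∀ y : Ext (F.obj T.X₂) (F.obj N) p, ∃ s ∈ S, ∃ x : Ext T.X₂ N p,
      (algebraMap A R s) • y = x.mapExactFunctor F) :
    (∀ y : Ext (F.obj T.X₃) (F.obj N) (p + 1), ∃ s ∈ S, ∃ x : Ext T.X₃ N (p + 1),
      (algebraMap A R s) • y = x.mapExactFunctor F) ∧
    (∀ x : Ext T.X₃ N (p + 1), x.mapExactFunctor F = 0 → ∃ s ∈ S, s • x = 0) := by
  have hS' := hT.map_of_exact F
  have hP : Projective (T.map F).X₂ := inferInstanceAs (Projective (F.obj T.X₂))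
  have hsm : ∀ (a : A) {X : C} {q : ℕ} (x : Ext X N q), (a • x).mapExactFunctor F =
      algebraMap A R a • x.mapExactFunctor F := fun a X q x => by
    rw [Ext.smul_eq_comp_mk₀, Ext.mapExactFunctor_comp, Ext.mapExactFunctor_mk₀, hF,
      ← Ext.smul_eq_comp_mk₀]
  constructor
  · intro y
    obtain ⟨z, rfl⟩ := Ext.contravariant_sequence_exact₃ hS' _ y (Ext.eq_zero_of_projective _)
      (add_comm 1 p)
    obtain ⟨s, hs, w, hw⟩ := ihK1 z
    refine ⟨s, hs, hT.extClass.comp w (add_comm 1 p), ?_⟩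
    rw [Ext.mapExactFunctor_comp, Ext.mapExactFunctor_extClass, ← hw]
    exact (Ext.comp_smul _ _ _ _).symm
  · intro x hx
    obtain ⟨w, rfl⟩ := Ext.contravariant_sequence_exact₃ hT _ x (Ext.eq_zero_of_projective _)
      (add_comm 1 p)
    rw [Ext.mapExactFunctor_comp, Ext.mapExactFunctor_extClass] at hx
    obtain ⟨z, hz⟩ := Ext.contravariant_sequence_exact₁ hS' _ _ (add_comm 1 p) hx
    obtain ⟨s, hs, v, hv⟩ := ihF1 z
    obtain ⟨t, ht, h⟩ := ihK2 (s • w - (Ext.mk₀ T.f).comp v (zero_add _)) (by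
      rw [← Functor.mapExtAddHom_apply, map_sub, Functor.mapExtAddHom_apply,
        Functor.mapExtAddHom_apply, hsm, ← hz, Ext.mapExactFunctor_comp, ← hv,
        Ext.mapExactFunctor_mk₀, sub_eq_zero]
      exact (Ext.comp_smul _ _ _ _).symm)
    refine ⟨t * s, S.mul_mem ht hs, ?_⟩
    rw [smul_sub, sub_eq_zero, smul_smul] at h
    rw [← Ext.comp_smul, h, Ext.comp_smul,
      ← Ext.comp_assoc _ _ _ (add_zero 1) (zero_add p) (by lia)]
    simp

lemma loc_ext [IsNoetherianRing A] (N : ModuleCat.{u} A) (p : ℕ) :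
    ∀ (M : ModuleCat.{u} A) [Module.Finite A M],
    (∀ y : Ext ((ModuleCat.localizedModuleFunctor S).obj M)
        ((ModuleCat.localizedModuleFunctor S).obj N) p,
      ∃ s ∈ S, ∃ x : Ext M N p, (algebraMap A (Localization S) s) • y =
        x.mapExactFunctor (ModuleCat.localizedModuleFunctor S)) ∧
    (∀ x : Ext M N p, x.mapExactFunctor (ModuleCat.localizedModuleFunctor S) = 0 →
      ∃ s ∈ S, s • x = 0) := by
  induction p with
  | zero =>
    intro M _
    have : Module.FinitePresentation A M := Module.finitePresentation_of_finite A M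
    constructor
    · intro y
      obtain ⟨g, rfl⟩ := (Ext.mk₀_bijective _ _).2 y
      let g' : M.localizedModule S →ₗ[Localization S] N.localizedModule S := g.hom
      obtain ⟨h, s, hs⟩ := Module.FinitePresentation.exists_lift_of_isLocalizedModule S
        (N.localizedModuleMkLinearMap S)
        ((g'.restrictScalars A).comp (M.localizedModuleMkLinearMap S))
      refine ⟨s, s.2, Ext.mk₀ (ModuleCat.ofHom h), ?_⟩
      rw [Ext.mapExactFunctor_mk₀, ← Ext.mk₀_smul]
      congr 1
      apply locF_ext
      intro x
      rw [locF_apply]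
      have := LinearMap.congr_fun hs x
      refine Eq.trans ?_ this.symm
      change (algebraMap A (Localization S) s) • g' _ = (s : A) • g' _
      rw [algebraMap_smul]
    · intro x hx
      obtain ⟨g, rfl⟩ := (Ext.mk₀_bijective _ _).2 x
      rw [Ext.mapExactFunctor_mk₀, ← Ext.mk₀_zero] at hx
      have hx := (Ext.mk₀_bijective _ _).1 hx
      obtain ⟨s, hs⟩ := Module.Finite.exists_smul_of_comp_eq_of_isLocalizedModule S
        (N.localizedModuleMkLinearMap S) g.hom 0 (by
          ext y
          have := locF_apply S g y
          rw [hx] at this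
          exact this.symm.trans (map_zero (N.localizedModuleMkLinearMap S)).symm)
      refine ⟨s, s.2, ?_⟩
      rw [← Ext.mk₀_smul, ← Ext.mk₀_zero]
      congr 1
      ext y
      exact LinearMap.congr_fun hs y |>.trans (smul_zero _)
  | succ p ih =>
    intro M _
    obtain ⟨F, _, _, _, _, f, surjf⟩ := Module.exists_finite_presentation A M
    have hS := LinearMap.shortExact_shortComplexKer surjf
    have hS' := hS.map_of_exact (ModuleCat.localizedModuleFunctor S)
    have : Module.Free A (f.shortComplexKer).X₂ := inferInstanceAs (Module.Free A F)
    have : Module.Finite A (f.shortComplexKer).X₂ := inferInstanceAs (Module.Finite A F)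
    have : Module.Finite A (f.shortComplexKer).X₁ :=
      inferInstanceAs (Module.Finite A (LinearMap.ker f))
    have := locF_projective S (f.shortComplexKer).X₂
    exact loc_ext_step S (ModuleCat.localizedModuleFunctor S) (locF_smul S) _ hS N p
      (ih (f.shortComplexKer).X₁).1 (ih (f.shortComplexKer).X₁).2 (ih (f.shortComplexKer).X₂).1
end Loc
end NormalExt

namespace NormalExt
open Abelian

section ExtStep
variable {R : Type u} [CommRing R] (J : Ideal R)

/-- `X` is free of rank `c` over `R ⧸ J`. -/
def FreeQ (X : Type u) [AddCommGroup X] [Module R X] (c : ℕ) : Prop :=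
  Nonempty (X ≃ₗ[R] (Fin c → R ⧸ J))

variable {J}

lemma exists_liftJ {X : Type u} [AddCommGroup X] [Module R X]
    (hX : ∀ r ∈ J, ∀ x : X, r • x = 0) (y : X) :
    ∃ L : (R ⧸ J) →ₗ[R] X, ∀ r, L (Ideal.Quotient.mk J r) = r • y :=
  ⟨Submodule.liftQ J (LinearMap.toSpanSingleton R X y)
    (fun r hr => LinearMap.mem_ker.2 (hX r hr y)), fun _ => rfl⟩

lemma freeQ_of_exact {U X V : Type u} [AddCommGroup U] [AddCommGroup X] [AddCommGroup V]
    [Module R U] [Module R X] [Module R V] {a b : ℕ} (hU : FreeQ J U a) (hV : FreeQ J V b)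
    (hX : ∀ r ∈ J, ∀ x : X, r • x = 0)
    (f : U →ₗ[R] X) (g : X →ₗ[R] V) (hf : Function.Injective f) (hg : Function.Surjective g)
    (hfg : Function.Exact f g) : FreeQ J X (a + b) := by
  classical
  obtain ⟨eU⟩ := hU
  obtain ⟨eV⟩ := hV
  choose y hy using fun j : Fin b => hg (eV.symm (Pi.single j 1))
  choose L hL using fun j => exists_liftJ hX (y j)
  let s0 : (Fin b → R ⧸ J) →ₗ[R] X := ∑ j, L j ∘ₗ LinearMap.proj j
  have hs0 : ∀ v, eV (g (s0 v)) = v := by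
    intro v
    ext i
    have : ∀ j (q : R ⧸ J), eV (g (L j q)) = Pi.single j q := by
      intro j q
      obtain ⟨r, rfl⟩ := Ideal.Quotient.mk_surjective q
      rw [hL, map_smul, hy, map_smul, LinearEquiv.apply_symm_apply, ← Pi.single_smul]
      congr 1
      rw [← Ideal.Quotient.algebraMap_eq, Algebra.smul_def, mul_one]
    simp only [s0, LinearMap.sum_apply, LinearMap.comp_apply, map_sum, this, LinearMap.proj_apply]
    rw [Finset.sum_apply]
    simp [Pi.single_apply]
  let s : V →ₗ[R] X := s0 ∘ₗ eV.toLinearMap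
  have hs : g ∘ₗ s = LinearMap.id := by
    ext v
    apply eV.injective
    simpa [s] using hs0 (eV v)
  obtain ⟨e, -⟩ := Function.Exact.splitSurjectiveEquiv hfg hf ⟨s, hs⟩
  exact ⟨e.trans ((LinearEquiv.prodCongr eU eV).trans
    ((LinearEquiv.sumArrowLequivProdArrow _ _ R _).symm.trans
      (LinearEquiv.funCongrLeft R _ finSumFinEquiv.symm)))⟩

lemma ext_killed {T : ModuleCat.{u} R} (hT : ∀ r ∈ J, ∀ x : T, r • x = 0) (M : ModuleCat.{u} R)
    {p : ℕ} (r : R) (hr : r ∈ J) (x : Ext M T p) : r • x = 0 := by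
  rw [Ext.smul_eq_comp_mk₀]
  have : r • 𝟙 T = 0 := by
    ext t
    exact hT r hr t
  rw [this]
  simp

lemma ext_step {T : ModuleCat.{u} R} (hT : ∀ r ∈ J, ∀ x : T, r • x = 0)
    {M M' : ModuleCat.{u} R} {x : R} (hx : x ∈ J) (g : M ⟶ M') (w : (x • 𝟙 M) ≫ g = 0)
    (hS : (ShortComplex.mk (x • 𝟙 M) g w).ShortExact) :
    (∀ c, FreeQ J (Ext M T 0) c → FreeQ J (Ext M' T 0) c) ∧
    (∀ p a b, FreeQ J (Ext M T p) a → FreeQ J (Ext M T (p+1)) b → 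
      FreeQ J (Ext M' T (p+1)) (a+b)) := by
  have hzero : ∀ {p} (y : Ext M T p), (Ext.mk₀ (x • 𝟙 M)).comp y (zero_add p) = 0 := by
    intro p y
    rw [Ext.mk₀_smul, Ext.smul_comp, Ext.mk₀_id_comp, ext_killed hT M x hx]
  have hsurj : ∀ {p} (y : Ext M T p), ∃ z : Ext M' T p, (Ext.mk₀ g).comp z (zero_add p) = y :=
    fun y => Ext.contravariant_sequence_exact₂ hS T y (hzero y)
  constructor
  · rintro c ⟨e⟩
    have : Epi g := hS.epi_g
    let f : Ext M' T 0 →ₗ[R] Ext M T 0 := 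
      { toFun z := (Ext.mk₀ g).comp z (zero_add 0)
        map_add' := by simp
        map_smul' := by simp }
    have hf : Function.Bijective f :=
      ⟨fun a b hab => Ext.precomp_mk₀_injective_of_epi T g hab, hsurj⟩
    exact ⟨(LinearEquiv.ofBijective f hf).trans e⟩
  · intro p a b ha hb
    let f : Ext M T p →ₗ[R] Ext M' T (p+1) :=
      { toFun z := hS.extClass.comp z (add_comm 1 p)
        map_add' := by simp
        map_smul' := by simp }
    let g' : Ext M' T (p+1) →ₗ[R] Ext M T (p+1) :=
      { toFun z := (Ext.mk₀ g).comp z (zero_add _)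
        map_add' := by simp
        map_smul' := by simp }
    refine freeQ_of_exact ha hb (ext_killed hT M') f g' ?_ hsurj ?_
    · rw [injective_iff_map_eq_zero]
      intro y hy
      obtain ⟨z, hz⟩ := Ext.contravariant_sequence_exact₁ hS T y (add_comm 1 p) hy
      rw [← hz]
      exact hzero z
    · intro y
      constructor
      · intro hy
        exact Ext.contravariant_sequence_exact₃ hS T y hy (add_comm 1 p)
      · rintro ⟨z, rfl⟩
        change (Ext.mk₀ g).comp (hS.extClass.comp z (add_comm 1 p)) (zero_add (p+1)) = 0
        exact hS.comp_extClass_assoc z (add_comm 1 p)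


lemma ext_congr_left {M M' : ModuleCat.{u} R} (T : ModuleCat.{u} R) (e : M ≅ M') (p : ℕ) :
    Nonempty (Ext M T p ≃ₗ[R] Ext M' T p) := by
  let f : Ext M T p →ₗ[R] Ext M' T p :=
      { toFun z := (Ext.mk₀ e.inv).comp z (zero_add p)
        map_add' := by simp
        map_smul' := by simp }
  let g : Ext M' T p →ₗ[R] Ext M T p :=
      { toFun z := (Ext.mk₀ e.hom).comp z (zero_add p)
        map_add' := by simp
        map_smul' := by simp }
  refine ⟨LinearEquiv.ofLinearMap f g ?_ ?_⟩
  · ext z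
    simp [f, g]
  · ext z
    simp [f, g]

lemma freeQ_pi {T : Type u} [AddCommGroup T] [Module R T] {t : ℕ} (hT : FreeQ J T t) (r : ℕ) :
    FreeQ J (Fin r → T) (r * t) := by
  obtain ⟨e⟩ := hT
  exact ⟨(LinearEquiv.piCongrRight fun _ => e).trans
    ((LinearEquiv.curry R _ _ _).symm.trans (LinearEquiv.funCongrLeft R _ finProdFinEquiv.symm))⟩

lemma ext_base {T : ModuleCat.{u} R} {t : ℕ} (hT : FreeQ J T t) (r p : ℕ) :
    FreeQ J (Ext (ModuleCat.of R (Fin r → R ⧸ (⊥ : Ideal R))) T p)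
      (Nat.choose 0 p * (r * t)) := by
  let e : (Fin r → R ⧸ (⊥ : Ideal R)) ≃ₗ[R] (Fin r → R) :=
    LinearEquiv.piCongrRight fun _ => Submodule.quotEquivOfEqBot _ rfl
  obtain ⟨e'⟩ := ext_congr_left T e.toModuleIso p
  rcases p with _ | p
  · obtain ⟨f⟩ := freeQ_pi hT r
    let g1 : Ext (ModuleCat.of R (Fin r → R)) T 0 ≃ₗ[R] (ModuleCat.of R (Fin r → R) ⟶ T) :=
      Ext.linearEquiv₀ (R := R)
    let g2 : (ModuleCat.of R (Fin r → R) ⟶ T) ≃ₗ[R] ((Fin r → R) →ₗ[R] T) :=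
      ModuleCat.homLinearEquiv (S := R)
    let g3 : ((Fin r → R) →ₗ[R] T) ≃ₗ[R] (Fin r → T) := (Module.piEquiv (Fin r) R T).symm
    let g4 : (Fin (r * t) → R ⧸ J) ≃ₗ[R] (Fin (Nat.choose 0 0 * (r * t)) → R ⧸ J) :=
      LinearEquiv.funCongrLeft R _ (finCongr (by simp))
    exact ⟨(((e'.trans g1).trans g2).trans g3).trans (f.trans g4)⟩
  · have : Projective (ModuleCat.of R (Fin r → R)) := (IsProjective.iff_projective _).1 inferInstance
    have : Subsingleton (Ext (ModuleCat.of R (Fin r → R)) T (p+1)) :=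
      subsingleton_of_forall_eq 0 Ext.eq_zero_of_projective
    have : Subsingleton (Ext (ModuleCat.of R (Fin r → R ⧸ (⊥ : Ideal R))) T (p+1)) :=
      e'.toEquiv.subsingleton
    have : IsEmpty (Fin (Nat.choose 0 (p+1) * (r * t))) := by simp; infer_instance
    exact ⟨LinearEquiv.ofSubsingleton _ _⟩

lemma ext_koszul {T : ModuleCat.{u} R} {t : ℕ} (hT : FreeQ J T t) (r n : ℕ) (x : ℕ → R)
    (K : ℕ → Ideal R) (h0 : K 0 = ⊥) (hK : ∀ i < n, K (i+1) = K i ⊔ Ideal.span {x i})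
    (hx : ∀ i < n, x i ∈ J) (hreg : ∀ i < n, ∀ a, x i * a ∈ K i → a ∈ K i) :
    ∀ i ≤ n, ∀ p, FreeQ J (Ext (ModuleCat.of R (Fin r → R ⧸ K i)) T p)
      (Nat.choose i p * (r * t)) := by
  have hT' : ∀ r ∈ J, ∀ x : T, r • x = 0 := by
    intro r hr y
    obtain ⟨e⟩ := hT
    apply e.injective
    rw [map_smul, map_zero]
    ext i
    obtain ⟨b, hb⟩ := Ideal.Quotient.mk_surjective (e y i)
    rw [Pi.smul_apply, ← hb, Pi.zero_apply]
    change Ideal.Quotient.mk J (r * b) = 0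
    rw [Ideal.Quotient.eq_zero_iff_mem]
    exact J.mul_mem_right _ hr
  intro i
  induction i with
  | zero => intro _ p; rw [h0]; exact ext_base hT r p
  | succ i ih =>
    intro hi
    have hi' : i < n := hi
    have hle : K i ≤ K (i+1) := hK i hi' ▸ le_sup_left
    let G : (Fin r → R ⧸ K i) →ₗ[R] (Fin r → R ⧸ K (i+1)) :=
      LinearMap.pi fun j => (Submodule.factor hle) ∘ₗ LinearMap.proj j
    have w : (x i • 𝟙 (ModuleCat.of R (Fin r → R ⧸ K i))) ≫ ModuleCat.ofHom G = 0 := by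
      ext1
      apply LinearMap.ext
      intro y
      change G (x i • y) = 0
      ext j
      obtain ⟨b, hb⟩ := Ideal.Quotient.mk_surjective (y j)
      change Submodule.factor hle (x i • y j) = 0
      rw [← hb]
      change Ideal.Quotient.mk _ (x i * b) = 0
      rw [Ideal.Quotient.eq_zero_iff_mem, hK i hi']
      exact Ideal.mul_mem_right _ _ (Ideal.mem_sup_right (Ideal.mem_span_singleton_self _))
    have hS : (ShortComplex.mk _ _ w).ShortExact := by
      apply ShortComplex.ShortExact.mk' 
      · rw [ShortComplex.moduleCat_exact_iff]
        intro y hy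
        change ∃ z : (Fin r → R ⧸ K i), x i • z = y
        have hy' : G y = 0 := hy
        have : ∀ j, ∃ z : R ⧸ K i, x i • z = (y : Fin r → R ⧸ K i) j := by
          intro j
          have hj : Submodule.factor hle ((y : Fin r → R ⧸ K i) j) = 0 := congrFun hy' j
          obtain ⟨b, hb⟩ := Ideal.Quotient.mk_surjective ((y : Fin r → R ⧸ K i) j)
          rw [← hb] at hj ⊢
          have hj' : Ideal.Quotient.mk (K (i+1)) b = 0 := hj
          rw [Ideal.Quotient.eq_zero_iff_mem, hK i hi', Submodule.mem_sup] at hj'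
          obtain ⟨c, hc, d, hd, rfl⟩ := hj'
          obtain ⟨d, rfl⟩ := Ideal.mem_span_singleton'.1 hd
          refine ⟨Ideal.Quotient.mk _ d, ?_⟩
          rw [map_add, (Ideal.Quotient.eq_zero_iff_mem).2 hc, zero_add]
          change Ideal.Quotient.mk _ (x i * d) = _
          rw [mul_comm]
        choose z hz using this
        exact ⟨z, funext hz⟩
      · rw [ModuleCat.mono_iff_injective, injective_iff_map_eq_zero]
        intro y hy
        have hy' : ∀ j, x i • (y : Fin r → R ⧸ K i) j = 0 := fun j => congrFun hy j
        change (y : Fin r → R ⧸ K i) = 0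
        ext j
        have := hy' j
        obtain ⟨b, hb⟩ := Ideal.Quotient.mk_surjective ((y : Fin r → R ⧸ K i) j)
        rw [← hb] at this ⊢
        have h2 : Ideal.Quotient.mk (K i) (x i * b) = 0 := this
        rw [Ideal.Quotient.eq_zero_iff_mem] at h2
        exact (Ideal.Quotient.eq_zero_iff_mem).2 (hreg i hi' b h2)
      · rw [ModuleCat.epi_iff_surjective]
        intro y
        have : ∀ j, ∃ z : R ⧸ K i, Submodule.factor hle z = (y : Fin r → R ⧸ K (i+1)) j :=
          fun j => Submodule.factor_surjective hle _
        choose z hz using this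
        exact ⟨z, funext hz⟩
    obtain ⟨s0, s1⟩ := ext_step hT' (hx i hi') _ w hS
    rintro (_ | p)
    · have := s0 _ (ih (by omega) 0)
      simpa using this
    · have := s1 p _ _ (ih (by omega) p) (ih (by omega) (p+1))
      rwa [← add_mul, ← Nat.choose_succ_succ] at this

lemma ext_local {M T : ModuleCat.{u} R} {r t : ℕ} (hT : FreeQ J T t) (hM : FreeQ J M r) (n : ℕ)
    (x : ℕ → R)
    (K : ℕ → Ideal R) (h0 : K 0 = ⊥) (hK : ∀ i < n, K (i+1) = K i ⊔ Ideal.span {x i})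
    (hn : K n = J) (hreg : ∀ i < n, ∀ a, x i * a ∈ K i → a ∈ K i) (p : ℕ) :
    FreeQ J (Ext M T p) (Nat.choose n p * (r * t)) := by
  have hmono : ∀ j ≤ n, K j ≤ K n := by
    intro j hj
    induction hj using Nat.decreasingInduction with
    | self => exact le_rfl
    | of_succ i hi ih => exact (hK i hi ▸ le_sup_left).trans ih
  have hx : ∀ i < n, x i ∈ J := by
    intro i hi
    rw [← hn]
    apply hmono (i+1) hi
    rw [hK i hi]
    exact Ideal.mem_sup_right (Ideal.mem_span_singleton_self _)
  obtain ⟨e⟩ := ext_koszul hT r n x K h0 hK hx hreg n le_rfl p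
  obtain ⟨f⟩ := hM
  subst hn
  obtain ⟨g⟩ := ext_congr_left T f.toModuleIso p
  exact ⟨g.trans e⟩

end ExtStep
end NormalExt

namespace NormalExt

section Near
variable {A : Type u} [CommRing A]

/-- Two modules are isomorphic up to multiplication by an element of `S`. -/
def NearIso (S : Submonoid A) (M N : Type u) [AddCommGroup M] [AddCommGroup N]
    [Module A M] [Module A N] : Prop :=
  ∃ (f : M →ₗ[A] N) (g : N →ₗ[A] M) (s : A), s ∈ S ∧ f ∘ₗ g = s • LinearMap.id ∧
    g ∘ₗ f = s • LinearMap.id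

variable {S : Submonoid A} {M N P Q : Type u} [AddCommGroup M] [AddCommGroup N]
    [Module A M] [Module A N] [AddCommGroup P] [Module A P] [AddCommGroup Q] [Module A Q]

lemma NearIso.symm (h : NearIso S M N) : NearIso S N M := by
  obtain ⟨f, g, s, hs, h1, h2⟩ := h
  exact ⟨g, f, s, hs, h2, h1⟩

lemma NearIso.of_equiv (e : M ≃ₗ[A] N) : NearIso S M N :=
  ⟨e, e.symm, 1, S.one_mem, by simp, by simp⟩

lemma NearIso.trans (h : NearIso S M N) (h' : NearIso S N P) : NearIso S M P := by
  obtain ⟨f, g, s, hs, h1, h2⟩ := h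
  obtain ⟨f', g', s', hs', h1', h2'⟩ := h'
  refine ⟨f' ∘ₗ f, g ∘ₗ g', s * s', S.mul_mem hs hs', ?_, ?_⟩
  · ext x
    have e1 := LinearMap.congr_fun h1 (g' x)
    have e2 := LinearMap.congr_fun h1' x
    simp only [LinearMap.comp_apply, LinearMap.smul_apply, LinearMap.id_apply] at e1 e2
    simp [e1, e2, smul_smul]
  · ext x
    have e1 := LinearMap.congr_fun h2 x
    have e2 := LinearMap.congr_fun h2' (f x)
    simp only [LinearMap.comp_apply, LinearMap.smul_apply, LinearMap.id_apply] at e1 e2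
    simp [e1, e2, smul_smul, mul_comm]

lemma NearIso.hom (h : NearIso S M N) (h' : NearIso S P Q) :
    NearIso S (M →ₗ[A] P) (N →ₗ[A] Q) := by
  obtain ⟨f, g, s, hs, h1, h2⟩ := h
  obtain ⟨f', g', s', hs', h1', h2'⟩ := h'
  refine ⟨(LinearMap.lcomp A Q g) ∘ₗ (LinearMap.llcomp A M P Q f'),
    (LinearMap.lcomp A P f) ∘ₗ (LinearMap.llcomp A N Q P g'), s * s', S.mul_mem hs hs', ?_, ?_⟩
  · ext φ x
    have e1 := LinearMap.congr_fun h1 x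
    have e2 := LinearMap.congr_fun h1' (φ x)
    simp only [LinearMap.comp_apply, LinearMap.smul_apply, LinearMap.id_apply] at e1 e2
    simp [e1, e2, smul_smul]
  · ext φ x
    have e1 := LinearMap.congr_fun h2 x
    have e2 := LinearMap.congr_fun h2' (φ x)
    simp only [LinearMap.comp_apply, LinearMap.smul_apply, LinearMap.id_apply] at e1 e2
    simp [e1, e2, smul_smul]

lemma NearIso.tensor (h : NearIso S M N) (h' : NearIso S P Q) :
    NearIso S (M ⊗[A] P) (N ⊗[A] Q) := by
  obtain ⟨f, g, s, hs, h1, h2⟩ := h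
  obtain ⟨f', g', s', hs', h1', h2'⟩ := h'
  refine ⟨TensorProduct.map f f', TensorProduct.map g g', s * s', S.mul_mem hs hs', ?_, ?_⟩
  · rw [← TensorProduct.map_comp, h1, h1', TensorProduct.map_smul_left, TensorProduct.map_smul_right,
      TensorProduct.map_id, smul_smul]
  · rw [← TensorProduct.map_comp, h2, h2', TensorProduct.map_smul_left, TensorProduct.map_smul_right,
      TensorProduct.map_id, smul_smul]

lemma ext_pow_smul (p : ℕ) (s : A) :
    exteriorPower.map p (s • (LinearMap.id : M →ₗ[A] M)) = s ^ p • LinearMap.id := by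
  apply exteriorPower.linearMap_ext
  ext v
  have := (exteriorPower.ιMulti A p (M := M)).map_smul_univ (fun _ => s) v
  simp only [LinearMap.compAlternatingMap_apply, exteriorPower.map_apply_ιMulti]
  rw [Finset.prod_const, Finset.card_univ, Fintype.card_fin] at this
  exact congrArg Subtype.val this

lemma NearIso.exteriorPower (h : NearIso S M N) (p : ℕ) :
    NearIso S (⋀[A]^p M) (⋀[A]^p N) := by
  obtain ⟨f, g, s, hs, h1, h2⟩ := h
  refine ⟨exteriorPower.map p f, exteriorPower.map p g, s ^ p, S.pow_mem hs p, ?_, ?_⟩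
  · rw [← exteriorPower.map_comp, h1, ext_pow_smul]
  · rw [← exteriorPower.map_comp, h2, ext_pow_smul]

lemma NearIso.of_loc {M' N' : Type u} [AddCommGroup M'] [AddCommGroup N'] [Module A M'] [Module A N']
    (f : M →ₗ[A] M') (g : N →ₗ[A] N') [IsLocalizedModule S f] [IsLocalizedModule S g]
    [Module.FinitePresentation A M] [Module.FinitePresentation A N] (e : M' ≃ₗ[A] N') :
    NearIso S M N := by
  obtain ⟨φ, s, hφ⟩ := Module.FinitePresentation.exists_lift_of_isLocalizedModule S g
    (e.toLinearMap ∘ₗ f)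
  obtain ⟨ψ, t, hψ⟩ := Module.FinitePresentation.exists_lift_of_isLocalizedModule S f
    (e.symm.toLinearMap ∘ₗ g)
  have hφ' : ∀ x, g (φ x) = (s : A) • e (f x) := fun x => LinearMap.congr_fun hφ x
  have hψ' : ∀ x, f (ψ x) = (t : A) • e.symm (g x) := fun x => LinearMap.congr_fun hψ x
  obtain ⟨u, hu⟩ := Module.Finite.exists_smul_of_comp_eq_of_isLocalizedModule S g (φ ∘ₗ ψ)
    ((s * t : A) • LinearMap.id) (by ext x; simp [hφ', hψ', smul_smul])
  obtain ⟨v, hv⟩ := Module.Finite.exists_smul_of_comp_eq_of_isLocalizedModule S f (ψ ∘ₗ φ)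
    ((s * t : A) • LinearMap.id) (by ext x; simp [hφ', hψ', smul_smul, mul_comm])
  have hu' : (u : A) • (φ ∘ₗ ψ) = (u : A) • ((s * t : A) • LinearMap.id) := hu
  have hv' : (v : A) • (ψ ∘ₗ φ) = (v : A) • ((s * t : A) • LinearMap.id) := hv
  refine ⟨(u * v : A) • φ, ψ, u * v * (s * t), ?_, ?_, ?_⟩
  · exact S.mul_mem (S.mul_mem u.2 v.2) (S.mul_mem s.2 t.2)
  · rw [LinearMap.smul_comp, mul_comm (u : A), mul_smul, hu']
    simp only [smul_smul, mul_assoc]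
  · rw [LinearMap.comp_smul, mul_smul, hv']
    simp only [smul_smul, mul_assoc]

lemma NearIso.loc (h : NearIso S M N) {M' N' : Type u} [AddCommGroup M'] [AddCommGroup N']
    [Module A M'] [Module A N']
    (f : M →ₗ[A] M') (g : N →ₗ[A] N') [IsLocalizedModule S f] [IsLocalizedModule S g] :
    Nonempty (M' ≃ₗ[A] N') := by
  obtain ⟨φ, ψ, s, hs, h1, h2⟩ := h
  let φ' := IsLocalizedModule.map S f g φ
  let ψ' := IsLocalizedModule.map S g f ψ
  have e1 : φ' ∘ₗ ψ' = s • LinearMap.id := by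
    rw [← IsLocalizedModule.map_comp', h1, map_smul, IsLocalizedModule.map_id]
  have e2 : ψ' ∘ₗ φ' = s • LinearMap.id := by
    rw [← IsLocalizedModule.map_comp', h2, map_smul, IsLocalizedModule.map_id]
  have b1 : Function.Bijective (fun x : N' => s • x) :=
    (Module.End.isUnit_iff _).1 (IsLocalizedModule.map_units g ⟨s, hs⟩)
  have b2 : Function.Bijective (fun x : M' => s • x) :=
    (Module.End.isUnit_iff _).1 (IsLocalizedModule.map_units f ⟨s, hs⟩)
  refine ⟨LinearEquiv.ofBijective φ' ⟨?_, ?_⟩⟩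
  · intro x y hxy
    apply b2.1
    have := congrArg ψ' hxy
    simpa using (LinearMap.congr_fun e2 x).symm.trans (this.trans (LinearMap.congr_fun e2 y))
  · intro y
    obtain ⟨z, rfl⟩ := b1.2 y
    exact ⟨ψ' z, LinearMap.congr_fun e1 z⟩

lemma nearIso_free (m : Ideal A) [m.IsPrime] [Module.Finite A M] [Module.Projective A M] :
    ∃ n : ℕ, NearIso m.primeCompl M (Fin n → A) := by
  let R := Localization.AtPrime m
  let M' := LocalizedModule m.primeCompl M
  have : Module.Free R M' := Module.free_of_flat_of_isLocalRing
  have : Module.Finite R M' := inferInstance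
  have : Module.FinitePresentation A M := Module.finitePresentation_of_projective A M
  refine ⟨Module.finrank R M', ?_⟩
  let e : M' ≃ₗ[R] (Fin (Module.finrank R M') → R) := (Module.finBasis R M').equivFun
  exact NearIso.of_loc (LocalizedModule.mkLinearMap m.primeCompl M)
    (LinearMap.pi fun i => (Algebra.linearMap A R) ∘ₗ LinearMap.proj i) (e.restrictScalars A)

lemma fin_hom [IsNoetherianRing A] [Module.Finite A M] [Module.Finite A N] :
    Module.Finite A (M →ₗ[A] N) := inferInstance

end Near
end NormalExt

namespace NormalExt

section Reg
variable {k R : Type u} [Field k] [CharZero k] [CommRing R] [Algebra k R]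

lemma reg_aux (K : Ideal R) (D : Derivation k R R) (hD : ∀ a ∈ K, D a ∈ K) (x : R) (h1 : D x = 1)
    (n : ℕ) : ∀ (j : ℕ) (a : R), x ^ j * a ∈ K → a ∈ K ⊔ Ideal.span {x ^ n} := by
  induction n with
  | zero => intro j a _; simp
  | succ n ihn =>
    intro j
    induction j with
    | zero => intro a h; exact (le_sup_left : K ≤ _) (by simpa using h)
    | succ j ihj =>
      intro a h
      have e1 : D (x ^ (j + 1) * a) = x ^ j * (((j + 1 : ℕ) : R) * a + x * D a) := by
        rw [Derivation.leibniz, Derivation.leibniz_pow, h1]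
        simp only [smul_eq_mul, nsmul_eq_mul, Nat.add_sub_cancel, mul_one]
        ring
      have e2 := hD _ h
      rw [e1] at e2
      have e3 : x ^ (j + 2) * D a ∈ K := by
        have : x ^ (j + 2) * D a = x * (x ^ j * (((j + 1 : ℕ) : R) * a + x * D a))
            - ((j + 1 : ℕ) : R) * (x ^ (j + 1) * a) := by ring
        rw [this]
        exact K.sub_mem (K.mul_mem_left _ e2) (K.mul_mem_left _ h)
      have e4 := ihj _ e2
      have e5 : x * D a ∈ K ⊔ Ideal.span {x ^ (n + 1)} := by
        obtain ⟨u, hu, v, hv, huv⟩ := Submodule.mem_sup.1 (ihn _ _ e3)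
        obtain ⟨w, rfl⟩ := Ideal.mem_span_singleton'.1 hv
        refine Submodule.mem_sup.2 ⟨x * u, K.mul_mem_left _ hu, w * x ^ (n + 1),
          Ideal.mem_span_singleton'.2 ⟨w, rfl⟩, ?_⟩
        rw [← huv]; ring
      have e6 := Ideal.sub_mem _ e4 e5
      rw [add_sub_cancel_right] at e6
      have e7 := Ideal.mul_mem_left _ (algebraMap k R ((j + 1 : ℕ) : k)⁻¹) e6
      rwa [← mul_assoc, ← map_natCast (algebraMap k R) (j + 1), ← map_mul, inv_mul_cancel₀, map_one,
        one_mul] at e7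
      exact Nat.cast_ne_zero.2 (Nat.succ_ne_zero j)

variable [IsNoetherianRing R] [IsLocalRing R]

lemma reg_one (K : Ideal R) (D : Derivation k R R) (hD : ∀ a ∈ K, D a ∈ K) (x : R) (h1 : D x = 1)
    (hx : x ∈ IsLocalRing.maximalIdeal R) (a : R) (h : x * a ∈ K) : a ∈ K := by
  have key := Ideal.iInf_pow_smul_eq_bot_of_isLocalRing (M := R ⧸ K) (Ideal.span {x}) (by
    intro h
    rw [Ideal.span_singleton_eq_top] at h
    exact (IsLocalRing.mem_maximalIdeal _).1 hx h)
  rw [← Ideal.Quotient.eq_zero_iff_mem, ← Submodule.mem_bot R, ← key, Submodule.mem_iInf]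
  intro n
  obtain ⟨u, hu, v, hv, huv⟩ := Submodule.mem_sup.1
    (reg_aux K D hD x h1 n 1 a (by simpa using h))
  obtain ⟨w, rfl⟩ := Ideal.mem_span_singleton'.1 hv
  have : Ideal.Quotient.mk K a = (w * x ^ n) • (1 : R ⧸ K) := by
    rw [← huv, map_add, Ideal.Quotient.eq_zero_iff_mem.2 hu, zero_add, Algebra.smul_def, mul_one]
    rfl
  rw [this]
  refine Submodule.smul_mem_smul ?_ trivial
  rw [Ideal.span_singleton_pow]
  exact Ideal.mem_span_singleton'.2 ⟨w, rfl⟩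

lemma reg_seq (n : ℕ) (x : Fin n → R) (D : Fin n → Derivation k R R)
    (hx : ∀ i, x i ∈ IsLocalRing.maximalIdeal R)
    (hD : ∀ i j, D i (x j) = if i = j then 1 else 0) (J : Ideal R)
    (hJ : J = Ideal.span (Set.range x)) :
    ∃ (y : ℕ → R) (K : ℕ → Ideal R), K 0 = ⊥ ∧ (∀ i < n, K (i+1) = K i ⊔ Ideal.span {y i}) ∧
      K n = J ∧ (∀ i < n, ∀ a, y i * a ∈ K i → a ∈ K i) := by
  let y : ℕ → R := fun i => if h : i < n then x ⟨i, h⟩ else 0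
  let K : ℕ → Ideal R := fun i => Ideal.span (y '' {j | j < i})
  refine ⟨y, K, by simp [K], ?_, ?_, ?_⟩
  · intro i _
    have : {j | j < i + 1} = {j | j < i} ∪ {i} := by
      ext j; simp; omega
    simp only [K]
    rw [this, Set.image_union, Ideal.span_union, Set.image_singleton]
  · rw [hJ]
    simp only [K]
    congr 1
    ext z
    constructor
    · rintro ⟨j, hj, rfl⟩
      exact ⟨⟨j, hj⟩, by simp [y, show j < n from hj]⟩
    · rintro ⟨j, rfl⟩
      exact ⟨j, j.2, by simp [y]⟩
  · intro i hi a ha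
    have hy : y i = x ⟨i, hi⟩ := by simp [y, hi]
    rw [hy] at ha
    refine reg_one (K i) (D ⟨i, hi⟩) ?_ (x ⟨i, hi⟩) (by simp [hD]) (hx _) a ha
    intro b hb
    induction hb using Submodule.span_induction with
    | mem z hz =>
      obtain ⟨j, hj, rfl⟩ := hz
      have hj' : j < i := hj
      have : y j = x ⟨j, hj'.trans hi⟩ := by simp [y, hj'.trans hi]
      rw [this, hD, if_neg]
      · exact zero_mem _
      · intro h
        have := congrArg Fin.val h
        simp at this
        omega
    | zero => rw [map_zero]; exact zero_mem _
    | add u v _ _ hu hv => rw [map_add]; exact add_mem hu hv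
    | smul r u hu' hu =>
      rw [smul_eq_mul, Derivation.leibniz]
      exact add_mem (Ideal.mul_mem_left _ _ hu)
        (by rw [smul_eq_mul, mul_comm]; exact Ideal.mul_mem_left _ _ hu')

lemma fix_der (n : ℕ) (x : Fin n → R) (D : Fin n → Derivation k R R) (s : R) (hs : IsUnit s)
    (hD : ∀ i j, D i (x j) - (if i = j then s else 0) ∈ IsLocalRing.maximalIdeal R) :
    ∃ D' : Fin n → Derivation k R R, ∀ i j, D' i (x j) = if i = j then 1 else 0 := by
  let M : Matrix (Fin n) (Fin n) R := Matrix.of fun i j => D i (x j)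
  have hM : M.map (IsLocalRing.residue R) = Matrix.scalar (Fin n) (IsLocalRing.residue R s) := by
    ext i j
    have : IsLocalRing.residue R (D i (x j)) = IsLocalRing.residue R (if i = j then s else 0) :=
      (Ideal.Quotient.eq).2 (hD i j)
    simp only [Matrix.map_apply, M, Matrix.of_apply, this, Matrix.scalar_apply,
      Matrix.diagonal_apply]
    split_ifs <;> simp
  have hdet : IsUnit M.det := by
    rw [← isUnit_map_iff (IsLocalRing.residue R), RingHom.map_det, RingHom.mapMatrix_apply, hM]
    simp only [Matrix.scalar_apply, Matrix.det_diagonal, Finset.prod_const]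
    exact (hs.map _).pow _
  refine ⟨fun i => ∑ l, M⁻¹ i l • D l, fun i j => ?_⟩
  have := congrFun (congrFun (Matrix.nonsing_inv_mul M hdet) i) j
  rw [Matrix.mul_apply, Matrix.one_apply] at this
  rw [← this]
  change Derivation.coeFnAddMonoidHom (∑ l, M⁻¹ i l • D l) (x j) = _
  rw [map_sum, Finset.sum_apply]
  rfl

end Reg
end NormalExt

namespace NormalExt

section Geo
open KaehlerDifferential
variable {k A : Type u} [Field k] [CharZero k] [CommRing A] [Algebra k A]
  [Algebra.FormallySmooth k A] (I : Ideal A) [Algebra.FormallySmooth k (A ⧸ I)]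

lemma cot_split : ∃ (i : I.Cotangent →ₗ[A] ((A ⧸ I) ⊗[A] Ω[A⁄k]))
    (l : ((A ⧸ I) ⊗[A] Ω[A⁄k]) →ₗ[A] I.Cotangent),
    l ∘ₗ i = LinearMap.id ∧ ∀ x : I, i (I.toCotangent x) = 1 ⊗ₜ D k A x := by
  have hs : Function.Surjective (algebraMap A (A ⧸ I)) := Ideal.Quotient.mk_surjective
  obtain ⟨l, hl⟩ := (Algebra.FormallySmooth.iff_split_injection (R := k) hs).1 inferInstance
  have gen : ∀ (J J' : Ideal A) (_ : J = J'),
      (∃ (i : J.Cotangent →ₗ[A] ((A ⧸ I) ⊗[A] Ω[A⁄k]))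
        (l : ((A ⧸ I) ⊗[A] Ω[A⁄k]) →ₗ[A] J.Cotangent),
        l ∘ₗ i = LinearMap.id ∧ ∀ x : J, i (J.toCotangent x) = 1 ⊗ₜ D k A x) →
      (∃ (i : J'.Cotangent →ₗ[A] ((A ⧸ I) ⊗[A] Ω[A⁄k]))
        (l : ((A ⧸ I) ⊗[A] Ω[A⁄k]) →ₗ[A] J'.Cotangent),
        l ∘ₗ i = LinearMap.id ∧ ∀ x : J', i (J'.toCotangent x) = 1 ⊗ₜ D k A x) := by
    rintro J _ rfl h; exact h
  refine gen (RingHom.ker (algebraMap A (A ⧸ I))) I Ideal.mk_ker ?_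
  exact ⟨_, l, hl, fun x => kerCotangentToTensor_toCotangent k A (A ⧸ I) x⟩

lemma cot_projective (k : Type u) [Field k] [CharZero k] [Algebra k A]
    [Algebra.FormallySmooth k A] [Algebra.FormallySmooth k (A ⧸ I)] :
    Module.Projective (A ⧸ I) I.Cotangent := by
  obtain ⟨i, l, h, -⟩ := cot_split (k := k) I
  have hs : Function.Surjective (algebraMap A (A ⧸ I)) := Ideal.Quotient.mk_surjective
  refine Module.Projective.of_split (i.extendScalarsOfSurjective hs)
    (l.extendScalarsOfSurjective hs) ?_
  ext x
  exact LinearMap.congr_fun h x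

lemma der_lift (f : I.Cotangent →ₗ[A ⧸ I] (A ⧸ I)) :
    ∃ ψ : Ω[A⁄k] →ₗ[A] A, ∀ x : I, Ideal.Quotient.mk I (ψ (D k A x)) = f (I.toCotangent x) := by
  obtain ⟨i, l, h, hi⟩ := cot_split (k := k) I
  obtain ⟨ψ, hψ⟩ := Module.projective_lifting_property (Algebra.linearMap A (A ⧸ I))
    ((f.restrictScalars A) ∘ₗ l ∘ₗ (TensorProduct.mk A (A ⧸ I) (Ω[A⁄k]) 1))
    Ideal.Quotient.mk_surjective
  refine ⟨ψ, fun x => ?_⟩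
  have := LinearMap.congr_fun hψ (D k A x)
  refine this.trans ?_
  have e : l (1 ⊗ₜ D k A x) = I.toCotangent x := by
    rw [← hi]; exact LinearMap.congr_fun h _
  simp [e]

lemma der_loc (S : Submonoid A) (ψ : Ω[A⁄k] →ₗ[A] A) :
    ∃ D' : Derivation k (Localization S) (Localization S), ∀ a : A,
      D' (algebraMap A _ a) = algebraMap A _ (ψ (D k A a)) := by
  let R := Localization S
  let q := KaehlerDifferential.map k k A R
  have hq : IsLocalizedModule S q := inferInstance
  let φ : Ω[R⁄k] →ₗ[A] R := IsLocalizedModule.map S q (Algebra.linearMap A R) ψ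
  let φ' : Ω[R⁄k] →ₗ[R] R := φ.extendScalarsOfIsLocalization S R
  refine ⟨φ'.compDer (D k R), fun a => ?_⟩
  have := IsLocalizedModule.map_apply S q (Algebra.linearMap A R) ψ (D k A a)
  simp only [q, KaehlerDifferential.map_D] at this
  exact this

end Geo

section Geo2
variable {k A : Type u} [Field k] [CharZero k] [CommRing A] [IsNoetherianRing A] [Algebra k A]
  [Algebra.FormallySmooth k A] (I : Ideal A) [Algebra.FormallySmooth k (A ⧸ I)]

lemma geo_main (k : Type u) [Field k] [CharZero k] [Algebra k A]
    [Algebra.FormallySmooth k A] [Algebra.FormallySmooth k (A ⧸ I)]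
    (m : Ideal A) [hm : m.IsPrime] (hI : I ≤ m) (m' : Ideal (A ⧸ I)) [m'.IsPrime]
    (hm' : m'.comap (Ideal.Quotient.mk I) = m) :
    ∃ n : ℕ, NearIso m'.primeCompl I.Cotangent (Fin n → A ⧸ I) ∧
    ∃ (y : ℕ → Localization.AtPrime m) (K : ℕ → Ideal (Localization.AtPrime m)),
      K 0 = ⊥ ∧ (∀ i < n, K (i+1) = K i ⊔ Ideal.span {y i}) ∧
      K n = I.map (algebraMap A (Localization.AtPrime m)) ∧
      (∀ i < n, ∀ a, y i * a ∈ K i → a ∈ K i) := by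
  classical
  have hproj := cot_projective I k
  have hfinA : Module.Finite A I.Cotangent :=
    Module.Finite.of_surjective I.toCotangent I.toCotangent_surjective
  have hfin : Module.Finite (A ⧸ I) I.Cotangent :=
    Module.Finite.of_restrictScalars_finite A (A ⧸ I) I.Cotangent
  obtain ⟨n, hn⟩ := nearIso_free (M := I.Cotangent) m'
  refine ⟨n, hn, ?_⟩
  obtain ⟨f, g, s, hs, h1, h2⟩ := hn
  obtain ⟨a, rfl⟩ := Ideal.Quotient.mk_surjective s
  have ha : a ∈ m.primeCompl := fun h => hs (by rw [← hm'] at h; exact h)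
  let R := Localization.AtPrime m
  have hx : ∀ j : Fin n, ∃ x : I, I.toCotangent x = g (Pi.single j 1) := fun j =>
    I.toCotangent_surjective _
  choose x hx using hx
  choose ψ hψ using fun i : Fin n => der_lift (k := k) I (LinearMap.proj i ∘ₗ f)
  choose D hD using fun i => der_loc (k := k) m.primeCompl (ψ i)
  have hIm : ∀ b ∈ I, algebraMap A R b ∈ IsLocalRing.maximalIdeal R := fun b hb =>
    (IsLocalization.AtPrime.to_map_mem_maximal_iff R m b).2 (hI hb)
  have ua : IsUnit (algebraMap A R a) := IsLocalization.map_units R ⟨a, ha⟩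
  obtain ⟨D', hD'⟩ := fix_der (k := k) n (fun j => algebraMap A R (x j)) D (algebraMap A R a) ua (by
    intro i j
    rw [hD]
    have : (algebraMap A R) (ψ i (KaehlerDifferential.D k A (x j))) -
        (if i = j then algebraMap A R a else 0) = algebraMap A R
          (ψ i (KaehlerDifferential.D k A (x j)) - if i = j then a else 0) := by
      split_ifs <;> simp
    rw [this]
    apply hIm
    rw [← Ideal.Quotient.eq, hψ, hx]
    have e := congrFun (LinearMap.congr_fun h1 (Pi.single j 1)) i
    refine e.trans ?_
    simp only [LinearMap.smul_apply, LinearMap.id_apply, Pi.smul_apply, Pi.single_apply]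
    split_ifs <;> simp)
  refine reg_seq (k := k) n (fun j => algebraMap A R (x j)) D' (fun i => hIm _ (x i).2) hD' _ ?_
  apply le_antisymm
  · apply Submodule.le_of_le_smul_of_le_jacobson_bot (I := IsLocalRing.maximalIdeal R)
    · exact IsNoetherian.noetherian _
    · exact IsLocalRing.maximalIdeal_le_jacobson _
    · rw [Ideal.map_le_iff_le_comap]
      intro b hb
      rw [Ideal.mem_comap]
      have e := LinearMap.congr_fun h2 (I.toCotangent ⟨b, hb⟩)
      have e' : f (I.toCotangent ⟨b, hb⟩) = ∑ j, f (I.toCotangent ⟨b, hb⟩) j • Pi.single j (1 : A ⧸ I) := by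
        ext i; simp [Pi.single_apply, Finset.sum_apply]
      choose c hc using fun j => Ideal.Quotient.mk_surjective (f (I.toCotangent ⟨b, hb⟩) j)
      rw [LinearMap.comp_apply, e', map_sum] at e
      simp only [map_smul, ← hx, ← hc] at e
      have e2 : I.toCotangent (∑ j, c j • x j) = I.toCotangent (a • ⟨b, hb⟩) := by
        rw [map_sum, map_smul]
        simp only [map_smul]
        exact e
      rw [Ideal.toCotangent_eq] at e2
      rw [← Ideal.unit_mul_mem_iff_mem _ ua, ← map_mul]
      have e3 : a * b = ((∑ j, c j • x j : I) : A) -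
          (((∑ j, c j • x j : I) : A) - ((a • (⟨b, hb⟩ : I) : I) : A)) := by
        rw [sub_sub_cancel]; rfl
      rw [e3, map_sub]
      refine sub_mem (Submodule.mem_sup_left ?_) (Submodule.mem_sup_right ?_)
      · have : ((∑ j, c j • x j : I) : A) = ∑ j, c j * (x j : A) := by
          rw [Submodule.coe_sum]; rfl
        rw [this, map_sum]
        refine sum_mem fun j _ => ?_
        rw [map_mul]
        exact Ideal.mul_mem_left _ _ (Ideal.subset_span ⟨j, rfl⟩)
      · have := Ideal.mem_map_of_mem (algebraMap A R) e2
        rw [pow_two, Ideal.map_mul] at this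
        refine Ideal.mul_mono_left ?_ this
        rw [Ideal.map_le_iff_le_comap]
        exact fun b hb => hIm b hb
  · rw [Ideal.span_le]
    rintro _ ⟨j, rfl⟩
    exact Ideal.mem_map_of_mem _ (x j).2

end Geo2
end NormalExt

namespace NormalExt

section Asm
variable {A : Type u} [CommRing A] {I : Ideal A}

lemma NearIso.down {m : Ideal A} [m.IsPrime] {m' : Ideal (A ⧸ I)} [m'.IsPrime]
    (hm' : m'.comap (Ideal.Quotient.mk I) = m) {M N : Type u} [AddCommGroup M] [AddCommGroup N]
    [Module A M] [Module A N] [Module (A ⧸ I) M] [Module (A ⧸ I) N]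
    [IsScalarTower A (A ⧸ I) M] [IsScalarTower A (A ⧸ I) N] (h : NearIso m'.primeCompl M N) :
    NearIso m.primeCompl M N := by
  obtain ⟨f, g, s, hs, h1, h2⟩ := h
  obtain ⟨a, rfl⟩ := Ideal.Quotient.mk_surjective s
  have ha : a ∈ m.primeCompl := fun h => hs (by rw [← hm'] at h; exact h)
  refine ⟨f.restrictScalars A, g.restrictScalars A, a, ha, ?_, ?_⟩
  · ext x
    refine (LinearMap.congr_fun h1 x).trans ?_
    exact algebraMap_smul (A ⧸ I) a x
  · ext x
    refine (LinearMap.congr_fun h2 x).trans ?_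
    exact algebraMap_smul (A ⧸ I) a x

lemma quot_loc (S : Submonoid A) (I : Ideal A) :
    ∃ q : (A ⧸ I) →ₗ[A] (Localization S ⧸ I.map (algebraMap A (Localization S))),
      IsLocalizedModule S q := by
  have h := IsLocalizedModule.toLocalizedQuotient' (Localization S) S
    (Algebra.linearMap A (Localization S)) I
  rw [← Ideal.localized'_eq_map (Localization S) S]
  exact ⟨_, h⟩

lemma pi_quot_loc (S : Submonoid A) (I : Ideal A) (c : ℕ) :
    ∃ q : (Fin c → (A ⧸ I)) →ₗ[A] (Fin c → Localization S ⧸ I.map (algebraMap A (Localization S))),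
      IsLocalizedModule S q := by
  obtain ⟨q, hq⟩ := quot_loc S I
  exact ⟨_, IsLocalizedModule.pi S (fun _ => q)⟩

lemma freeQ_loc (S : Submonoid A) (E : ModuleCat.{u} A) (r : ℕ)
    (h : NearIso S E (Fin r → A ⧸ I)) :
    FreeQ (I.map (algebraMap A (Localization S)))
      ((ModuleCat.localizedModuleFunctor S).obj E) r := by
  obtain ⟨q, hq⟩ := pi_quot_loc S I r
  obtain ⟨e⟩ := h.loc (E.localizedModuleMkLinearMap S) q
  exact ⟨e.extendScalarsOfIsLocalization S (Localization S)⟩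

open Abelian in
lemma ext_near [IsNoetherianRing A] (S : Submonoid A) (E : ModuleCat.{u} A) [Module.Finite A E]
    (p c : ℕ) (h : FreeQ (I.map (algebraMap A (Localization S)))
      (Ext ((ModuleCat.localizedModuleFunctor S).obj E)
        ((ModuleCat.localizedModuleFunctor S).obj E) p) c) :
    NearIso S (Ext E E p) (Fin c → A ⧸ I) := by
  obtain ⟨q, hq⟩ := pi_quot_loc S I c
  obtain ⟨e⟩ := h
  let R := Localization S
  let X' := Ext ((ModuleCat.localizedModuleFunctor S).obj E)
        ((ModuleCat.localizedModuleFunctor S).obj E) p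
  let _ : Module A X' := Module.compHom X' (algebraMap A R)
  have hsm : ∀ (a : A) (x : X'), a • x = algebraMap A R a • x := fun _ _ => rfl
  have : IsScalarTower A R X' := ⟨fun a r x => by
    rw [hsm, Algebra.smul_def, mul_smul]⟩
  let f : Ext E E p →ₗ[A] X' :=
    { toFun := fun x => x.mapExactFunctor (ModuleCat.localizedModuleFunctor S)
      map_add' := fun x y => Ext.mapExactFunctor_add (ModuleCat.localizedModuleFunctor S) _ _ _ x y
      map_smul' := fun a x => mapExt_smul S a x }
  obtain ⟨l1, l2⟩ := loc_ext S E p E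
  have hf : IsLocalizedModule S f := by
    constructor
    · intro s
      rw [Module.End.isUnit_iff]
      have hu := IsLocalization.map_units R s
      constructor
      · intro x y hxy
        exact hu.smul_left_cancel.1 hxy
      · intro y
        obtain ⟨v, hv⟩ := hu
        refine ⟨(↑v⁻¹ : R) • y, ?_⟩
        rw [Module.algebraMap_end_apply]
        rw [show ((s : A) • ((↑v⁻¹ : R) • y) : X') = algebraMap A R s • ((↑v⁻¹ : R) • y) from rfl]
        rw [← hv, smul_smul, Units.mul_inv, one_smul]
    · intro y
      obtain ⟨s, hs, x, hx⟩ := l1 y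
      exact ⟨⟨x, ⟨s, hs⟩⟩, hx⟩
    · intro x y hxy
      obtain ⟨s, hs, h0⟩ := l2 (x - y) (by
        change f (x - y) = 0
        rw [map_sub, hxy, sub_self])
      refine ⟨⟨s, hs⟩, ?_⟩
      rw [smul_sub, sub_eq_zero] at h0
      exact h0
  have fin1 : Module.Finite A (Ext E E p) := ModuleCat.finite_ext A E E p
  have fp1 : Module.FinitePresentation A (Ext E E p) := Module.finitePresentation_of_finite A _
  have fp2 : Module.FinitePresentation A (Fin c → A ⧸ I) := Module.finitePresentation_of_finite A _
  exact NearIso.of_loc f q (e.restrictScalars A)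

lemma prime_nontrivial {B : Type u} [CommRing B] (m : Ideal B) [hm : m.IsPrime] :
    Nontrivial B :=
  ⟨0, 1, fun h => (Ideal.ne_top_iff_one m).1 hm.ne_top (h ▸ m.zero_mem)⟩

lemma wedge (B : Type u) [CommRing B] (C : Type u) [AddCommGroup C] [Module B C]
    [Module.Finite B (Module.Dual B C)] (p : ℕ) :
    ∃ (W : Type u) (_ : AddCommGroup W) (_ : Module B W),
      Nonempty (W ≃ₗ[B] ⋀[B]^p (Module.Dual B C)) ∧ Module.Finite B W ∧
      ∀ (m : Ideal B) [m.IsPrime] (n : ℕ), NearIso m.primeCompl C (Fin n → B) →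
        NearIso m.primeCompl W (Fin (n.choose p) → B) := by
  refine ⟨⋀[B]^p (Module.Dual B C), inferInstance, inferInstance, ⟨LinearEquiv.refl _ _⟩,
    exteriorPower.instFinite, ?_⟩
  intro m _ n hC
  have := prime_nontrivial m
  have h1 : NearIso m.primeCompl (Module.Dual B C) (Module.Dual B (Fin n → B)) :=
    hC.hom (NearIso.of_equiv (LinearEquiv.refl B B))
  have h2 : NearIso m.primeCompl (Module.Dual B C) (Fin n → B) :=
    h1.trans (NearIso.of_equiv (LinearEquiv.ofFinrankEq _ _ (by
      simp [Module.Dual, Module.finrank_linearMap])))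
  refine (h2.exteriorPower p).trans (NearIso.of_equiv (LinearEquiv.ofFinrankEq _ _ ?_))
  rw [exteriorPower.finrank_eq]
  simp

lemma rhs_near {B : Type u} [CommRing B] (m : Ideal B) [m.IsPrime] {E W : Type u} [AddCommGroup E]
    [Module B E] [AddCommGroup W] [Module B W] {r c : ℕ} (hE : NearIso m.primeCompl E (Fin r → B))
    (hW : NearIso m.primeCompl W (Fin c → B)) :
    NearIso m.primeCompl (E →ₗ[B] (W ⊗[B] E)) (Fin (c * (r * r)) → B) := by
  have := prime_nontrivial m
  refine (hE.hom (hW.tensor hE)).trans (NearIso.of_equiv (LinearEquiv.ofFinrankEq _ _ ?_))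
  simp only [Module.finrank_linearMap, Module.finrank_tensorProduct, Module.finrank_fin_fun]
  ring

lemma NearIso.surj {m : Ideal A} [hm : m.IsMaximal] {X Y : Type u} [AddCommGroup X]
    [AddCommGroup Y] [Module A X] [Module A Y] (h : NearIso m.primeCompl X Y) :
    ∃ φ : X →ₗ[A] Y, LinearMap.range φ ⊔ m • (⊤ : Submodule A Y) = ⊤ := by
  obtain ⟨f, g, s, hs, h1, -⟩ := h
  refine ⟨f, eq_top_iff.2 fun y _ => ?_⟩
  obtain ⟨t, i, hi, hti⟩ := hm.exists_inv hs
  have : y = f (t • g y) + i • y := by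
    rw [map_smul, show f (g y) = s • y from LinearMap.congr_fun h1 y, smul_smul, ← add_smul, hti,
      one_smul]
  rw [this]
  exact Submodule.add_mem_sup ⟨_, rfl⟩ (Submodule.smul_mem_smul hi trivial)

lemma kill_surj {m : Ideal A} [hm : m.IsMaximal] {X Y : Type u} [AddCommGroup X]
    [AddCommGroup Y] [Module A X] [Module A Y] (s : A) (hs : s ∉ m) (h : ∀ y : Y, s • y = 0) :
    ∃ φ : X →ₗ[A] Y, LinearMap.range φ ⊔ m • (⊤ : Submodule A Y) = ⊤ := by
  refine ⟨0, eq_top_iff.2 fun y _ => ?_⟩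
  obtain ⟨t, i, hi, hti⟩ := hm.exists_inv hs
  have : y = i • y := by
    conv_lhs => rw [← one_smul A y, ← hti, add_smul, mul_smul, h, smul_zero, zero_add]
  rw [this]
  exact Submodule.mem_sup_right (Submodule.smul_mem_smul hi trivial)

end Asm
end NormalExt

namespace NormalExt

section Fin
variable (k : Type u) [Field k] [CharZero k]
    (A : Type u) [CommRing A] [Algebra k A]
    [Algebra.FormallySmooth k A] [Algebra.FinitePresentation k A]
    (I : Ideal A)
    [Algebra.FormallySmooth k (A ⧸ I)]
    (E : Type u) [AddCommGroup E] [Module (A ⧸ I) E]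
    [Module.Finite (A ⧸ I) E] [Module.Projective (A ⧸ I) E]
    [Module A E] [IsScalarTower A (A ⧸ I) E]
    (p : ℕ)

lemma ext_tower (M N : ModuleCat.{u} A) (a : k) (x : Abelian.Ext M N p) :
    algebraMap k A a • x = a • x := by
  rw [Abelian.Ext.smul_eq_comp_mk₀, Abelian.Ext.smul_eq_comp_mk₀ x a]
  rfl

lemma final_abs (Y : Type u) [AddCommGroup Y] [Module (A ⧸ I) Y] [Module A Y] [Module k Y]
    [IsScalarTower A (A ⧸ I) Y] [IsScalarTower k (A ⧸ I) Y] [Module.Finite (A ⧸ I) Y]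
    (hY : ∀ (m : Ideal (A ⧸ I)) [m.IsPrime] (r n : ℕ), NearIso m.primeCompl E (Fin r → A ⧸ I) →
      NearIso m.primeCompl I.Cotangent (Fin n → A ⧸ I) →
      NearIso m.primeCompl Y (Fin (n.choose p * (r * r)) → A ⧸ I)) :
    Nonempty ((((Ext k (ModuleCat.{u} A) p).obj
          (Opposite.op (ModuleCat.of A E))).obj (ModuleCat.of A E)) ≃ₗ[k] Y) := by
  have : IsNoetherianRing A := Algebra.FiniteType.isNoetherianRing k A
  have : Module.Finite A E := Module.Finite.trans (A ⧸ I) E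
  have : Module.Finite A Y := Module.Finite.trans (A ⧸ I) Y
  let X := Abelian.Ext (ModuleCat.of A E) (ModuleCat.of A E) p
  have fX : Module.Finite A X := ModuleCat.finite_ext A _ _ p
  have tX : IsScalarTower k A X := ⟨fun a b x => by
    rw [Algebra.smul_def, mul_smul]; exact ext_tower k A p _ _ a (b • x)⟩
  have tY : IsScalarTower k A Y := ⟨fun a b y => by
    rw [← algebraMap_smul (A ⧸ I) (a • b), ← algebraMap_smul (A ⧸ I) b, Algebra.smul_def a b,
      map_mul, ← IsScalarTower.algebraMap_apply k A (A ⧸ I), mul_smul, algebraMap_smul]⟩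
  have kY : ∀ a ∈ I, ∀ y : Y, a • y = 0 := fun a ha y => by
    rw [← algebraMap_smul (A ⧸ I) a, Ideal.Quotient.algebraMap_eq,
      Ideal.Quotient.eq_zero_iff_mem.2 ha, zero_smul]
  have kE : ∀ a ∈ I, ∀ y : E, a • y = 0 := fun a ha y => by
    rw [← algebraMap_smul (A ⧸ I) a, Ideal.Quotient.algebraMap_eq,
      Ideal.Quotient.eq_zero_iff_mem.2 ha, zero_smul]
  have kX : ∀ a ∈ I, ∀ x : X, a • x = 0 := fun a ha x => by
    rw [Abelian.Ext.smul_eq_comp_mk₀]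
    have : a • 𝟙 (ModuleCat.of A E) = 0 := by
      ext y
      exact kE a ha y
    rw [this]
    simp
  have near : ∀ m : Ideal A, m.IsMaximal → I ≤ m → ∃ _ : m.IsPrime, NearIso m.primeCompl X Y := by
    intro m hm hI
    have hmp : m.IsPrime := hm.isPrime
    refine ⟨hmp, ?_⟩
    let m' := m.map (Ideal.Quotient.mk I)
    have hm' : m'.comap (Ideal.Quotient.mk I) = m := by
      rw [Ideal.comap_map_of_surjective _ Ideal.Quotient.mk_surjective, sup_eq_left]
      rwa [← RingHom.ker_eq_comap_bot, Ideal.mk_ker]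
    have hp' : m'.IsPrime := Ideal.map_isPrime_of_surjective Ideal.Quotient.mk_surjective
      (by rwa [Ideal.mk_ker])
    obtain ⟨r, hr⟩ := nearIso_free (M := E) m'
    obtain ⟨n, hn, y, K, h0, hK, hKn, hreg⟩ := geo_main I k m hI m' hm'
    have h1 := (hY m' r n hr hn).down hm'
    have h2 : NearIso m.primeCompl (ModuleCat.of A E) (Fin r → A ⧸ I) := hr.down hm'
    have h3 := freeQ_loc m.primeCompl (ModuleCat.of A E) r h2
    have h4 := ext_local h3 h3 n y K h0 hK hKn hreg p
    have h5 : NearIso m.primeCompl X _ := ext_near m.primeCompl (ModuleCat.of A E) p _ h4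
    exact h5.trans h1.symm
  obtain ⟨e1⟩ := ext_cmp (k := k) (ModuleCat.of A E) (ModuleCat.of A E) p
  obtain ⟨e2⟩ := glob (A := A) (X := X) (Y := Y) k
    (fun m hm => by
      by_cases hI : I ≤ m
      · obtain ⟨_, h⟩ := near m hm hI
        exact h.surj
      · obtain ⟨s, hs, hs'⟩ := SetLike.not_le_iff_exists.1 hI
        exact kill_surj s hs' (kY s hs))
    (fun m hm => by
      by_cases hI : I ≤ m
      · obtain ⟨_, h⟩ := near m hm hI
        exact h.symm.surj
      · obtain ⟨s, hs, hs'⟩ := SetLike.not_le_iff_exists.1 hI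
        exact kill_surj s hs' (kX s hs))
  exact ⟨e1.trans e2⟩

lemma final_abs2 (Y : Type u) [AddCommGroup Y] [Module (A ⧸ I) Y] [Module.Finite (A ⧸ I) Y]
    (hY : ∀ (m : Ideal (A ⧸ I)) [m.IsPrime] (r n : ℕ), NearIso m.primeCompl E (Fin r → A ⧸ I) →
      NearIso m.primeCompl I.Cotangent (Fin n → A ⧸ I) →
      NearIso m.primeCompl Y (Fin (n.choose p * (r * r)) → A ⧸ I)) :
    Nonempty ((((Ext k (ModuleCat.{u} A) p).obj
          (Opposite.op (ModuleCat.of A E))).obj (ModuleCat.of A E)) ≃ₗ[k]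
            RestrictScalars k (A ⧸ I) Y) := by
  let _ : Module A Y := Module.compHom Y (Ideal.Quotient.mk I)
  let _ : Module k Y := Module.compHom Y (algebraMap k (A ⧸ I))
  have : IsScalarTower A (A ⧸ I) Y := ⟨fun a b y => by
    rw [Algebra.smul_def, mul_smul]; rfl⟩
  have : IsScalarTower k (A ⧸ I) Y := ⟨fun a b y => by
    rw [Algebra.smul_def, mul_smul]; rfl⟩
  obtain ⟨e⟩ := final_abs k A I E p Y hY
  exact ⟨e⟩

lemma final :
    Nonempty (
      (((Ext k (ModuleCat.{u} A) p).obj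
          (Opposite.op (ModuleCat.of A E))).obj (ModuleCat.of A E))
        ≃ₗ[k]
      (RestrictScalars k (A ⧸ I)
        (E →ₗ[A ⧸ I]
          ((⋀[A ⧸ I]^p (Module.Dual (A ⧸ I) I.Cotangent)) ⊗[A ⧸ I] E)))) := by
  have : IsNoetherianRing A := Algebra.FiniteType.isNoetherianRing k A
  have hfinA : Module.Finite A I.Cotangent :=
    Module.Finite.of_surjective I.toCotangent I.toCotangent_surjective
  have hfin : Module.Finite (A ⧸ I) I.Cotangent :=
    Module.Finite.of_restrictScalars_finite A (A ⧸ I) I.Cotangent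
  have : Module.Finite (A ⧸ I) (Module.Dual (A ⧸ I) I.Cotangent) := fin_hom
  obtain ⟨W, _, _, ⟨e⟩, hW, hn⟩ := wedge (A ⧸ I) I.Cotangent p
  have : Module.Finite (A ⧸ I) (E →ₗ[A ⧸ I] (W ⊗[A ⧸ I] E)) := fin_hom
  obtain ⟨e1⟩ := final_abs2 k A I E p (E →ₗ[A ⧸ I] (W ⊗[A ⧸ I] E))
    (fun m _ r n hr hc => rhs_near m hr (hn m n hc))
  let e2 := LinearEquiv.congrRight (M := E) (TensorProduct.congr e (LinearEquiv.refl (A ⧸ I) E))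
  refine ⟨e1.trans
    { toFun := fun x => e2 x
      invFun := fun x => e2.symm x
      left_inv := fun x => e2.left_inv x
      right_inv := fun x => e2.right_inv x
      map_add' := fun x y => e2.map_add x y
      map_smul' := fun a x => e2.map_smul (algebraMap k (A ⧸ I) a) x }⟩

end Fin
end NormalExt

/-- In the smooth affine setting, for a finitely generated projective
B = A/I-module E, there is an isomorphism of k-modules
Ext^p_A(E, E) ≅ Hom_B(E, (∧^p_B N) ⊗_B E), where N = Hom_B(I/I², B) is the normal
module.  Here Ext is computed in the category of A-modules (as k-modules, via the
k-linear structure of that category). -/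
theorem ext_self_eq_hom_exterior_normal
    (k : Type u) [Field k] [CharZero k]
    (A : Type u) [CommRing A] [Algebra k A]
    [Algebra.FormallySmooth k A] [Algebra.FinitePresentation k A]
    (I : Ideal A)
    [Algebra.FormallySmooth k (A ⧸ I)] [Algebra.FinitePresentation k (A ⧸ I)]
    (E : Type u) [AddCommGroup E] [Module (A ⧸ I) E]
    [Module.Finite (A ⧸ I) E] [Module.Projective (A ⧸ I) E]
    [Module A E] [IsScalarTower A (A ⧸ I) E]
    (p : ℕ) :
    Nonempty (
      (((Ext k (ModuleCat.{u} A) p).obj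
          (Opposite.op (ModuleCat.of A E))).obj (ModuleCat.of A E))
        ≃ₗ[k]
      (RestrictScalars k (A ⧸ I)
        (E →ₗ[A ⧸ I]
          ((⋀[A ⧸ I]^p (Module.Dual (A ⧸ I) I.Cotangent)) ⊗[A ⧸ I] E)))) := by
  exact NormalExt.final k A I E p
end

section
/- Let k be a field of characteristic zero, A a smooth commutative k-algebra (formally smooth and of finite presentation over k), and I an ideal such that B = A/I is also smooth over k. Then for every n ≥ 0 there is an isomorphism of B-modules Tor_n^A(B, B) ≅ ∧^n_B (I/I²), where ∧^n_B denotes the n-th exterior power over B of the conormal module I/I². -/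
open CategoryTheory

universe u


section Part1
open ExteriorAlgebra

variable {R P : Type*} [CommRing R] [AddCommGroup P] [Module R P]

/-- exterior powers of projective modules are projective -/
lemma extPow_projective [Module.Projective R P] (n : ℕ) : Module.Projective R (⋀[R]^n P) := by
  obtain ⟨s, hs⟩ := Module.projective_def'.1 (inferInstance : Module.Projective R P)
  refine Module.Projective.of_split (M := ⋀[R]^n (P →₀ R)) (exteriorPower.map n s)
    (exteriorPower.map n (Finsupp.linearCombination R id)) ?_
  rw [← exteriorPower.map_comp, hs, exteriorPower.map_id]

lemma exists_proj (n : ℕ) : ∃ q : ExteriorAlgebra R P →ₗ[R] ⋀[R]^n P, ∀ x : ⋀[R]^n P, q x = x := by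
  refine ⟨(DirectSum.component R ℕ (fun i => ⋀[R]^i P) n) ∘ₗ
    (DirectSum.decomposeLinearEquiv (fun i : ℕ => ⋀[R]^i P)).toLinearMap, fun x => ?_⟩
  simp only [LinearMap.coe_comp, LinearEquiv.coe_coe, Function.comp_apply,
    DirectSum.decomposeLinearEquiv_apply, DirectSum.decompose_coe]
  exact DirectSum.component.lof_self R (M := fun i => ⋀[R]^i P) n x

lemma exists_connection [Module.Projective R P] (D : Derivation ℤ R P) (n : ℕ) :
    ∃ h : ExteriorAlgebra R P →+ ExteriorAlgebra R P,
      (∀ w ∈ ⋀[R]^n P, h w ∈ ⋀[R]^(n+1) P) ∧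
      ∀ (a : R), ∀ w ∈ ⋀[R]^n P, h (a • w) = ι R (D a) * w + a • h w := by
  have := extPow_projective (R := R) (P := P) n
  obtain ⟨s, hs⟩ := Module.projective_def'.1 this
  obtain ⟨q, hq⟩ := exists_proj (R := R) (P := P) n
  let g : (⋀[R]^n P →₀ R) →+ ExteriorAlgebra R P :=
    Finsupp.liftAddHom fun x =>
      { toFun := fun r => ι R (D r) * (x : ExteriorAlgebra R P)
        map_zero' := by simp
        map_add' := by intro a b; simp [add_mul] }
  have hg : ∀ (a : R) (f : ⋀[R]^n P →₀ R), g (a • f) =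
      ι R (D a) * (Finsupp.linearCombination R id f : ⋀[R]^n P) + a • g f := by
    intro a f
    induction f using Finsupp.induction_linear with
    | zero => simp
    | add f1 f2 h1 h2 =>
      rw [smul_add, map_add, h1, h2, map_add, map_add, Submodule.coe_add, mul_add, smul_add]; abel
    | single x r =>
      rw [Finsupp.smul_single, Finsupp.linearCombination_single]
      simp only [g, Finsupp.liftAddHom_apply_single, AddMonoidHom.coe_mk, ZeroHom.coe_mk,
        smul_eq_mul, Derivation.leibniz, map_add, map_smul, add_mul, id_eq, Submodule.coe_smul,
        smul_mul_assoc, mul_smul_comm]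
      abel
  have hmem : ∀ f, g f ∈ ⋀[R]^(n+1) P := by
    intro f
    induction f using Finsupp.induction_linear with
    | zero => simp
    | add f1 f2 h1 h2 => rw [map_add]; exact add_mem h1 h2
    | single x r =>
      simp only [g, Finsupp.liftAddHom_apply_single, AddMonoidHom.coe_mk, ZeroHom.coe_mk]
      rw [exteriorPower, pow_succ']
      exact Submodule.mul_mem_mul ⟨_, rfl⟩ x.2
  refine ⟨g.comp (s.toAddMonoidHom.comp q.toAddMonoidHom), fun w hw => hmem _, fun a w hw => ?_⟩
  have e := hg a (s (q w))
  have e2 : (Finsupp.linearCombination R id (s (q w)) : ⋀[R]^n P) = q w :=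
    LinearMap.congr_fun hs (q w)
  have e3 : ((q w : ⋀[R]^n P) : ExteriorAlgebra R P) = w := congrArg Subtype.val (hq ⟨w, hw⟩)
  rw [e2, e3] at e
  have e4 : s (q (a • w)) = a • s (q w) := by rw [map_smul, map_smul]
  change g (s (q (a • w))) = _ + a • g (s (q w))
  rw [e4, e]


/-! ### The Koszul complex with a weight operator -/

local notation "Lam" => ExteriorAlgebra R P
local notation "VV" => LinearMap.range (ExteriorAlgebra.ι R : P →ₗ[R] ExteriorAlgebra R P)

lemma mul_mem_mul_smul (b : Ideal R) {S T : Submodule R Lam} {x y : Lam}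
    (hx : x ∈ S) (hy : y ∈ b • T) : x * y ∈ b • (S * T) := by
  induction hy using Submodule.smul_induction_on' with
  | smul r hr n hn =>
    rw [mul_smul_comm]
    exact Submodule.smul_mem_smul hr (Submodule.mul_mem_mul hx hn)
  | add x _ y _ h1 h2 => rw [mul_add]; exact add_mem h1 h2

lemma ι_smul_top_mul (b : Ideal R) {T : Submodule R Lam} {x : P} {y : Lam}
    (hx : x ∈ b • (⊤ : Submodule R P)) (hy : y ∈ T) : ι R x * y ∈ b • (VV * T) := by
  induction hx using Submodule.smul_induction_on' with
  | smul r hr n hn =>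
    rw [map_smul, smul_mul_assoc]
    exact Submodule.smul_mem_smul hr (Submodule.mul_mem_mul ⟨_, rfl⟩ hy)
  | add x _ y _ h1 h2 => rw [map_add, add_mul]; exact add_mem h1 h2

/-- The Koszul differential. -/
noncomputable def kd (δ : P →ₗ[R] R) : Lam →ₗ[R] Lam := CliffordAlgebra.contractLeft (Q := 0) δ

lemma kd_ι_mul (δ : P →ₗ[R] R) (p : P) (w : Lam) :
    kd δ (ι R p * w) = δ p • w - ι R p * kd δ w :=
  CliffordAlgebra.contractLeft_ι_mul (Q := 0) (d := δ) p w

lemma kd_kd (δ : P →ₗ[R] R) (w : Lam) : kd δ (kd δ w) = 0 :=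
  CliffordAlgebra.contractLeft_contractLeft (Q := 0) (d := δ) w

lemma kd_zero (δ : P →ₗ[R] R) {w : Lam} (hw : w ∈ VV ^ 0) : kd δ w = 0 := by
  rw [pow_zero, Submodule.mem_one] at hw
  obtain ⟨r, rfl⟩ := hw
  exact CliffordAlgebra.contractLeft_algebraMap (Q := 0) (d := δ) r

lemma kd_mem (δ : P →ₗ[R] R) {J : Ideal R} (hJ : ∀ p, δ p ∈ J) (n : ℕ) {w : Lam}
    (hw : w ∈ VV ^ (n+1)) : kd δ w ∈ J • VV ^ n := by
  induction n generalizing w with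
  | zero =>
    rw [pow_succ'] at hw
    induction hw using Submodule.mul_induction_on' with
    | mem_mul_mem x hx y hy =>
      obtain ⟨p, rfl⟩ := hx
      rw [kd_ι_mul, kd_zero δ hy, mul_zero, sub_zero]
      exact Submodule.smul_mem_smul (hJ p) hy
    | add x _ y _ h1 h2 => rw [map_add]; exact add_mem h1 h2
  | succ n ih =>
    rw [pow_succ'] at hw
    induction hw using Submodule.mul_induction_on' with
    | mem_mul_mem x hx y hy =>
      obtain ⟨p, rfl⟩ := hx
      rw [kd_ι_mul]
      refine sub_mem (Submodule.smul_mem_smul (hJ p) hy) ?_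
      rw [pow_succ' _ n]
      exact mul_mem_mul_smul J ⟨p, rfl⟩ (ih hy)
    | add x _ y _ h1 h2 => rw [map_add]; exact add_mem h1 h2

lemma kd_mem' (δ : P →ₗ[R] R) (n : ℕ) {w : Lam}
    (hw : w ∈ VV ^ (n+1)) : kd δ w ∈ VV ^ n :=
  Submodule.smul_le_right (kd_mem δ (J := ⊤) (fun _ => trivial) n hw)

/-- Data for the weight argument. -/
structure KD (δ : P →ₗ[R] R) (J 𝔞 : Ideal R) (N0 : Submodule R P) (D : Derivation ℤ R P)
    (h : ℕ → ExteriorAlgebra R P →+ ExteriorAlgebra R P) : Prop where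
  rng : LinearMap.range δ = J
  aJ : 𝔞 ≤ J
  Da : ∀ a ∈ 𝔞, D a ∈ 𝔞 • (⊤ : Submodule R P)
  dN : ∀ p ∈ N0, δ p ∈ 𝔞
  Dd : ∀ p, D (δ p) - p ∈ N0 ⊔ J • (⊤ : Submodule R P)
  hmem : ∀ n, ∀ w ∈ VV ^ n, h n w ∈ VV ^ (n+1)
  hleib : ∀ n (a : R), ∀ w ∈ VV ^ n, h n (a • w) = ι R (D a) * w + a • h n w
  unit : ∀ n : ℕ, IsUnit ((n + 1 : ℕ) : R)

namespace KD

variable {δ : P →ₗ[R] R} {J 𝔞 : Ideal R} {N0 : Submodule R P} {D : Derivation ℤ R P}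
    {h : ℕ → ExteriorAlgebra R P →+ ExteriorAlgebra R P} (H : KD δ J 𝔞 N0 D h)

lemma memJ (H : KD δ J 𝔞 N0 D h) (p : P) : δ p ∈ J := by rw [← H.rng]; exact ⟨p, rfl⟩

lemma recur (H : KD δ J 𝔞 N0 D h) (n : ℕ) (p : P) {w : Lam} (hw : w ∈ VV ^ n) :
    h n (kd δ (ι R p * w)) - ι R (D (δ p)) * w - ι R p * h (n-1) (kd δ w) ∈ J • VV ^ (n+1) := by
  have key : h n (ι R p * kd δ w) + ι R p * h (n-1) (kd δ w) ∈ J • VV ^ (n+1) := by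
    cases n with
    | zero => rw [kd_zero δ hw]; simp
    | succ m =>
      have hy := kd_mem δ H.memJ m hw
      rw [Nat.add_sub_cancel]
      generalize kd δ w = y at hy
      induction hy using Submodule.smul_induction_on' with
      | smul j hj u hu =>
        have hpu : ι R p * u ∈ VV ^ (m+1) := by
          rw [pow_succ']; exact Submodule.mul_mem_mul ⟨p, rfl⟩ hu
        rw [mul_smul_comm, H.hleib _ _ _ hpu, H.hleib _ _ _ hu]
        have e : ι R (D j) * (ι R p * u) + ι R p * (ι R (D j) * u) = 0 := by
          rw [← mul_assoc, ← mul_assoc, ← add_mul, ι_add_mul_swap, zero_mul]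
        have e2 : ι R (D j) * (ι R p * u) + j • h (m+1) (ι R p * u) +
            ι R p * (ι R (D j) * u + j • h m u) =
            j • (h (m+1) (ι R p * u) + ι R p * h m u) := by
          rw [mul_add, mul_smul_comm, smul_add, add_add_add_comm, e, zero_add]
        rw [e2]
        refine Submodule.smul_mem_smul hj (add_mem (H.hmem _ _ hpu) ?_)
        rw [pow_succ' _ (m+1)]
        exact Submodule.mul_mem_mul ⟨p, rfl⟩ (H.hmem _ _ hu)
      | add x _ y _ h1 h2 =>
        have := add_mem h1 h2
        rw [mul_add, map_add, map_add, mul_add]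
        convert this using 1
        abel
  rw [kd_ι_mul, map_sub, H.hleib _ _ _ hw]
  have := sub_mem (Submodule.smul_mem_smul (H.memJ p) (H.hmem _ _ hw)) key
  convert this using 1
  abel

/-- next step of the filtration -/
def nxt (N0 : Submodule R P) : ℕ → ℕ → Submodule R Lam
  | 0, _ => ⊥
  | b+1, a => VV ^ b * (N0.map (ι R)) ^ (a+1)

lemma N_le (N0 : Submodule R P) : N0.map (ι R) ≤ VV := LinearMap.map_le_range

lemma NV_comm (N0 : Submodule R P) : N0.map (ι R) * VV ≤ VV * N0.map (ι R) := by
  rw [Submodule.mul_le]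
  rintro _ ⟨x, hx, rfl⟩ _ ⟨y, rfl⟩
  have : ι R x * ι R y = - (ι R y * ι R x) := by
    rw [eq_neg_iff_add_eq_zero, ι_add_mul_swap]
  rw [this]
  exact neg_mem (Submodule.mul_mem_mul ⟨y, rfl⟩ ⟨x, hx, rfl⟩)

lemma NVpow_comm (N0 : Submodule R P) (b : ℕ) :
    N0.map (ι R) * VV ^ b ≤ VV ^ b * N0.map (ι R) := by
  induction b with
  | zero => simp
  | succ b ih =>
    calc N0.map (ι R) * VV ^ (b+1) = (N0.map (ι R) * VV) * VV ^ b := by rw [pow_succ', mul_assoc]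
      _ ≤ (VV * N0.map (ι R)) * VV ^ b := mul_le_mul' (NV_comm N0) le_rfl
      _ = VV * (N0.map (ι R) * VV ^ b) := by rw [mul_assoc]
      _ ≤ VV * (VV ^ b * N0.map (ι R)) := mul_le_mul' le_rfl ih
      _ = VV ^ (b+1) * N0.map (ι R) := by rw [pow_succ' _ b, mul_assoc]

lemma VN_le (N0 : Submodule R P) (b a : ℕ) :
    VV ^ b * (N0.map (ι R)) ^ a ≤ (VV ^ (a + b) : Submodule R Lam) := by
  rw [add_comm, pow_add]
  exact mul_le_mul' le_rfl (pow_le_pow_left' (N_le N0) a)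

lemma C0 (H : KD δ J 𝔞 N0 D h) (a : ℕ) {w : Lam} (hw : w ∈ (N0.map (ι R)) ^ a) :
    h (a-1) (kd δ w) ∈ J • VV ^ a := by
  induction a generalizing w with
  | zero => rw [kd_zero δ (by simpa using hw)]; simp
  | succ a ih =>
    rw [pow_succ'] at hw
    rw [Nat.add_sub_cancel]
    induction hw using Submodule.mul_induction_on' with
    | mem_mul_mem x hx y hy =>
      obtain ⟨p, hp, rfl⟩ := hx
      have hyV : y ∈ VV ^ a := pow_le_pow_left' (N_le N0) a hy
      have r := H.recur a p hyV
      have r1 : ι R (D (δ p)) * y ∈ J • VV ^ (a+1) := by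
        rw [pow_succ']
        exact ι_smul_top_mul J (Submodule.smul_mono_left H.aJ (H.Da _ (H.dN p hp))) hyV
      have r2 : ι R p * h (a-1) (kd δ y) ∈ J • VV ^ (a+1) := by
        rw [pow_succ']
        exact mul_mem_mul_smul J ⟨p, rfl⟩ (ih hy)
      have := add_mem (add_mem r r1) r2
      convert this using 1
      abel
    | add x _ y _ h1 h2 => rw [map_add, map_add]; exact add_mem h1 h2

lemma C1 (H : KD δ J 𝔞 N0 D h) (b a : ℕ) {w : Lam} (hw : w ∈ VV ^ b * (N0.map (ι R)) ^ a) :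
    h (a+b-1) (kd δ w) - (b : R) • w ∈ nxt N0 b a ⊔ J • VV ^ (a+b) := by
  induction b generalizing w with
  | zero =>
    rw [pow_zero, one_mul] at hw
    have := H.C0 a hw
    simpa [nxt] using this
  | succ b ih =>
    rw [pow_succ', mul_assoc] at hw
    rw [← add_assoc, Nat.add_sub_cancel]
    induction hw using Submodule.mul_induction_on' with
    | mem_mul_mem x hx y hy =>
      obtain ⟨p, rfl⟩ := hx
      have hyV : y ∈ VV ^ (a+b) := VN_le N0 b a hy
      have r := Submodule.mem_sup_right (S := nxt N0 (b+1) a) (H.recur (a+b) p hyV)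
      have r1 : (ι R (D (δ p)) - ι R p) * y ∈ nxt N0 (b+1) a ⊔ J • VV ^ (a+b+1) := by
        obtain ⟨u, hu, v, hv, huv⟩ := Submodule.mem_sup.1 (H.Dd p)
        rw [← map_sub, ← huv, map_add, add_mul]
        refine add_mem (Submodule.mem_sup_left ?_) (Submodule.mem_sup_right ?_)
        · have : ι R u * y ∈ N0.map (ι R) * (VV ^ b * (N0.map (ι R)) ^ a) :=
            Submodule.mul_mem_mul ⟨u, hu, rfl⟩ hy
          rw [← mul_assoc] at this
          have := mul_le_mul' (NVpow_comm N0 b) le_rfl this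
          rwa [mul_assoc, ← pow_succ'] at this
        · rw [pow_succ']
          exact ι_smul_top_mul J hv hyV
      have r2 : ι R p * (h (a+b-1) (kd δ y) - (b : R) • y) ∈
          nxt N0 (b+1) a ⊔ J • VV ^ (a+b+1) := by
        obtain ⟨u, hu, v, hv, huv⟩ := Submodule.mem_sup.1 (ih hy)
        rw [← huv, mul_add]
        refine add_mem (Submodule.mem_sup_left ?_) (Submodule.mem_sup_right ?_)
        · cases b with
          | zero =>
            have : u = 0 := by simpa [nxt] using hu
            rw [this, mul_zero]; exact zero_mem _
          | succ b =>
            have : ι R p * u ∈ VV * (VV ^ b * (N0.map (ι R)) ^ (a+1)) :=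
              Submodule.mul_mem_mul ⟨p, rfl⟩ hu
            rwa [← mul_assoc, ← pow_succ'] at this
        · rw [pow_succ']
          exact mul_mem_mul_smul J ⟨p, rfl⟩ hv
      have := add_mem (add_mem r r1) r2
      convert this using 1
      rw [sub_mul, mul_sub, mul_smul_comm, Nat.cast_add, Nat.cast_one, add_smul, one_smul]
      abel
    | add x _ y _ h1 h2 =>
      have := add_mem h1 h2
      convert this using 1
      rw [map_add, map_add, smul_add]
      abel

lemma euler (H : KD δ J 𝔞 N0 D h) (M : ℕ) {j : R} (hj : j ∈ J ^ M) :
    δ (D j) - (M : R) * j ∈ J ^ (M+1) ⊔ 𝔞 := by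
  induction M generalizing j with
  | zero => simpa using Submodule.mem_sup_left (H.memJ (D j))
  | succ M ih =>
    rw [pow_succ] at hj
    induction hj using Submodule.mul_induction_on' with
    | mem_mul_mem x hx y hy =>
      have hy' : δ (D y) - y ∈ J ^ 2 ⊔ 𝔞 := by
        rw [← H.rng] at hy
        obtain ⟨p, rfl⟩ := hy
        rw [← map_sub]
        obtain ⟨u, hu, v, hv, huv⟩ := Submodule.mem_sup.1 (H.Dd p)
        rw [← huv, map_add]
        refine add_mem (Submodule.mem_sup_right (H.dN u hu)) (Submodule.mem_sup_left ?_)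
        clear huv
        induction hv using Submodule.smul_induction_on' with
        | smul r hr n hn =>
          rw [map_smul, pow_two]
          exact Ideal.mul_mem_mul hr (H.memJ n)
        | add x _ y _ h1 h2 => rw [map_add]; exact add_mem h1 h2
      have e : δ (D (x * y)) - ((M + 1 : ℕ) : R) * (x * y) =
          x * (δ (D y) - y) + y * (δ (D x) - (M : R) * x) := by
        rw [Derivation.leibniz, map_add, map_smul, map_smul]
        push_cast
        simp only [smul_eq_mul]
        ring
      rw [e]
      refine add_mem ?_ ?_
      · obtain ⟨u, hu, v, hv, huv⟩ := Submodule.mem_sup.1 hy'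
        rw [← huv, mul_add]
        refine add_mem (Submodule.mem_sup_left ?_)
          (Submodule.mem_sup_right (Ideal.mul_mem_left _ _ hv))
        have := Ideal.mul_mem_mul hx hu
        rwa [← pow_add] at this
      · obtain ⟨u, hu, v, hv, huv⟩ := Submodule.mem_sup.1 (ih hx)
        rw [← huv, mul_add]
        refine add_mem (Submodule.mem_sup_left ?_)
          (Submodule.mem_sup_right (Ideal.mul_mem_left _ _ hv))
        have := Ideal.mul_mem_mul hy hu
        rwa [← pow_succ'] at this
    | add x _ y _ h1 h2 =>
      have := add_mem h1 h2
      convert this using 1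
      rw [map_add, map_add]
      ring

/-- The weight operator (Lie derivative along the Euler field). -/
noncomputable def LL (δ : P →ₗ[R] R) (h : ℕ → ExteriorAlgebra R P →+ ExteriorAlgebra R P) (m : ℕ) :
    Lam →+ Lam :=
  (kd δ).toAddMonoidHom.comp (h (m+1)) + (h m).comp (kd δ).toAddMonoidHom

lemma LL_apply (m : ℕ) (z : Lam) : LL δ h m z = kd δ (h (m+1) z) + h m (kd δ z) := rfl

lemma LL_smul (H : KD δ J 𝔞 N0 D h) (m : ℕ) (a : R) {w : Lam} (hw : w ∈ VV ^ (m+1)) :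
    LL δ h m (a • w) = δ (D a) • w + a • LL δ h m w := by
  rw [LL_apply, LL_apply, H.hleib _ _ _ hw, map_add, kd_ι_mul, map_smul, map_smul,
    H.hleib _ _ _ (kd_mem' δ m hw), smul_add]
  abel

lemma LL_wt (H : KD δ J 𝔞 N0 D h) (m b a : ℕ) (hab : a + b = m + 1) {w : Lam}
    (hw : w ∈ VV ^ b * (N0.map (ι R)) ^ a) :
    LL δ h m w - (b : R) • w ∈ nxt N0 b a ⊔ J • VV ^ (m+1) := by
  have h1 := H.C1 b a hw
  have hwV := VN_le N0 b a hw
  rw [hab] at h1 hwV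
  rw [Nat.add_sub_cancel] at h1
  have h2 := Submodule.mem_sup_right (S := nxt N0 b a) (kd_mem δ H.memJ _ (H.hmem _ _ hwV))
  have := add_mem h2 h1
  rw [LL_apply]
  convert this using 1
  abel

lemma nxt_le (N0 : Submodule R P) (m b a : ℕ) (hab : a + b = m + 1) :
    nxt N0 b a ≤ (VV ^ (m+1) : Submodule R Lam) := by
  cases b with
  | zero => exact bot_le
  | succ b =>
    have := VN_le N0 b (a+1)
    rwa [show a + 1 + b = m + 1 by omega] at this

lemma F1 (H : KD δ J 𝔞 N0 D h) (M m b a : ℕ) (hab : a + b = m + 1) {y : Lam}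
    (hy : y ∈ J ^ M • (VV ^ b * (N0.map (ι R)) ^ a)) :
    LL δ h m y - ((b + M : ℕ) : R) • y ∈
      J ^ M • nxt N0 b a ⊔ J ^ (M+1) • VV ^ (m+1) ⊔ 𝔞 • VV ^ (m+1) := by
  induction hy using Submodule.smul_induction_on' with
  | smul j hj w hw =>
    have hwV := VN_le N0 b a hw
    rw [hab] at hwV
    rw [H.LL_smul m j hwV]
    have e : δ (D j) • w + j • LL δ h m w - ((b + M : ℕ) : R) • j • w =
        (δ (D j) - (M : R) * j) • w + j • (LL δ h m w - (b : R) • w) := by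
      push_cast
      module
    rw [e]
    refine add_mem ?_ ?_
    · obtain ⟨u, hu, v, hv, huv⟩ := Submodule.mem_sup.1 (H.euler M hj)
      rw [← huv, add_smul]
      exact add_mem (Submodule.mem_sup_left (Submodule.mem_sup_right
        (Submodule.smul_mem_smul hu hwV))) (Submodule.mem_sup_right
        (Submodule.smul_mem_smul hv hwV))
    · obtain ⟨u, hu, v, hv, huv⟩ := Submodule.mem_sup.1 (H.LL_wt m b a hab hw)
      rw [← huv, smul_add]
      refine Submodule.mem_sup_left (add_mem (Submodule.mem_sup_left
        (Submodule.smul_mem_smul hj hu)) (Submodule.mem_sup_right ?_))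
      rw [pow_succ, Submodule.mul_smul]
      exact Submodule.smul_mem_smul hj hv
  | add x _ y _ h1 h2 =>
    have := add_mem h1 h2
    convert this using 1
    rw [map_add, smul_add]
    abel

lemma F2 (H : KD δ J 𝔞 N0 D h) (M m : ℕ) {y : Lam} (hy : y ∈ J ^ M • VV ^ (m+1)) :
    LL δ h m y ∈ J ^ M • VV ^ (m+1) ⊔ 𝔞 • VV ^ (m+1) := by
  have h1 := H.F1 M m (m+1) 0 (by omega) (y := y) (by simpa using hy)
  have h2 : J ^ M • nxt N0 (m+1) 0 ⊔ J ^ (M+1) • VV ^ (m+1) ⊔ 𝔞 • VV ^ (m+1) ≤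
      J ^ M • VV ^ (m+1) ⊔ 𝔞 • VV ^ (m+1) := by
    refine sup_le_sup_right (sup_le ?_ ?_) _
    · exact Submodule.smul_mono le_rfl (nxt_le N0 m _ _ (by omega))
    · exact Submodule.smul_mono_left (Ideal.pow_le_pow_right (Nat.le_succ M))
  have h3 := add_mem (h2 h1) (Submodule.mem_sup_left (T := 𝔞 • VV ^ (m+1))
    (Submodule.smul_mem _ (((m + 1 + M : ℕ) : R)) hy))
  simpa using h3

/-- relative cycles -/
noncomputable def ZZ (δ : P →ₗ[R] R) (𝔞 : Ideal R) (m : ℕ) : Submodule R Lam :=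
  VV ^ (m+1) ⊓ (𝔞 • VV ^ m).comap (kd δ)

/-- relative boundaries -/
noncomputable def BB (δ : P →ₗ[R] R) (𝔞 : Ideal R) (m : ℕ) : Submodule R Lam :=
  (VV ^ (m+2)).map (kd δ) ⊔ 𝔞 • VV ^ (m+1)

lemma kd_smul_mem (δ : P →ₗ[R] R) (𝔞 : Ideal R) (m : ℕ) {z : Lam} (hz : z ∈ 𝔞 • VV ^ (m+1)) :
    kd δ z ∈ 𝔞 • VV ^ m := by
  induction hz using Submodule.smul_induction_on' with
  | smul j hj w hw => rw [map_smul]; exact Submodule.smul_mem_smul hj (kd_mem' δ m hw)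
  | add x _ y _ h1 h2 => rw [map_add]; exact add_mem h1 h2

lemma BB_le_ZZ (δ : P →ₗ[R] R) (𝔞 : Ideal R) (m : ℕ) : BB δ 𝔞 m ≤ ZZ δ 𝔞 m := by
  refine sup_le ?_ ?_
  · rintro _ ⟨w, hw, rfl⟩
    refine ⟨kd_mem' δ _ hw, ?_⟩
    change kd δ (kd δ w) ∈ 𝔞 • VV ^ m
    rw [kd_kd]; exact zero_mem _
  · intro z hz
    exact ⟨Submodule.smul_le_right hz, kd_smul_mem δ 𝔞 m hz⟩

lemma kd_N (H : KD δ J 𝔞 N0 D h) (m : ℕ) {w : Lam} (hw : w ∈ (N0.map (ι R)) ^ (m+1)) :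
    kd δ w ∈ 𝔞 • VV ^ m := by
  induction m generalizing w with
  | zero =>
    rw [pow_succ'] at hw
    induction hw using Submodule.mul_induction_on' with
    | mem_mul_mem x hx y hy =>
      obtain ⟨p, hp, rfl⟩ := hx
      rw [kd_ι_mul, kd_zero δ (by simpa using hy), mul_zero, sub_zero]
      exact Submodule.smul_mem_smul (H.dN p hp) (by simpa using hy)
    | add x _ y _ h1 h2 => rw [map_add]; exact add_mem h1 h2
  | succ m ih =>
    rw [pow_succ'] at hw
    induction hw using Submodule.mul_induction_on' with
    | mem_mul_mem x hx y hy =>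
      obtain ⟨p, hp, rfl⟩ := hx
      rw [kd_ι_mul]
      refine sub_mem (Submodule.smul_mem_smul (H.dN p hp)
        (pow_le_pow_left' (N_le N0) _ hy)) ?_
      rw [pow_succ' _ m]
      exact mul_mem_mul_smul 𝔞 ⟨p, rfl⟩ (ih hy)
    | add x _ y _ h1 h2 => rw [map_add]; exact add_mem h1 h2

lemma G_le_ZZ (H : KD δ J 𝔞 N0 D h) (m : ℕ) : (N0.map (ι R)) ^ (m+1) ≤ ZZ δ 𝔞 m :=
  fun _ hw => ⟨pow_le_pow_left' (N_le N0) _ hw, H.kd_N m hw⟩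

lemma J_ZZ (H : KD δ J 𝔞 N0 D h) (m : ℕ) : J • ZZ δ 𝔞 m ≤ BB δ 𝔞 m := by
  rw [Submodule.smul_le]
  rintro j hj z ⟨hz, hdz⟩
  rw [← H.rng] at hj
  obtain ⟨p, rfl⟩ := hj
  have e : δ p • z = kd δ (ι R p * z) + ι R p * kd δ z := by rw [kd_ι_mul]; abel
  rw [e]
  refine add_mem (Submodule.mem_sup_left ⟨_, ?_, rfl⟩) (Submodule.mem_sup_right ?_)
  · change _ ∈ VV ^ (m+2)
    rw [pow_succ' _ (m+1)]; exact Submodule.mul_mem_mul ⟨p, rfl⟩ hz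
  · rw [pow_succ' _ m]; exact mul_mem_mul_smul 𝔞 ⟨p, rfl⟩ hdz

lemma LL_ZZ (H : KD δ J 𝔞 N0 D h) (m : ℕ) {z : Lam} (hz : z ∈ ZZ δ 𝔞 m) :
    LL δ h m z ∈ BB δ 𝔞 m := by
  rw [LL_apply]
  refine add_mem (Submodule.mem_sup_left ⟨_, H.hmem _ _ hz.1, rfl⟩) (Submodule.mem_sup_right ?_)
  have : kd δ z ∈ 𝔞 • VV ^ m := hz.2
  generalize kd δ z = y at this
  induction this using Submodule.smul_induction_on' with
  | smul j hj w hw =>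
    rw [H.hleib _ _ _ hw]
    refine add_mem ?_ (Submodule.smul_mem_smul hj (H.hmem _ _ hw))
    rw [pow_succ']
    exact ι_smul_top_mul 𝔞 (H.Da j hj) hw
  | add x _ y _ h1 h2 => rw [map_add]; exact add_mem h1 h2

lemma step (H : KD δ J 𝔞 N0 D h) (M m b a : ℕ) (hab : a + b = m + 1) (hbM : b + M ≠ 0)
    (hq : ZZ δ 𝔞 m ≤ J ^ M • (VV ^ b * (N0.map (ι R)) ^ a) ⊔ J ^ (M+1) • VV ^ (m+1) ⊔
      ((N0.map (ι R)) ^ (m+1) ⊔ BB δ 𝔞 m)) :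
    ZZ δ 𝔞 m ≤ J ^ M • nxt N0 b a ⊔ J ^ (M+1) • VV ^ (m+1) ⊔
      ((N0.map (ι R)) ^ (m+1) ⊔ BB δ 𝔞 m) := by
  set W := J ^ M • nxt N0 b a ⊔ J ^ (M+1) • VV ^ (m+1) ⊔ ((N0.map (ι R)) ^ (m+1) ⊔ BB δ 𝔞 m)
    with hW
  have hBW : BB δ 𝔞 m ≤ W := le_sup_right.trans le_sup_right
  have haW : 𝔞 • VV ^ (m+1) ≤ W := le_sup_right.trans hBW
  have hJW : J ^ (M+1) • VV ^ (m+1) ≤ W := le_sup_right.trans le_sup_left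
  have hGW : (N0.map (ι R)) ^ (m+1) ⊔ BB δ 𝔞 m ≤ W := le_sup_right
  intro z hz
  obtain ⟨x, hx, g, hg, rfl⟩ := Submodule.mem_sup.1 (hq hz)
  obtain ⟨y, hy, y', hy', rfl⟩ := Submodule.mem_sup.1 hx
  set c : R := ((b + M : ℕ) : R) with hc
  have hcu : IsUnit c := by
    obtain ⟨n, hn⟩ := Nat.exists_eq_succ_of_ne_zero hbM
    rw [hc, hn]; exact H.unit n
  have h1 : LL δ h m y - c • y ∈ W := by
    refine (sup_le ?_ haW : _ ≤ W) (H.F1 M m b a hab hy)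
    exact le_sup_left
  have h2 : LL δ h m y' - c • y' ∈ W := by
    refine sub_mem ((sup_le hJW haW : _ ≤ W) (H.F2 (M+1) m hy')) (W.smul_mem _ (hJW hy'))
  have h3 : LL δ h m g - c • g ∈ W := by
    refine sub_mem (hBW (H.LL_ZZ m ?_)) (W.smul_mem _ (hGW hg))
    exact (sup_le (H.G_le_ZZ m) (BB_le_ZZ δ 𝔞 m) : _ ≤ ZZ δ 𝔞 m) hg
  have h4 : LL δ h m (y + y' + g) ∈ W := hBW (H.LL_ZZ m hz)
  have h5 : c • (y + y' + g) ∈ W := by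
    have := sub_mem h4 (add_mem (add_mem h1 h2) h3)
    convert this using 1
    rw [map_add, map_add, smul_add, smul_add]
    abel
  obtain ⟨c', hc'⟩ := hcu
  have := W.smul_mem (↑c'⁻¹ : R) h5
  rwa [← hc', smul_smul, Units.inv_mul, one_smul] at this

lemma stepAll (H : KD δ J 𝔞 N0 D h) (M m : ℕ)
    (hq : ZZ δ 𝔞 m ≤ J ^ M • VV ^ (m+1) ⊔ ((N0.map (ι R)) ^ (m+1) ⊔ BB δ 𝔞 m)) :
    ZZ δ 𝔞 m ≤ J ^ (M+1) • VV ^ (m+1) ⊔ ((N0.map (ι R)) ^ (m+1) ⊔ BB δ 𝔞 m) := by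
  have key : ∀ a b, a + b = m + 1 →
      ZZ δ 𝔞 m ≤ J ^ M • (VV ^ b * (N0.map (ι R)) ^ a) ⊔ J ^ (M+1) • VV ^ (m+1) ⊔
        ((N0.map (ι R)) ^ (m+1) ⊔ BB δ 𝔞 m) := by
    intro a
    induction a with
    | zero =>
      intro b hb
      obtain rfl : b = m + 1 := by omega
      rw [pow_zero, mul_one]
      exact hq.trans (sup_le_sup_right le_sup_left _)
    | succ a ih =>
      intro b hb
      exact H.step M m (b+1) a (by omega) (by omega) (ih (b+1) (by omega))
  by_cases hM : M = 0
  · subst hM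
    have := key (m+1) 0 (by omega)
    refine this.trans (sup_le (sup_le ?_ le_sup_left) le_sup_right)
    simp only [pow_zero, one_mul]
    exact Submodule.smul_le_right.trans (le_sup_left.trans le_sup_right)
  · have := H.step M m 0 (m+1) (by omega) (by omega) (key (m+1) 0 (by omega))
    simpa [nxt] using this

theorem main [IsNoetherianRing R] [Module.Finite R P] (H : KD δ J 𝔞 N0 D h) (m : ℕ) :
    ZZ δ 𝔞 m ≤ (N0.map (ι R)) ^ (m+1) ⊔ BB δ 𝔞 m := by
  have all : ∀ M, ZZ δ 𝔞 m ≤ J ^ M • VV ^ (m+1) ⊔ ((N0.map (ι R)) ^ (m+1) ⊔ BB δ 𝔞 m) := by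
    intro M
    induction M with
    | zero =>
      refine le_trans ?_ le_sup_left
      rw [pow_zero, Ideal.one_eq_top, Submodule.top_smul]
      exact inf_le_left
    | succ M ih => exact H.stepAll M m ih
  -- Artin-Rees
  have : ∃ M, J ^ M • VV ^ (m+1) ⊓ ZZ δ 𝔞 m ≤ J • ZZ δ 𝔞 m := by
    let X := ⋀[R]^(m+1) P
    have hfin : Module.Finite R X := inferInstance
    let Z : Submodule R X := (ZZ δ 𝔞 m).comap X.subtype
    obtain ⟨k, hk⟩ := J.exists_pow_inf_eq_pow_smul Z
    refine ⟨k + 1, ?_⟩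
    rintro x ⟨hx1, hx2⟩
    have hxX : x ∈ X := hx2.1
    have hx1' : (⟨x, hxX⟩ : X) ∈ J ^ (k+1) • (⊤ : Submodule R X) := by
      have : x ∈ (J ^ (k+1) • (⊤ : Submodule R X)).map X.subtype := by
        rw [Submodule.map_smul'', Submodule.map_top, Submodule.range_subtype]
        exact hx1
      obtain ⟨y, hy, rfl⟩ := this
      exact hy
    have h3 : (⟨x, hxX⟩ : X) ∈ J ^ (k+1) • (⊤ : Submodule R X) ⊓ Z := ⟨hx1', hx2⟩
    rw [hk (k+1) (by omega), Nat.add_sub_cancel_left, pow_one] at h3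
    have h4 : x ∈ (J • (J ^ k • (⊤ : Submodule R X) ⊓ Z)).map X.subtype := ⟨_, h3, rfl⟩
    rw [Submodule.map_smul''] at h4
    refine (Submodule.smul_mono le_rfl ?_ : _ ≤ J • ZZ δ 𝔞 m) h4
    rintro _ ⟨y, hy, rfl⟩
    exact hy.2
  obtain ⟨M, hM⟩ := this
  intro z hz
  obtain ⟨x, hx, g, hg, rfl⟩ := Submodule.mem_sup.1 (all M hz)
  have hgZ : g ∈ ZZ δ 𝔞 m := (sup_le (H.G_le_ZZ m) (BB_le_ZZ δ 𝔞 m) : _ ≤ ZZ δ 𝔞 m) hg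
  have hxZ : x ∈ ZZ δ 𝔞 m := by simpa using sub_mem hz hgZ
  exact add_mem (Submodule.mem_sup_right (H.J_ZZ m (hM ⟨hx, hxZ⟩))) hg

end KD

end Part1

section TorPart
open CategoryTheory.MonoidalCategory CategoryTheory.Limits TensorProduct

variable {A : Type u} [CommRing A]

/-- the complex `X ⊗ F` -/
noncomputable abbrev GG (F : ChainComplex (ModuleCat.{u} A) ℕ) (X : ModuleCat.{u} A) :
    ChainComplex (ModuleCat.{u} A) ℕ :=
  (((tensoringLeft (ModuleCat.{u} A)).obj X).mapHomologicalComplex _).obj F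

noncomputable abbrev GGm (F : ChainComplex (ModuleCat.{u} A) ℕ) {X X' : ModuleCat.{u} A} (f : X ⟶ X') :
    GG F X ⟶ GG F X' :=
  (NatTrans.mapHomologicalComplex ((tensoringLeft (ModuleCat.{u} A)).map f) _).app F

lemma GG_shortExact (F : ChainComplex (ModuleCat.{u} A) ℕ) (hF : ∀ i, Module.Flat A (F.X i))
    {X₁ X₂ X₃ : ModuleCat.{u} A} (f : X₁ ⟶ X₂) (g : X₂ ⟶ X₃) (hf : Function.Injective f)
    (hg : Function.Surjective g) (hfg : Function.Exact f g) :
    ∃ w : GGm F f ≫ GGm F g = 0, (ShortComplex.mk (GGm F f) (GGm F g) w).ShortExact := by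
  have w0 : f ≫ g = 0 := by
    ext x; exact hfg.apply_apply_eq_zero x
  have w : GGm F f ≫ GGm F g = 0 := by
    rw [← NatTrans.comp_app, ← NatTrans.mapHomologicalComplex_comp, ← Functor.map_comp, w0]
    ext i : 1
    simp
    rfl
  refine ⟨w, HomologicalComplex.shortExact_of_degreewise_shortExact _ fun i => ?_⟩
  have := hF i
  have he : (ShortComplex.mk f g w0).ShortExact := by
    refine ShortComplex.ShortExact.mk' ?_ ?_ ?_
    · rw [ShortComplex.ShortExact.moduleCat_exact_iff_function_exact]; exact hfg
    · exact (ModuleCat.mono_iff_injective _).2 hf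
    · exact (ModuleCat.epi_iff_surjective _).2 hg
  refine ShortComplex.ShortExact.mk' ?_ ?_ ?_
  · exact (Module.Flat.rTensor_shortComplex_exact (F.X i) _ he.exact)
  · rw [ModuleCat.mono_iff_injective]
    exact Module.Flat.rTensor_preserves_injective_linearMap (M := F.X i) f.hom hf
  · rw [ModuleCat.epi_iff_surjective]
    exact LinearMap.rTensor_surjective (F.X i) hg

lemma GG_zero {Y : ModuleCat.{u} A} (F : ProjectiveResolution Y) (X : ModuleCat.{u} A)
    (hX : Module.Flat A X) (i : ℕ) : IsZero ((GG F.complex X).homology (i+1)) := by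
  refine (HomologicalComplex.exactAt_iff_isZero_homology _ _).1 ?_
  have h := F.complex_exactAt_succ i
  have h' := (HomologicalComplex.exactAt_iff' _ (i+2) (i+1) i (by simp) (by simp)).1 h
  refine (HomologicalComplex.exactAt_iff' _ (i+2) (i+1) i (by simp) (by simp)).2 ?_
  have h'' := Module.Flat.lTensor_shortComplex_exact X _ h'
  exact h''

lemma tor_shift {Y : ModuleCat.{u} A} (F : ProjectiveResolution Y)
    (hF : ∀ i, Module.Flat A (F.complex.X i))
    {X₁ X₂ X₃ : ModuleCat.{u} A} (f : X₁ ⟶ X₂) (g : X₂ ⟶ X₃) (hf : Function.Injective f)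
    (hg : Function.Surjective g) (hfg : Function.Exact f g) (hX : Module.Flat A X₂) (i : ℕ) :
    Nonempty ((GG F.complex X₃).homology (i+2) ≅ (GG F.complex X₁).homology (i+1)) := by
  obtain ⟨w, hS⟩ := GG_shortExact F.complex hF f g hf hg hfg
  exact ⟨hS.δIso (i+2) (i+1) (by simp) (GG_zero F X₂ hX (i+1)) (GG_zero F X₂ hX i)⟩

instance (X : ModuleCat.{u} A) :
    PreservesFiniteColimits ((tensoringLeft (ModuleCat.{u} A)).obj X) :=
  inferInstanceAs (PreservesFiniteColimits (tensorLeft X))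

noncomputable def GG0 {Y : ModuleCat.{u} A} (F : ProjectiveResolution Y) (X : ModuleCat.{u} A) :
    (GG F.complex X).homology 0 ≅ X ⊗ Y :=
  (asIso ((GG F.complex X).homologyι 0)) ≪≫
    asIso (F.fromLeftDerivedZero' ((tensoringLeft (ModuleCat.{u} A)).obj X))

lemma GG0_nat {Y : ModuleCat.{u} A} (F : ProjectiveResolution Y) {X X' : ModuleCat.{u} A} (f : X ⟶ X') :
    HomologicalComplex.homologyMap (GGm F.complex f) 0 ≫ (GG0 F X').hom = (GG0 F X).hom ≫ f ▷ Y := by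
  have h2 : HomologicalComplex.opcyclesMap (GGm F.complex f) 0 ≫
      F.fromLeftDerivedZero' ((tensoringLeft (ModuleCat.{u} A)).obj X') =
      F.fromLeftDerivedZero' ((tensoringLeft (ModuleCat.{u} A)).obj X) ≫ f ▷ Y := by
    rw [← cancel_epi (HomologicalComplex.pOpcycles _ _)]
    have e1 := HomologicalComplex.p_opcyclesMap_assoc (GGm F.complex f) 0
      (F.fromLeftDerivedZero' ((tensoringLeft (ModuleCat.{u} A)).obj X'))
    have e2 := F.pOpcycles_comp_fromLeftDerivedZero' ((tensoringLeft (ModuleCat.{u} A)).obj X')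
    have e3 := F.pOpcycles_comp_fromLeftDerivedZero' ((tensoringLeft (ModuleCat.{u} A)).obj X)
    refine e1.trans ?_
    rw [e2]
    refine Eq.trans ?_ (Category.assoc _ _ _)
    rw [e3]
    exact (whisker_exchange f (F.π.f 0)).symm
  have h1 := HomologicalComplex.homologyι_naturality (GGm F.complex f) 0
  change _ ≫ (_ ≫ _) = (_ ≫ _) ≫ _
  rw [Category.assoc]
  erw [← h2]
  erw [reassoc_of% h1]
  rfl

lemma tor_one {Y : ModuleCat.{u} A} (F : ProjectiveResolution Y)
    (hF : ∀ i, Module.Flat A (F.complex.X i))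
    {X₁ X₂ X₃ : ModuleCat.{u} A} (f : X₁ ⟶ X₂) (g : X₂ ⟶ X₃) (hf : Function.Injective f)
    (hg : Function.Surjective g) (hfg : Function.Exact f g) (hX : Module.Flat A X₂) :
    Nonempty ((GG F.complex X₃).homology 1 ≃ₗ[A] LinearMap.ker (f.hom.rTensor Y)) := by
  obtain ⟨w, hS⟩ := GG_shortExact F.complex hF f g hf hg hfg
  have hm : Mono (hS.δ 1 0 (by simp)) := hS.mono_δ 1 0 (by simp) (GG_zero F X₂ hX 0)
  have he := hS.homology_exact₁ 1 0 (by simp)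
  have hm' := (ModuleCat.mono_iff_injective _).1 hm
  have he' := (ShortComplex.ShortExact.moduleCat_exact_iff_function_exact _).1 he
  let φ : (GG F.complex X₃).homology 1 →ₗ[A] X₁ ⊗[A] Y :=
    (hS.δ 1 0 (by simp) ≫ (GG0 F X₁).hom).hom
  have hφ : Function.Injective φ := by
    have : Mono (hS.δ 1 0 (by simp) ≫ (GG0 F X₁).hom) := mono_comp _ _
    exact (ModuleCat.mono_iff_injective _).1 this
  have hr : LinearMap.range φ = LinearMap.ker (f.hom.rTensor Y) := by
    ext x
    constructor
    · rintro ⟨y, rfl⟩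
      have e : (hS.δ 1 0 (by simp) ≫ (GG0 F X₁).hom) ≫ f ▷ Y = 0 := by
        rw [Category.assoc, ← GG0_nat, ← Category.assoc]
        erw [hS.δ_comp]
        simp
      exact congrArg (fun q => q.hom y) e
    · intro hx
      have hx' : (f ▷ Y).hom x = 0 := hx
      obtain ⟨y, hy⟩ : ∃ y, (GG0 F X₁).hom.hom y = x := ⟨(GG0 F X₁).inv.hom x, by
        rw [← LinearMap.comp_apply, ← ModuleCat.hom_comp, Iso.inv_hom_id]; rfl⟩
      have e : ((GG0 F X₁).hom ≫ f ▷ Y).hom y = 0 := by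
        rw [ModuleCat.hom_comp, LinearMap.comp_apply, hy]; exact hx'
      rw [← GG0_nat] at e
      have e' : (HomologicalComplex.homologyMap (GGm F.complex f) 0).hom y = 0 := by
        have : Function.Injective (GG0 F X₂).hom.hom :=
          (ModuleCat.mono_iff_injective _).1 inferInstance
        apply this
        rw [map_zero]
        exact e
      obtain ⟨z, hz⟩ := (he' y).1 e'
      refine ⟨z, ?_⟩
      rw [← hy, ← hz]
      rfl
  exact ⟨(LinearEquiv.ofInjective φ hφ).trans (LinearEquiv.ofEq _ _ hr)⟩


lemma tmul_one_eq_zero_iff (I : Ideal A) {M : Type*} [AddCommGroup M] [Module A M] (m : M) :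
    (m ⊗ₜ[A] (1 : A ⧸ I)) = 0 ↔ m ∈ I • (⊤ : Submodule A M) := by
  rw [← (TensorProduct.tensorQuotEquivQuotSMul M I).map_eq_zero_iff]
  have : (TensorProduct.tensorQuotEquivQuotSMul M I) (m ⊗ₜ[A] (1 : A ⧸ I)) =
      Submodule.Quotient.mk m := by
    have := TensorProduct.tensorQuotEquivQuotSMul_tmul_mk (I := I) m (1 : A)
    simpa using this
  rw [this, Submodule.Quotient.mk_eq_zero]

lemma exists_tmul_one (I : Ideal A) {M : Type*} [AddCommGroup M] [Module A M] (x : M ⊗[A] (A ⧸ I)) :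
    ∃ m : M, x = m ⊗ₜ[A] (1 : A ⧸ I) := by
  induction x with
  | zero => exact ⟨0, by simp⟩
  | tmul m b =>
    obtain ⟨a, rfl⟩ := Ideal.Quotient.mk_surjective b
    refine ⟨a • m, ?_⟩
    rw [TensorProduct.smul_tmul]
    congr 1
    rw [Algebra.smul_def, mul_one]; rfl
  | add x y hx hy =>
    obtain ⟨m, rfl⟩ := hx
    obtain ⟨m', rfl⟩ := hy
    exact ⟨m + m', by rw [TensorProduct.add_tmul]⟩

lemma tor_chain {Y : ModuleCat.{u} A} (F : ProjectiveResolution Y)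
    (hF : ∀ i, Module.Flat A (F.complex.X i)) (n : ℕ) :
    ∀ (K : ℕ → Type u) [∀ i, AddCommGroup (K i)] [∀ i, Module A (K i)]
      (_ : ∀ i, Module.Flat A (K i)) (d : ∀ i, K (i+1) →ₗ[A] K i)
      (X : Type u) [AddCommGroup X] [Module A X] (e : K 0 →ₗ[A] X) (_ : Function.Surjective e)
      (_ : Function.Exact (d 0) e) (_ : ∀ i, Function.Exact (d (i+1)) (d i)),
      Nonempty ((GG F.complex (ModuleCat.of A X)).homology (n+1) ≃ₗ[A]
        LinearMap.ker ((LinearMap.range (d n)).subtype.rTensor Y)) := by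
  induction n with
  | zero =>
    intro K _ _ hK d X _ _ e he hde hd
    refine tor_one F hF (ModuleCat.ofHom (LinearMap.range (d 0)).subtype) (ModuleCat.ofHom e)
      (Submodule.subtype_injective _) he ?_ (hK 0)
    intro x
    exact (hde x).trans (by simp)
  | succ n ih =>
    intro K _ _ hK d X _ _ e he hde hd
    obtain ⟨i⟩ := tor_shift F hF (ModuleCat.ofHom (LinearMap.range (d 0)).subtype) (ModuleCat.ofHom e)
      (Submodule.subtype_injective _) he (fun x => (hde x).trans (by simp)) (hK 0) n
    obtain ⟨j⟩ := ih (fun i => K (i+1)) (fun i => hK (i+1)) (fun i => d (i+1))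
      (LinearMap.range (d 0)) (d 0).rangeRestrict (LinearMap.surjective_rangeRestrict _)
      (fun x => by
        rw [← hd 0 x, Subtype.ext_iff]; rfl) (fun i => hd (i+1))
    exact ⟨i.toLinearEquiv.trans j⟩

lemma equiv_of_ker_eq {W M T : Type*} [AddCommGroup W] [Module A W] [AddCommMonoid M]
    [Module A M] [AddCommMonoid T] [Module A T] (α : W →ₗ[A] M) (ψ : W →ₗ[A] T)
    (hα : Function.Surjective α) (hψ : Function.Surjective ψ)
    (hk : ∀ z, α z = 0 ↔ ψ z = 0) : Nonempty (M ≃ₗ[A] T) := by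
  choose σ hσ using hα
  have key : ∀ z w, α z = α w → ψ z = ψ w := by
    intro z w h
    have h0 : α (w - w) = 0 := by rw [sub_self, map_zero]
    have : α (z - w) = 0 := by
      rw [sub_eq_add_neg, map_add, h, ← map_add, ← sub_eq_add_neg, h0]
    have h1 := (hk _).1 this
    rw [← sub_add_cancel z w, map_add, h1, zero_add]
  have key' : ∀ z w, ψ z = ψ w → α z = α w := by
    intro z w h
    have h0 : ψ (w - w) = 0 := by rw [sub_self, map_zero]
    have : ψ (z - w) = 0 := by
      rw [sub_eq_add_neg, map_add, h, ← map_add, ← sub_eq_add_neg, h0]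
    have h1 := (hk _).2 this
    rw [← sub_add_cancel z w, map_add, h1, zero_add]
  let f : M →ₗ[A] T :=
    { toFun := fun m => ψ (σ m)
      map_add' := fun x y => by
        rw [← map_add]; apply key; rw [map_add, hσ, hσ, hσ]
      map_smul' := fun a x => by
        rw [RingHom.id_apply, ← map_smul]; apply key; rw [map_smul, hσ, hσ] }
  refine ⟨LinearEquiv.ofBijective f ⟨fun x y h => ?_, fun t => ?_⟩⟩
  · rw [← hσ x, ← hσ y]; exact key' _ _ h
  · obtain ⟨w, rfl⟩ := hψ t
    exact ⟨α w, key _ _ (hσ _)⟩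

lemma ker_equiv (I : Ideal A) {M M' T : Type*} [AddCommGroup M] [Module A M] [AddCommGroup M']
    [Module A M'] [AddCommMonoid T] [Module A T] (d : M →ₗ[A] M') (Φ : M →ₗ[A] T)
    (Q : Submodule A M) (hQ : LinearMap.ker d = Q)
    (h1 : ∀ t, ∃ z, d z ∈ I • (⊤ : Submodule A M') ∧ Φ z = t)
    (h2 : ∀ z, d z ∈ I • (⊤ : Submodule A M') → (Φ z = 0 ↔ z ∈ Q ⊔ I • (⊤ : Submodule A M))) :
    Nonempty (LinearMap.ker ((LinearMap.range d).subtype.rTensor (A ⧸ I)) ≃ₗ[A] T) := by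
  let W : Submodule A M := (I • (⊤ : Submodule A M')).comap d
  let ψ : W →ₗ[A] T := Φ ∘ₗ W.subtype
  have hψ : Function.Surjective ψ := fun t => by
    obtain ⟨z, hz, rfl⟩ := h1 t
    exact ⟨⟨z, hz⟩, rfl⟩
  obtain ⟨α0, hα0⟩ : ∃ α0 : W →ₗ[A] (LinearMap.range d) ⊗[A] (A ⧸ I),
      ∀ z : W, α0 z = (d.rangeRestrict z) ⊗ₜ (1 : A ⧸ I) :=
    ⟨(TensorProduct.mk A _ (A ⧸ I)).flip 1 ∘ₗ d.rangeRestrict ∘ₗ W.subtype, fun z => rfl⟩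
  obtain ⟨α, hα1⟩ : ∃ α : W →ₗ[A] LinearMap.ker ((LinearMap.range d).subtype.rTensor (A ⧸ I)),
      ∀ z, (α z : (LinearMap.range d) ⊗[A] (A ⧸ I)) = α0 z :=
    ⟨α0.codRestrict _ fun z => by
      rw [LinearMap.mem_ker, hα0, LinearMap.rTensor_tmul, tmul_one_eq_zero_iff]
      exact z.2, fun z => rfl⟩
  have hα : Function.Surjective α := by
    rintro ⟨x, hx⟩
    obtain ⟨⟨_, ⟨z, rfl⟩⟩, rfl⟩ := exists_tmul_one I x
    rw [LinearMap.mem_ker, LinearMap.rTensor_tmul, tmul_one_eq_zero_iff] at hx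
    exact ⟨⟨z, hx⟩, Subtype.ext ((hα1 _).trans (hα0 _))⟩
  have hk : ∀ z, α z = 0 ↔ ψ z = 0 := by
    intro z
    have e1 : α z = 0 ↔ α0 z = 0 := by
      rw [← hα1, Submodule.coe_eq_zero]
    rw [e1, hα0, tmul_one_eq_zero_iff]
    refine Iff.trans ?_ (h2 z z.2).symm
    have e2 : I • (⊤ : Submodule A (LinearMap.range d)) = (I • (⊤ : Submodule A M)).map d.rangeRestrict := by
      rw [Submodule.map_smul'', Submodule.map_top, LinearMap.range_rangeRestrict]
    rw [e2, Submodule.mem_map]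
    constructor
    · rintro ⟨y, hy, hyz⟩
      have : (z : M) - y ∈ Q := by
        rw [← hQ, LinearMap.mem_ker, map_sub, sub_eq_zero]
        exact (congrArg Subtype.val hyz).symm
      rw [← sub_add_cancel (z : M) y]
      exact Submodule.add_mem_sup this hy
    · intro h
      obtain ⟨q, hq, y, hy, hqy⟩ := Submodule.mem_sup.1 h
      refine ⟨y, hy, Subtype.ext ?_⟩
      rw [← hQ, LinearMap.mem_ker] at hq
      rw [← hqy]
      simp [hq]
  exact equiv_of_ker_eq α ψ hα hψ hk

/-- `Tor` from a flat resolution -/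
theorem tor_of_flat_res (I : Ideal A) (n : ℕ) 
    (K : ℕ → Type u) [∀ i, AddCommGroup (K i)] [∀ i, Module A (K i)]
    (hK : ∀ i, Module.Flat A (K i)) (d : ∀ i, K (i+1) →ₗ[A] K i)
    (X : Type u) [AddCommGroup X] [Module A X] (e : K 0 →ₗ[A] X) (he : Function.Surjective e)
    (hde : Function.Exact (d 0) e) (hd : ∀ i, Function.Exact (d (i+1)) (d i))
    {T : Type*} [AddCommMonoid T] [Module A T] (Φ : K (n+1) →ₗ[A] T)
    (h1 : ∀ t, ∃ z, d n z ∈ I • (⊤ : Submodule A (K n)) ∧ Φ z = t)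
    (h2 : ∀ z, d n z ∈ I • (⊤ : Submodule A (K n)) →
      (Φ z = 0 ↔ z ∈ LinearMap.range (d (n+1)) ⊔ I • (⊤ : Submodule A (K (n+1))))) :
    Nonempty ((((Tor (ModuleCat.{u} A) (n+1)).obj (ModuleCat.of A X)).obj
          (ModuleCat.of A (A ⧸ I))) ≃ₗ[A] T) := by
  let F := projectiveResolution (ModuleCat.of A (A ⧸ I))
  have hF : ∀ i, Module.Flat A (F.complex.X i) := fun i => by
    have : Module.Projective A (F.complex.X i) := (IsProjective.iff_projective _).2 (F.projective i)
    infer_instance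
  obtain ⟨j⟩ := tor_chain F hF n K hK d X e he hde hd
  obtain ⟨j'⟩ := ker_equiv I (d n) Φ _ (LinearMap.exact_iff.1 (hd n)) h1 h2
  have i := F.isoLeftDerivedObj ((tensoringLeft (ModuleCat.{u} A)).obj (ModuleCat.of A X)) (n+1)
  exact ⟨i.toLinearEquiv.trans (j.trans j')⟩

theorem tor_zero (I : Ideal A) : Nonempty ((((Tor (ModuleCat.{u} A) 0).obj (ModuleCat.of A (A ⧸ I))).obj
          (ModuleCat.of A (A ⧸ I))) ≃ₗ[A] (A ⧸ I)) := by
  have i := (((tensoringLeft (ModuleCat.{u} A)).obj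
    (ModuleCat.of A (A ⧸ I))).leftDerivedZeroIsoSelf).app (ModuleCat.of A (A ⧸ I))
  have hb : I • (⊤ : Submodule A (A ⧸ I)) = ⊥ := ?_
  · have j : (A ⧸ I) ⊗[A] (A ⧸ I) ≃ₗ[A] (A ⧸ I) :=
      (TensorProduct.tensorQuotEquivQuotSMul (A ⧸ I) I).trans (Submodule.quotEquivOfEqBot _ hb)
    exact ⟨i.toLinearEquiv.trans j⟩
  rw [eq_bot_iff, Submodule.smul_le]
  rintro x hx y -
  rw [Submodule.mem_bot, Algebra.smul_def, Ideal.Quotient.algebraMap_eq,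
    Ideal.Quotient.eq_zero_iff_mem.2 hx, zero_mul]
end TorPart

section EPart
open TensorProduct
variable {k A : Type*} [CommRing k] [CommRing A] [Algebra k A]

/-- derivations map I² to I•M -/
lemma der_sq {R M : Type*} [CommRing R] [AddCommGroup M] [Module R M] (I : Ideal R)
    (D : R → M) (hadd : ∀ a b, D (a + b) = D a + D b)
    (hmul : ∀ a b, D (a * b) = a • D b + b • D a) (x : R) (hx : x ∈ I ^ 2) :
    D x ∈ I • (⊤ : Submodule R M) := by
  rw [pow_two] at hx
  induction hx using Submodule.mul_induction_on' with
  | mem_mul_mem a ha b hb =>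
    rw [hmul]
    exact add_mem (Submodule.smul_mem_smul ha trivial) (Submodule.smul_mem_smul hb trivial)
  | add x _ y _ h1 h2 => rw [hadd]; exact add_mem h1 h2

lemma exists_tau [Module.Projective A (Ω[A⁄k])] (I : Ideal A) {N : Type*} [AddCommGroup N] [Module A N]
    (π : I →ₗ[A] N) (hπ : Function.Surjective π) (hπ0 : ∀ x, π x = 0 → (x : A) ∈ I ^ 2)
    (ρ : Ω[A⁄k] →ₗ[A] N) (hρ : ∀ x : I, ρ (KaehlerDifferential.D k A x) = π x) :
    ∃ (E2 : Ω[A⁄k] →ₗ[A] I) (τ : Ω[A⁄k] →ₗ[A] Ω[A⁄k]),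
      (∀ x : I, (E2 (KaehlerDifferential.D k A x) : A) - x ∈ I ^ 2) ∧
      (∀ ω, τ ω - KaehlerDifferential.D k A (E2 ω) ∈ I • (⊤ : Submodule A (Ω[A⁄k]))) := by
  obtain ⟨E2, hE2⟩ := Module.projective_lifting_property π ρ hπ
  let U : Submodule A (Ω[A⁄k]) := I • ⊤
  let t : Ω[A⁄k] →ₗ[A] Ω[A⁄k] ⧸ U :=
    { toFun := fun ω => U.mkQ (KaehlerDifferential.D k A (E2 ω))
      map_add' := fun x y => by simp
      map_smul' := fun a x => by
        rw [map_smul, Submodule.coe_smul, smul_eq_mul, Derivation.leibniz, RingHom.id_apply,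
          ← map_smul U.mkQ, ← sub_eq_zero, ← map_sub, add_sub_cancel_left, Submodule.mkQ_apply,
          Submodule.Quotient.mk_eq_zero]
        exact Submodule.smul_mem_smul (E2 x).2 trivial }
  obtain ⟨τ, hτ⟩ := Module.projective_lifting_property U.mkQ t U.mkQ_surjective
  refine ⟨E2, τ, fun x => ?_, fun ω => ?_⟩
  · have h1 : π (E2 (KaehlerDifferential.D k A x) - x) = 0 := by
      rw [map_sub, sub_eq_zero, ← hρ x, ← hE2]; rfl
    exact hπ0 _ h1
  · have h := LinearMap.congr_fun hτ ω
    exact (Submodule.Quotient.eq U).1 h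

lemma exists_E1 {R : Type*} [CommRing R] [Algebra k R] [Algebra A R] [IsScalarTower k A R]
    [Module.Projective A (Ω[A⁄k])] (s : A →+* R) (hs : ∀ c, s (algebraMap k A c) = algebraMap k R c)
    (J : Ideal R) (hJ : ∀ a, algebraMap A R a - s a ∈ J) :
    ∃ E1 : Ω[A⁄k] →ₗ[A] R, ∀ a, E1 (KaehlerDifferential.D k A a) - (algebraMap A R a - s a) ∈ J ^ 2 := by
  let q : R →ₗ[A] R ⧸ (J ^ 2) := (Ideal.Quotient.mkₐ A (J ^ 2)).toLinearMap
  have hq : ∀ r, q r = 0 ↔ r ∈ J ^ 2 := fun r => Ideal.Quotient.eq_zero_iff_mem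
  have hqk : ∀ (c : k) r, q (c • r) = c • q r := fun c r => rfl
  let f : A →ₗ[k] R ⧸ (J ^ 2) :=
    { toFun := fun a => q (algebraMap A R a - s a)
      map_add' := fun x y => by
        rw [← map_add]; congr 1; simp only [map_add]; ring
      map_smul' := fun c x => by
        rw [RingHom.id_apply, ← hqk]
        congr 1
        rw [Algebra.smul_def, map_mul, map_mul, hs, ← IsScalarTower.algebraMap_apply,
          Algebra.smul_def]
        ring }
  let δ : Derivation k A (R ⧸ (J ^ 2)) := Derivation.mk' f fun a b => by
    change q _ = a • q _ + b • q _
    rw [← map_smul, ← map_smul, ← map_add, ← sub_eq_zero, ← map_sub, hq]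
    have : algebraMap A R (a * b) - s (a * b) - (a • (algebraMap A R b - s b) + b • (algebraMap A R a - s a))
      = - ((algebraMap A R a - s a) * (algebraMap A R b - s b)) := by
      simp only [Algebra.smul_def, map_mul]; ring
    rw [this, neg_mem_iff, pow_two]
    exact Ideal.mul_mem_mul (hJ a) (hJ b)
  obtain ⟨E1, hE1⟩ := Module.projective_lifting_property q δ.liftKaehlerDifferential
    Ideal.Quotient.mk_surjective
  refine ⟨E1, fun a => ?_⟩
  rw [← hq, map_sub, sub_eq_zero, ← LinearMap.comp_apply, hE1]
  exact δ.liftKaehlerDifferential_comp_D a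

lemma exists_E {R : Type*} [CommRing R] [Algebra k R] [Algebra A R] [IsScalarTower k A R]
    [Module.Projective A (Ω[A⁄k])] (I : Ideal A) {N : Type*} [AddCommGroup N] [Module A N]
    (π : I →ₗ[A] N) (hπ : Function.Surjective π) (hπ0 : ∀ x, π x = 0 → (x : A) ∈ I ^ 2)
    (ρ : Ω[A⁄k] →ₗ[A] N) (hρ : ∀ x : I, ρ (KaehlerDifferential.D k A x) = π x)
    (s : A →+* R) (hs : ∀ c, s (algebraMap k A c) = algebraMap k R c) (hsI : ∀ x ∈ I, s x = 0)
    (J : Ideal R) (hJ : ∀ a, algebraMap A R a - s a ∈ J) :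
    ∃ (E : Ω[A⁄k] →ₗ[A] R) (θ : Ω[A⁄k] →ₗ[A] Ω[A⁄k]),
      (∀ a, E (KaehlerDifferential.D k A a) - (algebraMap A R a - s a) ∈ J ^ 2) ∧
      (∀ x ∈ I, E (KaehlerDifferential.D k A x) ∈ I.map (algebraMap A R)) ∧
      (∀ x ∈ I, θ (KaehlerDifferential.D k A x) ∈ I • (⊤ : Submodule A (Ω[A⁄k]))) ∧
      (∀ ω, ω - θ ω ∈ Submodule.span A (KaehlerDifferential.D k A '' I) ⊔
        I • (⊤ : Submodule A (Ω[A⁄k]))) := by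
  obtain ⟨E2, τ, h1, h2⟩ := exists_tau I π hπ hπ0 ρ hρ
  obtain ⟨E1, h3⟩ := exists_E1 s hs J hJ
  have hIJ : ∀ x ∈ I, algebraMap A R x ∈ J := fun x hx => by
    have := hJ x
    rwa [hsI x hx, sub_zero] at this
  have hIJ2 : ∀ x ∈ I ^ 2, algebraMap A R x ∈ J ^ 2 := fun x hx => by
    have h : I.map (algebraMap A R) ≤ J := Ideal.map_le_iff_le_comap.2 hIJ
    have := Ideal.pow_right_mono h 2
    rw [← Ideal.map_pow] at this
    exact this (Ideal.mem_map_of_mem _ hx)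
  have hJ2 : J ^ 2 ≤ J := Ideal.pow_le_self two_ne_zero
  have hE1J : ∀ ω, E1 ω ∈ J := by
    intro ω
    have : (⊤ : Submodule A (Ω[A⁄k])) ≤ (J.restrictScalars A).comap E1 := by
      rw [← KaehlerDifferential.span_range_derivation, Submodule.span_le]
      rintro _ ⟨a, rfl⟩
      have := add_mem (hJ2 (h3 a)) (hJ a)
      rw [sub_add_cancel] at this
      exact this
    exact this trivial
  let E2' : Ω[A⁄k] →ₗ[A] R := (Algebra.linearMap A R) ∘ₗ I.subtype ∘ₗ E2
  have hE2' : ∀ ω, E2' ω = algebraMap A R (E2 ω) := fun ω => rfl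
  have hcomp : Submodule.span A (KaehlerDifferential.D k A '' I) ⊔ I • (⊤ : Submodule A (Ω[A⁄k]))
      ≤ ((J ^ 2).restrictScalars A).comap (E1 - E2') := by
    refine sup_le ?_ ?_
    · rw [Submodule.span_le]
      rintro _ ⟨x, hx, rfl⟩
      have e1 := h3 x
      rw [hsI x hx, sub_zero] at e1
      have e2 := hIJ2 _ (h1 ⟨x, hx⟩)
      rw [map_sub] at e2
      have := sub_mem e1 e2
      rw [sub_sub_sub_cancel_right] at this
      exact this
    · rw [Submodule.smul_le]
      rintro x hx ω -
      rw [Submodule.mem_comap, map_smul, Algebra.smul_def, Submodule.restrictScalars_mem, pow_two]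
      refine Ideal.mul_mem_mul (hIJ x hx) ?_
      rw [LinearMap.sub_apply]
      exact sub_mem (hE1J ω) (hIJ _ (E2 ω).2)
  have hτ : ∀ ω, τ ω ∈ Submodule.span A (KaehlerDifferential.D k A '' I) ⊔
        I • (⊤ : Submodule A (Ω[A⁄k])) := fun ω => by
    rw [← sub_add_cancel (τ ω) (KaehlerDifferential.D k A (E2 ω)), add_comm]
    exact Submodule.add_mem_sup (Submodule.subset_span ⟨_, (E2 ω).2, rfl⟩) (h2 ω)
  have hθ : ∀ x ∈ I, (KaehlerDifferential.D k A x) - τ (KaehlerDifferential.D k A x) ∈ I • (⊤ : Submodule A (Ω[A⁄k])) := by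
    intro x hx
    have e1 := h2 (KaehlerDifferential.D k A x)
    have e2 := der_sq I (KaehlerDifferential.D k A) (map_add _) (Derivation.leibniz _) _ (h1 ⟨x, hx⟩)
    rw [map_sub] at e2
    have := add_mem e1 e2
    rw [← neg_mem_iff, neg_sub]
    convert this using 1
    abel
  refine ⟨E1 ∘ₗ (LinearMap.id - τ) + E2' ∘ₗ τ, LinearMap.id - τ, fun a => ?_, fun x hx => ?_,
    fun x hx => ?_, fun ω => ?_⟩
  · have e1 := h3 a
    have e2 : (E1 - E2') (τ (KaehlerDifferential.D k A a)) ∈ J ^ 2 := hcomp (hτ _)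
    have := sub_mem e1 e2
    convert this using 1
    simp only [LinearMap.add_apply, LinearMap.comp_apply, LinearMap.sub_apply, LinearMap.id_apply, map_sub]
    ring
  · have e1 : I • (⊤ : Submodule A (Ω[A⁄k])) ≤ ((I.map (algebraMap A R)).restrictScalars A).comap E1 := by
      rw [Submodule.smul_le]
      rintro x hx ω -
      rw [Submodule.mem_comap, map_smul, Algebra.smul_def, Submodule.restrictScalars_mem]
      exact Ideal.mul_mem_right _ _ (Ideal.mem_map_of_mem _ hx)
    exact add_mem (e1 (hθ x hx)) (Ideal.mem_map_of_mem _ (E2 _).2)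
  · exact hθ x hx
  · have := hτ ω
    rw [LinearMap.sub_apply, LinearMap.id_apply, sub_sub_cancel]
    exact this

end EPart

section DeltaPart
open TensorProduct
variable {k A R : Type*} [CommRing k] [CommRing A] [Algebra k A] [CommRing R] [Algebra A R]

lemma smul_top_tmul (I : Ideal A) {M : Type*} [AddCommGroup M] [Module A M] {m : M}
    (hm : m ∈ I • (⊤ : Submodule A M)) :
    (1 : R) ⊗ₜ[A] m ∈ I.map (algebraMap A R) • (⊤ : Submodule R (R ⊗[A] M)) := by
  induction hm using Submodule.smul_induction_on' with
  | smul x hx m _ =>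
    rw [← TensorProduct.smul_tmul, Algebra.smul_def, mul_one, ← mul_one (algebraMap A R x),
      ← smul_eq_mul, ← TensorProduct.smul_tmul']
    exact Submodule.smul_mem_smul (Ideal.mem_map_of_mem _ hx) trivial
  | add x _ y _ h1 h2 => rw [TensorProduct.tmul_add]; exact add_mem h1 h2

lemma der_sq' {M : Type*} [AddCommGroup M] [Module R M] (D : Derivation ℤ R M) (J : Ideal R) {x : R}
    (hx : x ∈ J ^ 2) : D x ∈ J • (⊤ : Submodule R M) :=
  der_sq J D (map_add _) (Derivation.leibniz _) x hx

theorem exists_KD [Module.Finite A (Ω[A⁄k])] [Module.Projective A (Ω[A⁄k])] [IsNoetherianRing R]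
    (I : Ideal A) (s : A →+* R) (hsI : ∀ x ∈ I, s x = 0)
    (J : Ideal R) (hJ : J = Ideal.span (Set.range fun a => algebraMap A R a - s a))
    (hJj : J ≤ Ideal.jacobson ⊥) (hunit : ∀ n : ℕ, IsUnit ((n + 1 : ℕ) : R))
    (D : Derivation ℤ R (R ⊗[A] Ω[A⁄k]))
    (hDA : ∀ a, D (algebraMap A R a) = 1 ⊗ₜ KaehlerDifferential.D k A a)
    (hDs : ∀ a, D (s a) = 0)
    (E : Ω[A⁄k] →ₗ[A] R) (θ : Ω[A⁄k] →ₗ[A] Ω[A⁄k])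
    (hE : ∀ a, E (KaehlerDifferential.D k A a) - (algebraMap A R a - s a) ∈ J ^ 2)
    (hEI : ∀ x ∈ I, E (KaehlerDifferential.D k A x) ∈ I.map (algebraMap A R))
    (hθI : ∀ x ∈ I, θ (KaehlerDifferential.D k A x) ∈ I • (⊤ : Submodule A (Ω[A⁄k])))
    (hθ : ∀ ω, ω - θ ω ∈ Submodule.span A (KaehlerDifferential.D k A '' I) ⊔
        I • (⊤ : Submodule A (Ω[A⁄k]))) (N0 : Submodule R (R ⊗[A] Ω[A⁄k]))
    (hN0 : N0 = Submodule.span R ((fun x => (1 : R) ⊗ₜ[A] KaehlerDifferential.D k A x) '' I) ⊔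
      I.map (algebraMap A R) • ⊤) :
    ∃ (δ : R ⊗[A] Ω[A⁄k] →ₗ[R] R) (D2 : Derivation ℤ R (R ⊗[A] Ω[A⁄k]))
      (h1 h2 : ℕ → ExteriorAlgebra R (R ⊗[A] Ω[A⁄k]) →+ ExteriorAlgebra R (R ⊗[A] Ω[A⁄k])),
      KD δ J ⊥ ⊥ D h1 ∧ KD δ J (I.map (algebraMap A R)) N0 D2 h2 := by
  let δ : R ⊗[A] Ω[A⁄k] →ₗ[R] R := E.liftBaseChange R
  have hδ : ∀ r ω, δ (r ⊗ₜ ω) = r • E ω := fun r ω => LinearMap.liftBaseChange_tmul _ _ _ _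
  have hδ1 : ∀ ω, δ (1 ⊗ₜ ω) = E ω := fun ω => by rw [hδ, one_smul]
  let θR : R ⊗[A] Ω[A⁄k] →ₗ[R] R ⊗[A] Ω[A⁄k] := θ.baseChange R
  have hθR : ∀ ω, θR (1 ⊗ₜ ω) = 1 ⊗ₜ θ ω := fun ω => LinearMap.baseChange_tmul _ _ _
  have hspan : (⊤ : Submodule R (R ⊗[A] Ω[A⁄k])) =
      Submodule.span R (Set.range fun a => (1 : R) ⊗ₜ[A] KaehlerDifferential.D k A a) := by
    have h1 := Submodule.baseChange_span (R := A) (A := R) (Set.range (KaehlerDifferential.D k A))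
    rw [KaehlerDifferential.span_range_derivation, Submodule.baseChange_top] at h1
    rw [h1]
    congr 1
    ext x
    simp
  have hind : ∀ W : Submodule R (R ⊗[A] Ω[A⁄k]), (∀ a, (1 : R) ⊗ₜ[A] KaehlerDifferential.D k A a ∈ W) →
      ∀ p, p ∈ W := by
    intro W hW p
    have : (⊤ : Submodule R (R ⊗[A] Ω[A⁄k])) ≤ W := by
      rw [hspan, Submodule.span_le]
      rintro _ ⟨a, rfl⟩
      exact hW a
    exact this trivial
  have hJa : ∀ a, algebraMap A R a - s a ∈ J := fun a => by
    rw [hJ]; exact Ideal.subset_span ⟨a, rfl⟩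
  have hJ2 : J ^ 2 ≤ J := Ideal.pow_le_self two_ne_zero
  have hδJ : ∀ p, δ p ∈ J := by
    refine hind (Submodule.comap δ J) fun a => ?_
    have := add_mem (hJ2 (hE a)) (hJa a)
    rw [sub_add_cancel] at this
    change δ _ ∈ J
    rwa [hδ1]
  have hrng : LinearMap.range δ = J := by
    refine le_antisymm (by rintro _ ⟨p, rfl⟩; exact hδJ p) ?_
    refine Submodule.le_of_le_smul_of_le_jacobson_bot (I := J) (IsNoetherian.noetherian J) hJj ?_
    conv_lhs => rw [hJ]
    refine Submodule.span_le.2 ?_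
    rintro _ ⟨a, rfl⟩
    have := Submodule.add_mem_sup (S := LinearMap.range δ) (T := J • J)
      ⟨(1 : R) ⊗ₜ[A] KaehlerDifferential.D k A a, rfl⟩
      (by rw [smul_eq_mul, ← pow_two]; exact neg_mem (hE a))
    rw [hδ1] at this
    convert this using 1
    simp
  have hDd : ∀ p, D (δ p) - p ∈ J • (⊤ : Submodule R (R ⊗[A] Ω[A⁄k])) := by
    let W : Submodule R (R ⊗[A] Ω[A⁄k]) :=
      { carrier := {p | D (δ p) - p ∈ J • (⊤ : Submodule R (R ⊗[A] Ω[A⁄k]))}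
        add_mem' := fun {x y} hx hy => by
          have hx' : D (δ x) - x ∈ J • (⊤ : Submodule R (R ⊗[A] Ω[A⁄k])) := hx
          have hy' : D (δ y) - y ∈ J • (⊤ : Submodule R (R ⊗[A] Ω[A⁄k])) := hy
          have := add_mem hx' hy'
          change D (δ (x + y)) - (x + y) ∈ J • (⊤ : Submodule R (R ⊗[A] Ω[A⁄k]))
          rw [map_add, map_add]
          convert this using 1
          abel
        zero_mem' := by simp
        smul_mem' := fun r x hx => by
          change D (δ x) - x ∈ J • (⊤ : Submodule R (R ⊗[A] Ω[A⁄k])) at hx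
          change D (δ (r • x)) - r • x ∈ J • (⊤ : Submodule R (R ⊗[A] Ω[A⁄k]))
          rw [map_smul, smul_eq_mul, Derivation.leibniz]
          have := add_mem (Submodule.smul_mem _ r hx)
            (Submodule.smul_mem_smul (hδJ x) (Submodule.mem_top (x := D r)))
          rw [smul_sub] at this
          convert this using 1
          abel }
    refine hind W fun a => ?_
    change D (δ (1 ⊗ₜ[A] (KaehlerDifferential.D k A) a)) - 1 ⊗ₜ[A] (KaehlerDifferential.D k A) a ∈
      J • (⊤ : Submodule R (R ⊗[A] Ω[A⁄k]))
    rw [hδ1]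
    have := der_sq' D J (hE a)
    rwa [map_sub, map_sub, hDs, sub_zero, hDA] at this
  have haJ : I.map (algebraMap A R) ≤ J := by
    rw [Ideal.map_le_iff_le_comap]
    intro x hx
    have := hJa x
    rwa [hsI x hx, sub_zero] at this
  have hθN : ∀ p, p - θR p ∈ N0 := by
    refine hind (N0.comap (LinearMap.id - θR)) fun a => ?_
    change _ - θR _ ∈ N0
    rw [hθR, LinearMap.id_apply, ← TensorProduct.tmul_sub]
    obtain ⟨u, hu, v, hv, huv⟩ := Submodule.mem_sup.1 (hθ (KaehlerDifferential.D k A a))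
    rw [← huv, TensorProduct.tmul_add, hN0]
    refine Submodule.add_mem_sup ?_ (smul_top_tmul I hv)
    have := Submodule.tmul_mem_baseChange_of_mem (A := R) 1 hu
    rw [Submodule.baseChange_span, Set.image_image] at this
    exact this
  have hDmem : ∀ x ∈ I, (1 : R) ⊗ₜ[A] KaehlerDifferential.D k A x ∈ N0 := fun x hx => by
    rw [hN0]
    exact Submodule.mem_sup_left (Submodule.subset_span ⟨x, hx, rfl⟩)
  choose h1 h1m h1l using fun n => exists_connection D n
  choose h2 h2m h2l using fun n => exists_connection (θR.compDer D) n
  refine ⟨δ, θR.compDer D, h1, h2, ?_, ?_⟩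
  · exact ⟨hrng, bot_le, fun a ha => by rw [Ideal.mem_bot.1 ha]; simp, fun p hp => by
      rw [(Submodule.mem_bot R).1 hp]; simp, fun p => Submodule.mem_sup_right (hDd p), h1m, h1l, hunit⟩
  · refine ⟨hrng, haJ, fun a ha => ?_, fun p hp => ?_, fun p => ?_, h2m, h2l, hunit⟩
    · change θR (D a) ∈ _
      induction ha using Submodule.span_induction with
      | mem x hx =>
        obtain ⟨x, hx, rfl⟩ := hx
        rw [hDA, hθR]
        exact smul_top_tmul I (hθI x hx)
      | zero => simp
      | add x y _ _ hx hy => rw [map_add, map_add]; exact add_mem hx hy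
      | smul r x hx ih =>
        rw [smul_eq_mul, Derivation.leibniz, map_add, map_smul, map_smul]
        exact add_mem (Submodule.smul_mem _ _ ih) (Submodule.smul_mem_smul hx trivial)
    · have : N0 ≤ Submodule.comap δ (I.map (algebraMap A R)) := by
        rw [hN0]
        refine sup_le (Submodule.span_le.2 ?_) ?_
        · rintro _ ⟨x, hx, rfl⟩
          change δ _ ∈ I.map (algebraMap A R)
          rw [hδ1]
          exact hEI x hx
        · rw [Submodule.smul_le]
          rintro x hx p -
          change δ _ ∈ I.map (algebraMap A R)
          rw [map_smul]
          exact Ideal.mul_mem_right _ _ hx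
      exact this hp
    · change θR (D (δ p)) - p ∈ _
      have e1 : θR (D (δ p) - p) ∈ J • (⊤ : Submodule R (R ⊗[A] Ω[A⁄k])) := by
        have := Submodule.mem_map_of_mem (f := θR) (hDd p)
        rw [Submodule.map_smul''] at this
        exact Submodule.smul_mono le_rfl le_top this
      have e2 := neg_mem (hθN p)
      rw [map_sub] at e1
      have := Submodule.add_mem_sup e2 e1
      convert this using 1
      abel

end DeltaPart

section IdPart
open ExteriorAlgebra
variable {R P B N : Type*} [CommRing R] [AddCommGroup P] [Module R P]
  [CommRing B] [AddCommGroup N] [Module B N]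

lemma exists_extMap (σ : R →+* B) (ρ : P →ₛₗ[σ] N) :
    ∃ Φ : ExteriorAlgebra R P →+* ExteriorAlgebra B N,
      (∀ r, Φ (algebraMap R _ r) = algebraMap B _ (σ r)) ∧ ∀ p, Φ (ι R p) = ι B (ρ p) := by
  let _ : Algebra R B := σ.toAlgebra
  let _ : Module R N := Module.compHom N σ
  have : IsScalarTower R B N := ⟨fun r b n => by
    rw [Algebra.smul_def, mul_smul]; rfl⟩
  let f : P →ₗ[R] ExteriorAlgebra B N :=
    { toFun := fun p => ι B (ρ p)
      map_add' := fun x y => by simp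
      map_smul' := fun r x => by
        rw [map_smulₛₗ, map_smul, RingHom.id_apply]
        exact algebraMap_smul B r _ }
  refine ⟨(ExteriorAlgebra.lift R ⟨f, fun p => ?_⟩ : ExteriorAlgebra R P →ₐ[R] ExteriorAlgebra B N), fun r => ?_, fun p => ?_⟩
  · exact ι_sq_zero _
  · change ExteriorAlgebra.lift R _ (algebraMap R _ r) = _
    rw [AlgHom.commutes]
    exact IsScalarTower.algebraMap_apply R B _ r
  · exact lift_ι_apply R f _ p

lemma exists_kappa [Module.Projective B N] (s : B →+* R) (U : Submodule R P) (f : N → P)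
    (hadd : ∀ x y, f (x + y) - (f x + f y) ∈ U) (hsmul : ∀ b x, f (b • x) - s b • f x ∈ U) :
    ∃ κ : N →ₛₗ[s] P, ∀ v, κ v - f v ∈ U := by
  let _ : Module B P := Module.compHom P s
  let _ : Module B (P ⧸ U) := Module.compHom (P ⧸ U) s
  let q : P →ₗ[B] P ⧸ U :=
    { toFun := U.mkQ
      map_add' := map_add _
      map_smul' := fun b x => map_smul U.mkQ (s b) x }
  let g : N →ₗ[B] P ⧸ U :=
    { toFun := fun v => U.mkQ (f v)
      map_add' := fun x y => by
        rw [← map_add]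
        exact (Submodule.Quotient.eq U).2 (hadd x y)
      map_smul' := fun b x => by
        refine Eq.trans ?_ (map_smul U.mkQ (s b) (f x))
        exact (Submodule.Quotient.eq U).2 (hsmul b x) }
  obtain ⟨κ, hκ⟩ := Module.projective_lifting_property q g U.mkQ_surjective
  refine ⟨{ toFun := κ, map_add' := map_add κ, map_smul' := fun b x => map_smul κ b x }, fun v => ?_⟩
  have := LinearMap.congr_fun hκ v
  exact (Submodule.Quotient.eq U).1 this

lemma alg_smul (r : R) (x : ExteriorAlgebra R P) : r • x = algebraMap R _ r * x := Algebra.smul_def r x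

section
variable (ε : R →+* B) (s : B →+* R) (hεs : ∀ b, ε (s b) = b)
  (ρ : P →ₛₗ[ε] N) (κ : N →ₛₗ[s] P) (𝔞 : Ideal R) (N0 : Submodule R P)
  (hκN : ∀ v, κ v ∈ N0) (hρκ : ∀ v, ρ (κ v) = v)
  (hκρ : ∀ p ∈ N0, κ (ρ p) - p ∈ 𝔞 • (⊤ : Submodule R P) ⊔ RingHom.ker ε • N0)
  (Φ : ExteriorAlgebra R P →+* ExteriorAlgebra B N)
  (hΦ : ∀ r, Φ (algebraMap R _ r) = algebraMap B _ (ε r)) (hΦι : ∀ p, Φ (ι R p) = ι B (ρ p))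
  (Ψ : ExteriorAlgebra B N →+* ExteriorAlgebra R P)
  (hΨ : ∀ r, Ψ (algebraMap B _ r) = algebraMap R _ (s r)) (hΨι : ∀ p, Ψ (ι B p) = ι R (κ p))

lemma Phi_mem (Φ : ExteriorAlgebra R P →+* ExteriorAlgebra B N)
    (hΦ : ∀ r, Φ (algebraMap R _ r) = algebraMap B _ (ε r)) (hΦι : ∀ p, Φ (ι R p) = ι B (ρ p)) (n : ℕ)
    {z : ExteriorAlgebra R P} (hz : z ∈ ⋀[R]^n P) : Φ z ∈ ⋀[B]^n N := by
  induction hz using Submodule.pow_induction_on_left' with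
  | algebraMap r => rw [hΦ]; exact Submodule.algebraMap_mem _
  | add x y i hx hy h1 h2 => rw [map_add]; exact add_mem h1 h2
  | mem_mul m hm i x hx ih =>
    obtain ⟨p, rfl⟩ := hm
    rw [map_mul, hΦι]
    change _ ∈ (LinearMap.range (ι B)) ^ (i + 1)
    rw [pow_succ']
    exact Submodule.mul_mem_mul ⟨_, rfl⟩ ih

lemma Phi_kills (Φ : ExteriorAlgebra R P →+* ExteriorAlgebra B N)
    (hΦ : ∀ r, Φ (algebraMap R _ r) = algebraMap B _ (ε r)) (S : Submodule R (ExteriorAlgebra R P))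
    {z : ExteriorAlgebra R P} (hz : z ∈ RingHom.ker ε • S) : Φ z = 0 := by
  induction hz using Submodule.smul_induction_on' with
  | smul r hr m _ =>
    rw [Algebra.smul_def, map_mul, hΦ, (RingHom.mem_ker).1 hr, map_zero, zero_mul]
  | add x _ y _ h1 h2 => rw [map_add, h1, h2, add_zero]

lemma Psi_mem (hεs : ∀ b, ε (s b) = b)
    (hκN : ∀ v, κ v ∈ N0) (hρκ : ∀ v, ρ (κ v) = v)
    (Φ : ExteriorAlgebra R P →+* ExteriorAlgebra B N)
    (hΦ : ∀ r, Φ (algebraMap R _ r) = algebraMap B _ (ε r)) (hΦι : ∀ p, Φ (ι R p) = ι B (ρ p))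
    (Ψ : ExteriorAlgebra B N →+* ExteriorAlgebra R P)
    (hΨ : ∀ r, Ψ (algebraMap B _ r) = algebraMap R _ (s r)) (hΨι : ∀ p, Ψ (ι B p) = ι R (κ p)) (n : ℕ)
    {t : ExteriorAlgebra B N} (ht : t ∈ ⋀[B]^n N) : Ψ t ∈ (N0.map (ι R)) ^ n ∧ Φ (Ψ t) = t := by
  induction ht using Submodule.pow_induction_on_left' with
  | algebraMap r =>
    rw [hΨ, hΦ, hεs]; exact ⟨Submodule.algebraMap_mem _, rfl⟩
  | add x y i hx hy h1 h2 => rw [map_add, map_add, h1.2, h2.2]; exact ⟨add_mem h1.1 h2.1, rfl⟩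
  | mem_mul m hm i x hx ih =>
    obtain ⟨p, rfl⟩ := hm
    rw [map_mul, map_mul, hΨι, hΦι, hρκ, ih.2, pow_succ']
    exact ⟨Submodule.mul_mem_mul ⟨_, hκN p, rfl⟩ ih.1, rfl⟩

lemma Psi_Phi (hεs : ∀ b, ε (s b) = b)
    (hκN : ∀ v, κ v ∈ N0)
    (hκρ : ∀ p ∈ N0, κ (ρ p) - p ∈ 𝔞 • (⊤ : Submodule R P) ⊔ RingHom.ker ε • N0)
    (Φ : ExteriorAlgebra R P →+* ExteriorAlgebra B N)
    (hΦ : ∀ r, Φ (algebraMap R _ r) = algebraMap B _ (ε r)) (hΦι : ∀ p, Φ (ι R p) = ι B (ρ p))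
    (Ψ : ExteriorAlgebra B N →+* ExteriorAlgebra R P)
    (hΨ : ∀ r, Ψ (algebraMap B _ r) = algebraMap R _ (s r)) (hΨι : ∀ p, Ψ (ι B p) = ι R (κ p)) (n : ℕ)
    {g : ExteriorAlgebra R P} (hg : g ∈ (N0.map (ι R)) ^ n) :
    Ψ (Φ g) ∈ (N0.map (ι R)) ^ n ∧
    Ψ (Φ g) - g ∈ 𝔞 • (⋀[R]^n P : Submodule R (ExteriorAlgebra R P)) ⊔ RingHom.ker ε • (N0.map (ι R)) ^ n := by
  induction hg using Submodule.pow_induction_on_left' with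
  | algebraMap r =>
    refine ⟨by rw [hΦ, hΨ]; exact Submodule.algebraMap_mem _, Submodule.mem_sup_right ?_⟩
    rw [hΦ, hΨ, ← map_sub, ← mul_one (algebraMap R _ _), ← Algebra.smul_def]
    refine Submodule.smul_mem_smul ?_ (Submodule.one_le.1 (by simp))
    rw [RingHom.mem_ker, map_sub, hεs, sub_self]
  | add x y i hx hy h1 h2 =>
    rw [map_add, map_add]
    refine ⟨add_mem h1.1 h2.1, ?_⟩
    have := add_mem h1.2 h2.2
    convert this using 1
    abel
  | mem_mul m hm i x hx ih =>
    obtain ⟨p, hp, rfl⟩ := hm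
    rw [map_mul, map_mul, hΦι, hΨι]
    refine ⟨by rw [pow_succ']; exact Submodule.mul_mem_mul ⟨_, hκN _, rfl⟩ ih.1, ?_⟩
    have e : ι R (κ (ρ p)) * Ψ (Φ x) - ι R p * x = ι R (κ (ρ p) - p) * Ψ (Φ x) + ι R p * (Ψ (Φ x) - x) := by
      rw [map_sub, sub_mul, mul_sub]; abel
    rw [e]
    refine add_mem ?_ ?_
    · obtain ⟨u, hu, v, hv, huv⟩ := Submodule.mem_sup.1 (hκρ p hp)
      rw [← huv, map_add, add_mul]
      refine Submodule.add_mem_sup ?_ ?_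
      · have := ι_smul_top_mul 𝔞 hu (pow_le_pow_left' (KD.N_le N0) _ ih.1)
        rw [← pow_succ'] at this
        exact this
      · clear huv
        induction hv using Submodule.smul_induction_on' with
        | smul r hr m hm =>
          rw [map_smul, smul_mul_assoc, pow_succ']
          exact Submodule.smul_mem_smul hr (Submodule.mul_mem_mul ⟨_, hm, rfl⟩ ih.1)
        | add x _ y _ h1 h2 => rw [map_add, add_mul]; exact add_mem h1 h2
    · obtain ⟨u, hu, v, hv, huv⟩ := Submodule.mem_sup.1 ih.2
      rw [← huv, mul_add]
      refine Submodule.add_mem_sup ?_ ?_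
      · have := mul_mem_mul_smul 𝔞 (S := LinearMap.range (ι R)) (x := ι R p) ⟨p, rfl⟩ hu
        change _ ∈ 𝔞 • (LinearMap.range (ι R)) ^ (i + 1)
        rw [pow_succ']
        exact this
      · have := mul_mem_mul_smul (RingHom.ker ε) (S := N0.map (ι R)) (x := ι R p) ⟨p, hp, rfl⟩ hv
        rw [pow_succ']
        exact this

end

/-- identification of the relative homology of the Koszul complex -/
theorem identify [IsNoetherianRing R] [Module.Finite R P]
    (ε : R →+* B) (s : B →+* R) (hεs : ∀ b, ε (s b) = b)
    (ρ : P →ₛₗ[ε] N) (κ : N →ₛₗ[s] P) (𝔞 : Ideal R) (N0 : Submodule R P)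
    (hκN : ∀ v, κ v ∈ N0) (hρκ : ∀ v, ρ (κ v) = v)
    (hκρ : ∀ p ∈ N0, κ (ρ p) - p ∈ 𝔞 • (⊤ : Submodule R P) ⊔ RingHom.ker ε • N0)
    {δ : P →ₗ[R] R} {D : Derivation ℤ R P} {h : ℕ → ExteriorAlgebra R P →+ ExteriorAlgebra R P}
    (H : KD δ (RingHom.ker ε) 𝔞 N0 D h) :
    ∃ Φ : ExteriorAlgebra R P →+* ExteriorAlgebra B N,
      (∀ r, Φ (algebraMap R _ r) = algebraMap B _ (ε r)) ∧
      (∀ n, ∀ z ∈ ⋀[R]^n P, Φ z ∈ ⋀[B]^n N) ∧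
      ∀ m, (∀ t ∈ ⋀[B]^(m+1) N, ∃ z ∈ KD.ZZ δ 𝔞 m, Φ z = t) ∧
        (∀ z ∈ KD.ZZ δ 𝔞 m, Φ z = 0 ↔ z ∈ KD.BB δ 𝔞 m) := by
  obtain ⟨Φ, hΦ, hΦι⟩ := exists_extMap ε ρ
  obtain ⟨Ψ, hΨ, hΨι⟩ := exists_extMap s κ
  refine ⟨Φ, hΦ, fun n z hz => Phi_mem ε ρ Φ hΦ hΦι n hz, fun m => ⟨fun t ht => ?_, fun z hz => ?_⟩⟩
  · have := Psi_mem ε s ρ κ N0 hεs hκN hρκ Φ hΦ hΦι Ψ hΨ hΨι _ ht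
    exact ⟨Ψ t, H.G_le_ZZ m this.1, this.2⟩
  · have hB : ∀ z ∈ KD.BB δ 𝔞 m, Φ z = 0 := by
      intro z hz
      have : KD.BB δ 𝔞 m ≤ RingHom.ker ε • (⋀[R]^(m+1) P : Submodule R (ExteriorAlgebra R P)) := by
        refine sup_le ?_ (Submodule.smul_mono H.aJ le_rfl)
        rintro _ ⟨w, hw, rfl⟩
        exact kd_mem δ H.memJ _ hw
      exact Phi_kills ε Φ hΦ _ (this hz)
    refine ⟨fun h0 => ?_, hB z⟩
    obtain ⟨g, hg, b, hb, rfl⟩ := Submodule.mem_sup.1 (H.main m hz)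
    rw [map_add, hB b hb, add_zero] at h0
    refine add_mem ?_ hb
    have := (Psi_Phi ε s ρ κ 𝔞 N0 hεs hκN hκρ Φ hΦ hΦι Ψ hΨ hΨι _ hg).2
    rw [h0, map_zero, zero_sub, neg_mem_iff] at this
    refine (sup_le ?_ ?_ : _ ≤ KD.BB δ 𝔞 m) this
    · exact le_sup_right
    · exact (Submodule.smul_mono le_rfl (H.G_le_ZZ m)).trans (H.J_ZZ m)

end IdPart

section KosPart
open ExteriorAlgebra

lemma mem_smul_top_iff {A R M : Type*} [CommRing A] [CommRing R] [Algebra A R] [AddCommGroup M]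
    [Module R M] [Module A M] [IsScalarTower A R M] (I : Ideal A) (S : Submodule R M) (x : S) :
    x ∈ I • (⊤ : Submodule A S) ↔ (x : M) ∈ I.map (algebraMap A R) • S := by
  have h1 : I • (⊤ : Submodule A S) = (I.map (algebraMap A R) • (⊤ : Submodule R S)).restrictScalars A := by
    rw [Ideal.smul_restrictScalars, Submodule.restrictScalars_top]
  rw [h1, Submodule.restrictScalars_mem]
  have h2 : (I.map (algebraMap A R) • (⊤ : Submodule R S)).map S.subtype = I.map (algebraMap A R) • S := by
    rw [Submodule.map_smul'', Submodule.map_subtype_top]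
  rw [← h2]
  constructor
  · intro h; exact ⟨x, h, rfl⟩
  · rintro ⟨y, hy, hyx⟩
    rwa [Subtype.ext hyx] at hy

theorem tor_of_koszul {A R P N : Type u} [CommRing A] [CommRing R] [Algebra A R] [AddCommGroup P]
    [Module R P] [Module A P] [IsScalarTower A R P] [Module.Flat A R] [Module.Projective R P]
    [IsNoetherianRing R] [Module.Finite R P] (I : Ideal A) [AddCommGroup N] [Module (A ⧸ I) N]
    (ε : R →+* A ⧸ I) (hε : ∀ a, ε (algebraMap A R a) = Ideal.Quotient.mk I a)
    {δ : P →ₗ[R] R} {D : Derivation ℤ R P} {h : ℕ → ExteriorAlgebra R P →+ ExteriorAlgebra R P}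
    (H : KD δ (RingHom.ker ε) ⊥ ⊥ D h)
    (Φ : ExteriorAlgebra R P →+* ExteriorAlgebra (A ⧸ I) N)
    (hΦ : ∀ r, Φ (algebraMap R _ r) = algebraMap (A ⧸ I) _ (ε r))
    (hΦm : ∀ n, ∀ z ∈ ⋀[R]^n P, Φ z ∈ ⋀[A ⧸ I]^n N) (n : ℕ)
    (h1 : ∀ t ∈ ⋀[A ⧸ I]^(n+1) N, ∃ z ∈ KD.ZZ δ (I.map (algebraMap A R)) n, Φ z = t)
    (h2 : ∀ z ∈ KD.ZZ δ (I.map (algebraMap A R)) n, Φ z = 0 ↔ z ∈ KD.BB δ (I.map (algebraMap A R)) n) :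
    Nonempty (
      (((Tor (ModuleCat.{u} A) (n+1)).obj (ModuleCat.of A (A ⧸ I))).obj
          (ModuleCat.of A (A ⧸ I)))
        ≃ₗ[A]
      (RestrictScalars A (A ⧸ I) (⋀[A ⧸ I]^(n+1) N))) := by
  let d : ∀ i, (⋀[R]^(i+1) P) →ₗ[A] (⋀[R]^i P) := fun i =>
    ((kd δ).restrict (p := ⋀[R]^(i+1) P) (q := ⋀[R]^i P) (fun x hx => kd_mem' δ i hx)).restrictScalars A
  have hd : ∀ i z, (d i z : ExteriorAlgebra R P) = kd δ z := fun i z => rfl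
  have hflat : ∀ i, Module.Flat A (⋀[R]^i P) := fun i => by
    have := extPow_projective (R := R) (P := P) i
    exact Module.Flat.trans A R _
  have hsmul : ∀ (a : A) (z : ExteriorAlgebra R P), a • z = algebraMap A R a • z := fun a z =>
    (algebraMap_smul R a z).symm
  let e : (⋀[R]^0 P) →ₗ[A] A ⧸ I :=
    { toFun := fun z => ε (algebraMapInv (z : ExteriorAlgebra R P))
      map_add' := fun x y => by simp
      map_smul' := fun a x => by
        change ε (algebraMapInv (a • (x : ExteriorAlgebra R P))) = _
        rw [hsmul, map_smul, smul_eq_mul, map_mul, hε, RingHom.id_apply, Algebra.smul_def]; rfl }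
  have he0 : ∀ z, e z = ε (algebraMapInv (z : ExteriorAlgebra R P)) := fun z => rfl
  have hm0 : ∀ r, algebraMap R (ExteriorAlgebra R P) r ∈ ⋀[R]^0 P := fun r => by
    change _ ∈ (LinearMap.range (ι R)) ^ 0
    rw [pow_zero]; exact Submodule.algebraMap_mem _
  have hinv : ∀ r, algebraMapInv (algebraMap R (ExteriorAlgebra R P) r) = r :=
    algebraMap_leftInverse P
  let f : (⋀[R]^(n+1) P) →ₗ[A] RestrictScalars A (A ⧸ I) (⋀[A ⧸ I]^(n+1) N) :=
    { toFun := fun z => (RestrictScalars.addEquiv A (A ⧸ I) (⋀[A ⧸ I]^(n+1) N)).symm ⟨Φ z, hΦm _ _ z.2⟩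
      map_add' := fun x y => by
        rw [← map_add]
        congr 1
        exact Subtype.ext (map_add Φ _ _)
      map_smul' := fun a x => by
        rw [RingHom.id_apply, ← RestrictScalars.addEquiv_symm_map_algebraMap_smul]
        congr 1
        apply Subtype.ext
        change Φ (a • (x : ExteriorAlgebra R P)) = (algebraMap A (A ⧸ I) a) • Φ x
        rw [hsmul, Algebra.smul_def, map_mul, hΦ, hε, Algebra.smul_def]
        rfl }
  have hf : ∀ z, f z = 0 ↔ Φ z = 0 := fun z => by
    change (RestrictScalars.addEquiv A (A ⧸ I) (⋀[A ⧸ I]^(n+1) N)).symm ⟨Φ z, hΦm _ _ z.2⟩ = 0 ↔ _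
    rw [EmbeddingLike.map_eq_zero_iff, Subtype.ext_iff]
    rfl
  have hZ : ∀ z : ⋀[R]^(n+1) P, d n z ∈ I • (⊤ : Submodule A (⋀[R]^n P)) ↔
      (z : ExteriorAlgebra R P) ∈ KD.ZZ δ (I.map (algebraMap A R)) n := fun z => by
    rw [mem_smul_top_iff, hd]
    exact ⟨fun h => ⟨z.2, h⟩, fun h => h.2⟩
  refine tor_of_flat_res I n (fun i => ⋀[R]^i P) hflat d (A ⧸ I) e ?_ ?_ ?_ f ?_ ?_
  · intro b
    obtain ⟨a, rfl⟩ := Ideal.Quotient.mk_surjective b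
    exact ⟨⟨_, hm0 (algebraMap A R a)⟩, by rw [he0]; simp only; rw [hinv, hε]⟩
  · intro z
    have hz := z.2
    obtain ⟨r, hr⟩ : ∃ r, (z : ExteriorAlgebra R P) = algebraMap R _ r := by
      have h3 : (z : ExteriorAlgebra R P) ∈ (LinearMap.range (ι R)) ^ 0 := z.2
      rw [pow_zero, Submodule.mem_one] at h3
      obtain ⟨r, hr⟩ := h3
      exact ⟨r, hr.symm⟩
    have key : ∀ p, kd δ (ι R p) = algebraMap R _ (δ p) := fun p => by
      have := kd_ι_mul δ p 1
      have h10 : kd δ (1 : ExteriorAlgebra R P) = 0 := kd_zero δ (by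
        rw [pow_zero]; exact Submodule.one_le.1 le_rfl)
      rw [h10, mul_one, mul_zero, sub_zero] at this
      rw [this, Algebra.smul_def, mul_one]
    rw [he0, hr, hinv, ← RingHom.mem_ker, ← H.rng]
    constructor
    · rintro ⟨p, hp⟩
      refine ⟨⟨ι R p, ?_⟩, Subtype.ext ?_⟩
      · change _ ∈ (LinearMap.range (ι R)) ^ 1
        rw [pow_one]; exact ⟨p, rfl⟩
      · rw [hd, key, hr, hp]
    · rintro ⟨y, hy⟩
      have hy2 : (y : ExteriorAlgebra R P) ∈ (LinearMap.range (ι R)) ^ 1 := y.2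
      rw [pow_one] at hy2
      obtain ⟨p, hp⟩ := hy2
      refine ⟨p, ?_⟩
      have := congrArg Subtype.val hy
      rw [hd, ← hp, key, hr] at this
      rw [← hinv (δ p), this, hinv]
  · intro i z
    constructor
    · intro hz
      have hz' : kd δ (z : ExteriorAlgebra R P) = 0 := by rw [← hd, hz]; rfl
      have h3 : (z : ExteriorAlgebra R P) ∈ KD.ZZ δ ⊥ i := ⟨z.2, by
        refine Submodule.mem_comap.2 ?_
        rw [hz']; exact zero_mem _⟩
      have h4 := H.main i h3
      rw [Submodule.map_bot, pow_succ', Submodule.bot_mul, bot_sup_eq, KD.BB, Submodule.bot_smul,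
        sup_bot_eq] at h4
      obtain ⟨w, hw, hwz⟩ := h4
      exact ⟨⟨w, hw⟩, Subtype.ext hwz⟩
    · rintro ⟨w, rfl⟩
      exact Subtype.ext (kd_kd δ _)
  · intro t
    let t' := RestrictScalars.addEquiv A (A ⧸ I) (⋀[A ⧸ I]^(n+1) N) t
    obtain ⟨z, hz, hzt⟩ := h1 t'.1 t'.2
    refine ⟨⟨z, hz.1⟩, (hZ _).2 hz, ?_⟩
    change (RestrictScalars.addEquiv A (A ⧸ I) (⋀[A ⧸ I]^(n+1) N)).symm ⟨Φ z, _⟩ = t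
    rw [AddEquiv.symm_apply_eq]
    exact Subtype.ext hzt
  · intro z hz
    rw [hf, h2 _ ((hZ _).1 hz), KD.BB, Submodule.mem_sup, Submodule.mem_sup]
    constructor
    · rintro ⟨_, ⟨w, hw, rfl⟩, y, hy, hwy⟩
      exact ⟨d (n+1) ⟨w, hw⟩, ⟨_, rfl⟩, ⟨y, Submodule.smul_le_right hy⟩, (mem_smul_top_iff _ _ _).2 hy,
        Subtype.ext hwy⟩
    · rintro ⟨_, ⟨w, rfl⟩, y, hy, hwy⟩
      exact ⟨_, ⟨w, w.2, rfl⟩, y, (mem_smul_top_iff _ _ _).1 hy, congrArg Subtype.val hwy⟩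

end KosPart

section DataPart
open TensorProduct

lemma exists_rho {A R B Ω N : Type*} [CommRing A] [CommRing R] [CommRing B] [Algebra A R] [Algebra A B]
    [AddCommGroup Ω] [Module A Ω] [AddCommGroup N] [Module A N] [Module B N] [IsScalarTower A B N]
    (ε : R →+* B) (hε : ∀ a, ε (algebraMap A R a) = algebraMap A B a) (ρ : Ω →ₗ[A] N) :
    ∃ ρ' : (R ⊗[A] Ω) →ₛₗ[ε] N, ∀ r ω, ρ' (r ⊗ₜ ω) = ε r • ρ ω := by
  let _ : Module R N := Module.compHom N ε
  have : IsScalarTower A R N := ⟨fun a r n => by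
    change ε (a • r) • n = a • (ε r • n)
    rw [Algebra.smul_def, map_mul, hε, mul_smul, algebraMap_smul]⟩
  let g := ρ.liftBaseChange R
  have hg : ∀ r ω, g (r ⊗ₜ ω) = ε r • ρ ω := fun r ω => LinearMap.liftBaseChange_tmul _ _ _ _
  exact ⟨{ toFun := g, map_add' := map_add g, map_smul' := fun r x => map_smul g r x }, hg⟩

lemma cotangent_projective {k A : Type*} [CommRing k] [CommRing A] [Algebra k A]
    [Module.Projective A (Ω[A⁄k])] (I : Ideal A)
    (ρ : Ω[A⁄k] →ₗ[A] I.Cotangent) (hρ : ∀ x : I, ρ (KaehlerDifferential.D k A x) = I.toCotangent x) :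
    Module.Projective (A ⧸ I) I.Cotangent := by
  let f : I →ₗ[A] (A ⧸ I) ⊗[A] Ω[A⁄k] :=
    { toFun := fun x => 1 ⊗ₜ KaehlerDifferential.D k A (x : A)
      map_add' := fun x y => by simp [TensorProduct.tmul_add]
      map_smul' := fun a x => by
        have h0 : (Ideal.Quotient.mk I (x : A)) = 0 := Ideal.Quotient.eq_zero_iff_mem.2 x.2
        have : (1 : A ⧸ I) ⊗ₜ[A] ((x : A) • KaehlerDifferential.D k A a) = 0 := by
          rw [← TensorProduct.smul_tmul, Algebra.smul_def, mul_one]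
          change (Ideal.Quotient.mk I (x : A)) ⊗ₜ[A] _ = 0
          rw [h0, TensorProduct.zero_tmul]
        simp [TensorProduct.tmul_add, this] }
  let i0 : I.Cotangent →ₗ[A] (A ⧸ I) ⊗[A] Ω[A⁄k] := Ideal.Cotangent.lift f fun x y => by
    change 1 ⊗ₜ KaehlerDifferential.D k A ((x * y : A)) = 0
    have h0 : ∀ (x : I) (w : Ω[A⁄k]), (1 : A ⧸ I) ⊗ₜ[A] ((x : A) • w) = 0 := by
      intro x w
      have h0 : (Ideal.Quotient.mk I (x : A)) = 0 := Ideal.Quotient.eq_zero_iff_mem.2 x.2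
      rw [← TensorProduct.smul_tmul, Algebra.smul_def, mul_one]
      change (Ideal.Quotient.mk I (x : A)) ⊗ₜ[A] _ = 0
      rw [h0, TensorProduct.zero_tmul]
    rw [Derivation.leibniz, TensorProduct.tmul_add, h0, h0, add_zero]
  have hi0 : ∀ x : I, i0 (I.toCotangent x) = 1 ⊗ₜ KaehlerDifferential.D k A (x : A) := fun x => rfl
  let i : I.Cotangent →ₗ[A ⧸ I] (A ⧸ I) ⊗[A] Ω[A⁄k] :=
    LinearMap.extendScalarsOfSurjective Ideal.Quotient.mk_surjective i0
  let r : (A ⧸ I) ⊗[A] Ω[A⁄k] →ₗ[A ⧸ I] I.Cotangent := ρ.liftBaseChange (A ⧸ I)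
  refine Module.Projective.of_split i r ?_
  ext v
  obtain ⟨x, rfl⟩ := I.toCotangent_surjective v
  change r (i0 (I.toCotangent x)) = _
  rw [hi0]
  change ρ.liftBaseChange (A ⧸ I) _ = _
  rw [LinearMap.liftBaseChange_tmul, one_smul, hρ]
  rfl

lemma exists_kappa' {k A R : Type*} [CommRing k] [CommRing A] [CommRing R] [Algebra k A] [Algebra A R]
    [Module.Projective A (Ω[A⁄k])] (I : Ideal A)
    (s : A ⧸ I →+* R) (ε : R →+* A ⧸ I) (hεs : ∀ b, ε (s b) = b)
    (hεA : ∀ a, ε (algebraMap A R a) = Ideal.Quotient.mk I a)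
    (ρ : Ω[A⁄k] →ₗ[A] I.Cotangent) (hρ : ∀ x : I, ρ (KaehlerDifferential.D k A x) = I.toCotangent x)
    (ρ' : (R ⊗[A] Ω[A⁄k]) →ₛₗ[ε] I.Cotangent) (hρ' : ∀ r ω, ρ' (r ⊗ₜ ω) = ε r • ρ ω)
    (N0 : Submodule R (R ⊗[A] Ω[A⁄k]))
    (hN0 : N0 = Submodule.span R ((fun x => (1 : R) ⊗ₜ[A] KaehlerDifferential.D k A x) '' I) ⊔
      I.map (algebraMap A R) • ⊤) :
    ∃ κ : I.Cotangent →ₛₗ[s] (R ⊗[A] Ω[A⁄k]), (∀ v, κ v ∈ N0) ∧ (∀ v, ρ' (κ v) = v) ∧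
      (∀ p ∈ N0, κ (ρ' p) - p ∈ I.map (algebraMap A R) • (⊤ : Submodule R (R ⊗[A] Ω[A⁄k])) ⊔
        RingHom.ker ε • N0) := by
  have hproj := cotangent_projective I ρ hρ
  obtain ⟨σ, hσ⟩ := I.toCotangent_surjective.hasRightInverse
  obtain ⟨U, hU⟩ : ∃ U : Submodule R (R ⊗[A] Ω[A⁄k]),
    U = I.map (algebraMap A R) • (⊤ : Submodule R (R ⊗[A] Ω[A⁄k])) ⊔ RingHom.ker ε • N0 := ⟨_, rfl⟩
  have hIt : ∀ x ∈ I, ∀ ω, (1 : R) ⊗ₜ[A] ((x : A) • ω) ∈ I.map (algebraMap A R) • (⊤ : Submodule R (R ⊗[A] Ω[A⁄k])) := by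
    intro x hx ω
    rw [TensorProduct.tmul_smul, ← algebraMap_smul R x]
    exact Submodule.smul_mem_smul (Ideal.mem_map_of_mem _ hx) trivial
  have hUt : I.map (algebraMap A R) • (⊤ : Submodule R (R ⊗[A] Ω[A⁄k])) ≤ U := hU ▸ le_sup_left
  have hUk : RingHom.ker ε • N0 ≤ U := hU ▸ le_sup_right
  have hN0t : I.map (algebraMap A R) • (⊤ : Submodule R (R ⊗[A] Ω[A⁄k])) ≤ N0 := hN0 ▸ le_sup_right
  have hN0d : ∀ x ∈ I, (1 : R) ⊗ₜ[A] KaehlerDifferential.D k A x ∈ N0 := fun x hx => by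
    rw [hN0]
    exact Submodule.mem_sup_left (Submodule.subset_span ⟨x, hx, rfl⟩)
  have hUN : U ≤ N0 := by
    rw [hU]; exact sup_le hN0t Submodule.smul_le_right
  have hsq : ∀ x ∈ I ^ 2, (1 : R) ⊗ₜ[A] KaehlerDifferential.D k A x ∈ U := by
    intro x hx
    apply hUt
    rw [pow_two] at hx
    refine Submodule.mul_induction_on hx (fun a ha b hb => ?_) (fun a b ha hb => ?_)
    · rw [Derivation.leibniz, TensorProduct.tmul_add]
      exact add_mem (hIt _ ha _) (hIt _ hb _)
    · rw [map_add, TensorProduct.tmul_add]; exact add_mem ha hb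
  have hρU : ∀ p ∈ U, ρ' p = 0 := by
    rw [hU]
    intro p hp
    have hle : I.map (algebraMap A R) • (⊤ : Submodule R (R ⊗[A] Ω[A⁄k])) ⊔ RingHom.ker ε • N0
        ≤ LinearMap.ker ρ' := by
      refine sup_le (Submodule.smul_le.2 fun r hr n _ => ?_) (Submodule.smul_le.2 fun r hr n _ => ?_)
      · have : r ∈ RingHom.ker ε := by
          have h3 : I.map (algebraMap A R) ≤ RingHom.ker ε := by
            rw [Ideal.map_le_iff_le_comap]
            intro a ha
            rw [Ideal.mem_comap, RingHom.mem_ker, hεA, Ideal.Quotient.eq_zero_iff_mem]; exact ha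
          exact h3 hr
        rw [LinearMap.mem_ker, LinearMap.map_smulₛₗ, (RingHom.mem_ker).1 this, zero_smul]
      · rw [LinearMap.mem_ker, LinearMap.map_smulₛₗ, (RingHom.mem_ker).1 hr, zero_smul]
    exact hle hp
  let f : I.Cotangent → R ⊗[A] Ω[A⁄k] := fun v => 1 ⊗ₜ KaehlerDifferential.D k A (σ v : A)
  have hf : ∀ v, f v = 1 ⊗ₜ KaehlerDifferential.D k A (σ v : A) := fun v => rfl
  have hcong : ∀ x y : I, I.toCotangent x = I.toCotangent y →
      (1 : R) ⊗ₜ[A] KaehlerDifferential.D k A (x : A) - 1 ⊗ₜ KaehlerDifferential.D k A (y : A) ∈ U := by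
    intro x y hxy
    rw [← TensorProduct.tmul_sub, ← map_sub]
    exact hsq _ ((Ideal.toCotangent_eq I).1 hxy)
  obtain ⟨κ, hκ⟩ := exists_kappa s U f
    (fun x y => by
      rw [hf, hf, hf, ← TensorProduct.tmul_add, ← map_add]
      exact hcong (σ (x + y)) (σ x + σ y) (by rw [map_add, hσ, hσ, hσ]))
    (fun b x => by
      obtain ⟨a, rfl⟩ := Ideal.Quotient.mk_surjective b
      have h1 := hcong (σ (Ideal.Quotient.mk I a • x)) (a • σ x) (by
        rw [map_smul, hσ, hσ]; rfl)
      have h2 : (1 : R) ⊗ₜ[A] KaehlerDifferential.D k A ((a • σ x : I) : A) =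
          algebraMap A R a • f x + 1 ⊗ₜ ((σ x : A) • KaehlerDifferential.D k A a) := by
        change 1 ⊗ₜ KaehlerDifferential.D k A (a * (σ x : A)) = _
        rw [Derivation.leibniz, TensorProduct.tmul_add, TensorProduct.tmul_smul, algebraMap_smul, hf]
      have h3 : (algebraMap A R a - s (Ideal.Quotient.mk I a)) • f x ∈ U :=
        hUk (Submodule.smul_mem_smul (by rw [RingHom.mem_ker, map_sub, hεs, hεA, sub_self])
          (hN0d _ (σ x).2))
      have h4 := hUt (hIt _ (σ x).2 (KaehlerDifferential.D k A a))
      have := add_mem (add_mem h1 h4) h3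
      rw [h2] at this
      convert this using 1
      rw [hf (Ideal.Quotient.mk I a • x)]
      module)
  have hκN : ∀ v, κ v ∈ N0 := fun v => by
    have := add_mem (hUN (hκ v)) (hN0d _ (σ v).2)
    rwa [hf, sub_add_cancel] at this
  refine ⟨κ, hκN, fun v => ?_, ?_⟩
  · have := hρU _ (hκ v)
    rw [map_sub, sub_eq_zero] at this
    rw [this, hf, hρ', map_one, one_smul, hρ, hσ]
  · rw [← hU]
    intro p hp
    have hp' := hp
    rw [hN0] at hp'
    obtain ⟨q, hq, t, ht, rfl⟩ := Submodule.mem_sup.1 hp'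
    have h5 : κ (ρ' q) - q ∈ U := by
      refine Submodule.span_induction (p := fun q _ => κ (ρ' q) - q ∈ U) ?_ ?_ ?_ ?_ hq
      · rintro _ ⟨x, hx, rfl⟩
        simp only
        rw [hρ', map_one, one_smul, hρ ⟨x, hx⟩]
        have := add_mem (hκ (I.toCotangent ⟨x, hx⟩)) (hcong (σ (I.toCotangent ⟨x, hx⟩)) ⟨x, hx⟩ (hσ _))
        rwa [hf, sub_add_sub_cancel] at this
      · simp
      · intro x y _ _ hx hy
        have := add_mem hx hy
        convert this using 1
        rw [map_add, map_add]; abel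
      · intro r x _ hx
        have h6 : (s (ε r) - r) • κ (ρ' x) ∈ U :=
          hUk (Submodule.smul_mem_smul (by rw [RingHom.mem_ker, map_sub, hεs, sub_self]) (hκN _))
        have := add_mem h6 (U.smul_mem r hx)
        convert this using 1
        rw [LinearMap.map_smulₛₗ, LinearMap.map_smulₛₗ]; module
    have h7 : ρ' t = 0 := hρU _ (hUt ht)
    rw [map_add, h7, add_zero, ← sub_sub]
    exact sub_mem h5 (hUt ht)

theorem tor_of_data {k A R : Type u} [CommRing k] [CommRing A] [CommRing R] [Algebra k A] [Algebra A R]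
    [Algebra k R] [IsScalarTower k A R] [Module.Flat A R] [IsNoetherianRing R]
    [Module.Projective A (Ω[A⁄k])] [Module.Finite A (Ω[A⁄k])] (I : Ideal A)
    (s : A ⧸ I →+* R) (ε : R →+* A ⧸ I) (hεs : ∀ b, ε (s b) = b)
    (hεA : ∀ a, ε (algebraMap A R a) = Ideal.Quotient.mk I a)
    (hsk : ∀ c, s (Ideal.Quotient.mk I (algebraMap k A c)) = algebraMap k R c)
    (hJ : RingHom.ker ε = Ideal.span (Set.range fun a => algebraMap A R a - s (Ideal.Quotient.mk I a)))
    (hJj : RingHom.ker ε ≤ Ideal.jacobson ⊥) (hunit : ∀ n : ℕ, IsUnit ((n + 1 : ℕ) : R))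
    (D : Derivation ℤ R (R ⊗[A] Ω[A⁄k]))
    (hDA : ∀ a, D (algebraMap A R a) = 1 ⊗ₜ KaehlerDifferential.D k A a)
    (hDs : ∀ b, D (s b) = 0)
    (ρ : Ω[A⁄k] →ₗ[A] I.Cotangent) (hρ : ∀ x : I, ρ (KaehlerDifferential.D k A x) = I.toCotangent x)
    (n : ℕ) :
    Nonempty (
      (((Tor (ModuleCat.{u} A) (n+1)).obj (ModuleCat.of A (A ⧸ I))).obj
          (ModuleCat.of A (A ⧸ I)))
        ≃ₗ[A]
      (RestrictScalars A (A ⧸ I) (⋀[A ⧸ I]^(n+1) I.Cotangent))) := by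
  obtain ⟨s', hs'⟩ : ∃ s' : A →+* R, ∀ a, s' a = s (Ideal.Quotient.mk I a) :=
    ⟨s.comp (Ideal.Quotient.mk I), fun a => rfl⟩
  have hs'I : ∀ x ∈ I, s' x = 0 := fun x hx => by
    rw [hs', Ideal.Quotient.eq_zero_iff_mem.2 hx, map_zero]
  have hJ' : RingHom.ker ε = Ideal.span (Set.range fun a => algebraMap A R a - s' a) := by
    simp only [hs']; exact hJ
  obtain ⟨E, θ, hE, hEI, hθI, hθ⟩ := exists_E (k := k) I I.toCotangent I.toCotangent_surjective
    (fun x hx => (Ideal.toCotangent_eq_zero _ _).1 hx) ρ hρ s' (fun c => by rw [hs', hsk]) hs'I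
    (RingHom.ker ε) (fun a => by rw [hJ']; exact Ideal.subset_span ⟨a, rfl⟩)
  obtain ⟨N0, hN0⟩ : ∃ N0 : Submodule R (R ⊗[A] Ω[A⁄k]),
    N0 = Submodule.span R ((fun x => (1 : R) ⊗ₜ[A] KaehlerDifferential.D k A x) '' I) ⊔
      I.map (algebraMap A R) • ⊤ := ⟨_, rfl⟩
  obtain ⟨δ, D2, h1, h2, H1, H2⟩ := exists_KD I s' hs'I (RingHom.ker ε) hJ' hJj hunit D hDA
    (fun a => by rw [hs', hDs]) E θ hE hEI hθI hθ N0 hN0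
  obtain ⟨ρ', hρ'⟩ := exists_rho ε hεA ρ
  obtain ⟨κ, hκ1, hκ2, hκ3⟩ := exists_kappa' I s ε hεs hεA ρ hρ ρ' hρ' N0 hN0
  obtain ⟨Φ, hΦ, hΦm, hΦ2⟩ := identify ε s hεs ρ' κ _ N0 hκ1 hκ2 hκ3 H2
  exact tor_of_koszul I ε hεA H1 Φ hΦ hΦm n (hΦ2 n).1 (hΦ2 n).2

end DataPart

section GeomPart
open TensorProduct

lemma exists_derivation {k A B C R : Type u} [CommRing k] [CommRing A] [CommRing B] [CommRing C]
    [CommRing R] [Algebra k A] [Algebra k B] [Algebra k C] [Algebra A C] [Algebra B C]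
    [IsScalarTower k A C] [IsScalarTower k B C] [Algebra.IsPushout k B A C]
    [Algebra C R] [Algebra A R] [Algebra B R] [IsScalarTower A C R] [IsScalarTower B C R]
    [Algebra.FormallyEtale C R] :
    ∃ D : Derivation ℤ R (R ⊗[A] Ω[A⁄k]),
      (∀ a, D (algebraMap A R a) = 1 ⊗ₜ KaehlerDifferential.D k A a) ∧
      (∀ b, D (algebraMap B R b) = 0) := by
  let e1 := (KaehlerDifferential.tensorKaehlerEquivOfFormallyEtale B C R).symm
  let e2 : R ⊗[C] Ω[C⁄B] ≃ₗ[R] R ⊗[C] (C ⊗[A] Ω[A⁄k]) :=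
    (KaehlerDifferential.tensorKaehlerEquiv k B A C).symm.baseChange C R _ _
  let e3 : R ⊗[C] (C ⊗[A] Ω[A⁄k]) ≃ₗ[R] R ⊗[A] Ω[A⁄k] :=
    TensorProduct.AlgebraTensorModule.cancelBaseChange A C R R (Ω[A⁄k])
  let e : Ω[R⁄B] →ₗ[R] R ⊗[A] Ω[A⁄k] := (e1.trans (e2.trans e3)).toLinearMap
  have he : ∀ w, e w = e3 (e2 (e1 w)) := fun w => rfl
  have h1 : ∀ c, e1 (KaehlerDifferential.D B R (algebraMap C R c)) = 1 ⊗ₜ KaehlerDifferential.D B C c :=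
    fun c => KaehlerDifferential.tensorKaehlerEquivOfFormallyEtale_symm_D_algebraMap B C R c
  refine ⟨(e.compDer (KaehlerDifferential.D B R)).restrictScalars ℤ, fun a => ?_, fun b => ?_⟩
  · change e (KaehlerDifferential.D B R (algebraMap A R a)) = _
    rw [he, IsScalarTower.algebraMap_apply A C R, h1]
    have h2 : (KaehlerDifferential.tensorKaehlerEquiv k B A C).symm
        (KaehlerDifferential.D B C (algebraMap A C a)) = 1 ⊗ₜ KaehlerDifferential.D k A a := by
      rw [LinearEquiv.symm_apply_eq, KaehlerDifferential.tensorKaehlerEquiv_tmul_D, one_smul]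
    have h3 : e2 (1 ⊗ₜ KaehlerDifferential.D B C (algebraMap A C a)) =
      1 ⊗ₜ ((KaehlerDifferential.tensorKaehlerEquiv k B A C).symm
        (KaehlerDifferential.D B C (algebraMap A C a))) := rfl
    rw [h3, h2]
    change TensorProduct.AlgebraTensorModule.cancelBaseChange A C R R (Ω[A⁄k]) _ = _
    rw [TensorProduct.AlgebraTensorModule.cancelBaseChange_tmul, one_smul]
  · change e (KaehlerDifferential.D B R (algebraMap B R b)) = _
    rw [Derivation.map_algebraMap, map_zero]

lemma exists_retraction {k A : Type u} [CommRing k] [CommRing A] [Algebra k A] (I : Ideal A)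
    [Algebra.FormallySmooth k A] [Algebra.FormallySmooth k (A ⧸ I)] :
    ∃ ρ : Ω[A⁄k] →ₗ[A] I.Cotangent, ∀ x : I, ρ (KaehlerDifferential.D k A x) = I.toCotangent x := by
  obtain ⟨l, hl⟩ := (Algebra.FormallySmooth.iff_split_injection (R := k) (P := A) (A := A ⧸ I)
    Ideal.Quotient.mk_surjective).1 inferInstance
  have key : ∀ K : Ideal A, K = I → ∀ l : (A ⧸ I) ⊗[A] Ω[A⁄k] →ₗ[A] K.Cotangent,
    (∀ x : K, l (1 ⊗ₜ KaehlerDifferential.D k A x) = K.toCotangent x) →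
    ∃ ρ : Ω[A⁄k] →ₗ[A] I.Cotangent, ∀ x : I, ρ (KaehlerDifferential.D k A x) = I.toCotangent x := by
    rintro K rfl l hl
    exact ⟨l.comp (TensorProduct.mk A (A ⧸ K) (Ω[A⁄k]) 1), hl⟩
  refine key (RingHom.ker (algebraMap A (A ⧸ I))) Ideal.mk_ker l fun x => ?_
  exact LinearMap.congr_fun hl (Ideal.toCotangent _ x)

attribute [local instance] Algebra.TensorProduct.rightAlgebra

theorem exists_R {k A B : Type u} [Field k] [CharZero k] [CommRing A] [CommRing B] [Algebra k A]
    [Algebra k B] [Algebra.FiniteType k A] [Algebra.FiniteType k B] (p : A →ₐ[k] B) :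
    ∃ (R : Type u) (_ : CommRing R) (_ : Algebra A R) (_ : Algebra k R) (_ : IsScalarTower k A R)
      (_ : Module.Flat A R) (_ : IsNoetherianRing R) (s : B →+* R) (ε : R →+* B)
      (D : Derivation ℤ R (R ⊗[A] Ω[A⁄k])),
      (∀ b, ε (s b) = b) ∧ (∀ a, ε (algebraMap A R a) = p a) ∧
      (∀ c, s (algebraMap k B c) = algebraMap k R c) ∧
      (RingHom.ker ε = Ideal.span (Set.range fun a => algebraMap A R a - s (p a))) ∧
      (RingHom.ker ε ≤ Ideal.jacobson ⊥) ∧ (∀ n : ℕ, IsUnit ((n + 1 : ℕ) : R)) ∧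
      (∀ a, D (algebraMap A R a) = 1 ⊗ₜ KaehlerDifferential.D k A a) ∧
      (∀ b, D (s b) = 0) := by
  obtain ⟨μ, hμ⟩ : ∃ μ : A ⊗[k] B →ₐ[k] B, ∀ a b, μ (a ⊗ₜ b) = p a * b :=
    ⟨Algebra.TensorProduct.lift p (AlgHom.id k B) (fun _ _ => Commute.all _ _), fun a b => by simp⟩
  have hkerμ : ∀ c, c - (1 ⊗ₜ μ c : A ⊗[k] B) ∈
      Ideal.span (Set.range fun a => (a ⊗ₜ 1 - 1 ⊗ₜ p a : A ⊗[k] B)) := by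
    intro c
    induction c with
    | zero => simp
    | add x y hx hy =>
      have := add_mem hx hy
      convert this using 1
      rw [map_add, TensorProduct.tmul_add]; ring
    | tmul a b =>
      have h1 : (a ⊗ₜ b - 1 ⊗ₜ μ (a ⊗ₜ b) : A ⊗[k] B) = (1 ⊗ₜ b) * (a ⊗ₜ 1 - 1 ⊗ₜ p a) := by
        rw [hμ, mul_sub, Algebra.TensorProduct.tmul_mul_tmul, Algebra.TensorProduct.tmul_mul_tmul,
          one_mul, mul_one, one_mul, mul_comm]
      rw [h1]
      exact Ideal.mul_mem_left _ _ (Ideal.subset_span ⟨a, rfl⟩)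
  let S : Submonoid (A ⊗[k] B) := MonoidHom.mker (μ : A ⊗[k] B →* B)
  have hS : ∀ c, c ∈ S ↔ μ c = 1 := fun c => Iff.rfl
  let R := Localization S
  let ε : R →+* B := IsLocalization.lift (M := S) (g := (μ : A ⊗[k] B →+* B)) fun c => by
    have := (hS c).1 c.2
    change IsUnit (μ c)
    rw [this]; exact isUnit_one
  have hε : ∀ c, ε (algebraMap (A ⊗[k] B) R c) = μ c := fun c => IsLocalization.lift_eq _ _
  let s : B →+* R := algebraMap B R
  have hs : ∀ b, s b = algebraMap (A ⊗[k] B) R (1 ⊗ₜ b) := fun b => rfl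
  have hA : ∀ a, algebraMap A R a = algebraMap (A ⊗[k] B) R (a ⊗ₜ 1) := fun b => rfl
  have hrep : ∀ r : R, ∃ c : A ⊗[k] B, ∃ t u : R, t * u = 1 ∧ ε t = 1 ∧
      r = algebraMap (A ⊗[k] B) R c * u := by
    intro r
    obtain ⟨c, t, rfl⟩ := IsLocalization.exists_mk'_eq S r
    refine ⟨c, algebraMap (A ⊗[k] B) R t, IsLocalization.mk' R 1 t, ?_, ?_, ?_⟩
    · rw [IsLocalization.mul_mk'_eq_mk'_of_mul, mul_one, IsLocalization.mk'_self]
    · rw [hε]; exact t.2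
    · rw [IsLocalization.mul_mk'_eq_mk'_of_mul, mul_one]
  have hεu : ∀ t u : R, t * u = 1 → ε t = 1 → ε u = 1 := fun t u h h' => by
    have := congrArg ε h
    rwa [map_mul, h', one_mul, map_one] at this
  have hnoe : IsNoetherianRing R := by
    have hft : Algebra.FiniteType k (A ⊗[k] B) :=
      Algebra.FiniteType.trans (S := A) inferInstance inferInstance
    have : IsNoetherianRing (A ⊗[k] B) := Algebra.FiniteType.isNoetherianRing k _
    exact IsLocalization.isNoetherianRing S R inferInstance
  have hflat : Module.Flat A R := by
    have : Module.Flat (A ⊗[k] B) R := IsLocalization.flat R S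
    exact Module.Flat.trans A (A ⊗[k] B) R
  have het : Algebra.FormallyEtale (A ⊗[k] B) R := Algebra.FormallyEtale.of_isLocalization S
  obtain ⟨D, hDA, hDB⟩ := exists_derivation (k := k) (A := A) (B := B) (C := A ⊗[k] B) (R := R)
  refine ⟨R, inferInstance, inferInstance, inferInstance, inferInstance, hflat, hnoe, s, ε, D,
    fun b => ?_, fun a => ?_, fun c => ?_, ?_, ?_, fun n => ?_, hDA, hDB⟩
  · rw [hs, hε, hμ, map_one, one_mul]
  · rw [hA, hε, hμ, mul_one]
  · rw [hs, IsScalarTower.algebraMap_apply k (A ⊗[k] B) R, Algebra.TensorProduct.algebraMap_apply',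
      ]
  · apply le_antisymm
    · intro r hr
      obtain ⟨c, t, u, htu, ht, rfl⟩ := hrep r
      rw [RingHom.mem_ker, map_mul, hε, hεu t u htu ht, mul_one] at hr
      apply Ideal.mul_mem_right
      have h1 := Ideal.mem_map_of_mem (algebraMap (A ⊗[k] B) R) (hkerμ c)
      rw [hr, TensorProduct.tmul_zero, sub_zero, Ideal.map_span, ← Set.range_comp] at h1
      have h2 : (algebraMap (A ⊗[k] B) R ∘ fun a => (a ⊗ₜ 1 - 1 ⊗ₜ p a : A ⊗[k] B)) =
          fun a => algebraMap A R a - s (p a) := by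
        funext a
        rw [Function.comp_apply, map_sub, hs, hA]
      rwa [h2] at h1
    · rw [Ideal.span_le]
      rintro _ ⟨a, rfl⟩
      change _ ∈ RingHom.ker ε
      rw [RingHom.mem_ker, map_sub, hs, hA, hε, hε, hμ, hμ]
      simp
  · intro x hx
    rw [Ideal.mem_jacobson_bot]
    intro y
    have h1 : ε (x * y + 1) = 1 := by
      rw [map_add, map_mul, (RingHom.mem_ker).1 hx, zero_mul, zero_add, map_one]
    obtain ⟨c, t, u, htu, ht, h2⟩ := hrep (x * y + 1)
    rw [h2] at h1 ⊢
    rw [map_mul, hε, hεu t u htu ht, mul_one] at h1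
    refine IsUnit.mul (IsLocalization.map_units R (⟨c, h1⟩ : S)) (IsUnit.of_mul_eq_one t ?_)
    rw [mul_comm]; exact htu
  · have h1 : IsUnit ((n + 1 : ℕ) : k) := IsUnit.mk0 _ (Nat.cast_ne_zero.2 (Nat.succ_ne_zero n))
    have := h1.map (algebraMap k R)
    rwa [map_natCast] at this

end GeomPart

/-- In the smooth affine setting (A smooth over k, B = A/I smooth over k),
Tor_n^A(B, B) is isomorphic, as a module over B = A/I (equivalently, A-linearly, since
I acts by zero on both sides), to the n-th exterior power over B of the conormal module
I/I². -/
theorem tor_quotient_eq_exterior_power_conormal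
    (k : Type u) [Field k] [CharZero k]
    (A : Type u) [CommRing A] [Algebra k A]
    [Algebra.FormallySmooth k A] [Algebra.FinitePresentation k A]
    (I : Ideal A)
    [Algebra.FormallySmooth k (A ⧸ I)] [Algebra.FinitePresentation k (A ⧸ I)]
    (n : ℕ) :
    Nonempty (
      (((Tor (ModuleCat.{u} A) n).obj (ModuleCat.of A (A ⧸ I))).obj
          (ModuleCat.of A (A ⧸ I)))
        ≃ₗ[A]
      (RestrictScalars A (A ⧸ I) (⋀[A ⧸ I]^n I.Cotangent))) := by
  cases n with
  | zero =>
    obtain ⟨e⟩ := tor_zero I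
    let z := exteriorPower.zeroEquiv (R := A ⧸ I) (M := I.Cotangent)
    let w := RestrictScalars.addEquiv A (A ⧸ I) (⋀[A ⧸ I]^0 I.Cotangent)
    let v : (A ⧸ I) ≃ₗ[A] RestrictScalars A (A ⧸ I) (⋀[A ⧸ I]^0 I.Cotangent) :=
      { toFun := fun b => w.symm (z.symm b)
        map_add' := fun x y => by rw [map_add, map_add]
        map_smul' := fun a x => by
          rw [RingHom.id_apply, ← RestrictScalars.addEquiv_symm_map_algebraMap_smul, ← map_smul]
          rfl
        invFun := fun t => z (w t)
        left_inv := fun x => by simp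
        right_inv := fun x => by simp }
    exact ⟨e.trans v⟩
  | succ n =>
    obtain ⟨ρ, hρ⟩ := exists_retraction (k := k) I
    obtain ⟨R, i1, i2, i3, i4, i5, i6, s, ε, D, h1, h2, h3, h4, h5, h6, h7, h8⟩ :=
      exists_R (k := k) (Ideal.Quotient.mkₐ k I)
    exact tor_of_data I s ε h1 h2 h3 h4 h5 h6 D h7 h8 ρ hρ n
end
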